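/- Let n be a positive squarefree integer with n ≡ 1 (mod 8), with all (distinct) prime factors congruent to 1 modulo 4, with h_4(n) = 1, and suppose h_8(n) ≡ (d(n) − 1)/4 (mod 2). Then the group of rational points of the elliptic curve E^(n): y² = x³ − n²·x over ℚ is finite; in particular n is not a congruent number, i.e., n is not the area of any right triangle with rational side lengths. -/

import Mathlib

/-- all prime factors are `1 mod 4` -/
def PP (m : ℕ) : Prop := ∀ q : ℕ, q.Prime → q ∣ m → q % 4 = 1

theorem PP.mod4 {m : ℕ} (h : PP m) (hm : m ≠ 0) : m % 4 = 1 := by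
  revert h hm
  induction m using Nat.recOnMul with
  | zero => intro _ h; exact absurd rfl h
  | one => intros; rfl
  | prime p hp => intro h _; exact h p hp dvd_rfl
  | mul a b iha ihb =>
    intro h hab
    have h1 := iha (fun q hq hd => h q hq (hd.mul_right b)) (left_ne_zero_of_mul hab)
    have h2 := ihb (fun q hq hd => h q hq (hd.mul_left a)) (right_ne_zero_of_mul hab)
    rw [Nat.mul_mod, h1, h2]

theorem PP.dvd {m k : ℕ} (h : PP m) (hk : k ∣ m) : PP k := fun q hq hd => h q hq (hd.trans hk)

theorem PP.odd {m : ℕ} (h : PP m) (hm : m ≠ 0) : Odd m := by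
  have := h.mod4 hm
  rw [Nat.odd_iff]; omega

theorem jac_prod {a b : ℤ} {m : ℕ} (hm : m ≠ 0)
    (h : ∀ p : ℕ, p.Prime → p ∣ m → jacobiSym a p = jacobiSym b p) :
    jacobiSym a m = jacobiSym b m := by
  revert h hm
  induction m using Nat.recOnMul with
  | zero => intro h; exact absurd rfl h
  | one => intros; simp
  | prime p hp => intro _ h; exact h p hp dvd_rfl
  | mul x y ihx ihy =>
    intro hxy h
    have hx := left_ne_zero_of_mul hxy
    have hy := right_ne_zero_of_mul hxy
    rw [jacobiSym.mul_right' _ hx hy, jacobiSym.mul_right' _ hx hy,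
      ihx hx (fun q hq hd => h q hq (hd.mul_right y)),
      ihy hy (fun q hq hd => h q hq (hd.mul_left x))]

theorem jac_prod_one {a : ℤ} {m : ℕ} (hm : m ≠ 0)
    (h : ∀ p : ℕ, p.Prime → p ∣ m → jacobiSym a p = 1) : jacobiSym a m = 1 := by
  rw [← jacobiSym.one_left m]
  exact jac_prod hm (fun p hp hd => by rw [h p hp hd, jacobiSym.one_left])

theorem jac_congr {a b : ℤ} {m : ℕ} (h : (m : ℤ) ∣ a - b) : jacobiSym a m = jacobiSym b m :=
  jacobiSym.mod_left' (Int.emod_eq_emod_iff_emod_sub_eq_zero.2 (Int.emod_eq_zero_of_dvd h))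

theorem jac_sq {A x t : ℤ} {m : ℕ} (h : (m : ℤ) ∣ A * x ^ 2 - t ^ 2) (ht : IsCoprime t (m : ℤ)) :
    jacobiSym A m = 1 := by
  have h1 := jac_congr h
  rw [jacobiSym.sq_one' (Int.isCoprime_iff_gcd_eq_one.1 ht), jacobiSym.mul_left, jacobiSym.pow_left] at h1
  rcases jacobiSym.trichotomy A m with h2 | h2 | h2
  · rw [h2] at h1; simp at h1
  · exact h2
  · rw [h2] at h1; nlinarith [sq_nonneg (jacobiSym x m)]

theorem jac_sq_prime {A x t : ℤ} {p : ℕ} (hp : p.Prime) (h : (p : ℤ) ∣ A * x ^ 2 - t ^ 2)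
    (ht : ¬ (p : ℤ) ∣ t) : jacobiSym A p = 1 :=
  jac_sq h ((Nat.prime_iff_prime_int.1 hp).coprime_iff_not_dvd.2 ht).symm

/-- if `a x² ≡ b y²` mod p, then `ab` is a square mod `p`. -/
theorem jac_loc {a b x y : ℤ} {p : ℕ} (hp : p.Prime) (h : (p : ℤ) ∣ a * x ^ 2 - b * y ^ 2)
    (hb : ¬ (p : ℤ) ∣ b) (hy : ¬ (p : ℤ) ∣ y) : jacobiSym (a * b) p = 1 := by
  refine jac_sq_prime (x := x) (t := b * y) hp ?_ ?_
  · obtain ⟨k, hk⟩ := h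
    exact ⟨b * k, by linear_combination b * hk⟩
  · exact fun h => ((Nat.prime_iff_prime_int.1 hp).dvd_or_dvd h).elim hb hy

theorem jac_neg_one {m : ℕ} (h : PP m) (hm : m ≠ 0) : jacobiSym (-1) m = 1 := by
  rw [jacobiSym.at_neg_one (h.odd hm), ZMod.χ₄_nat_one_mod_four (h.mod4 hm)]

theorem jac_neg {m : ℕ} (h : PP m) (hm : m ≠ 0) (a : ℤ) : jacobiSym (-a) m = jacobiSym a m := by
  rw [neg_eq_neg_one_mul, jacobiSym.mul_left, jac_neg_one h hm, one_mul]

theorem jac_abs {m : ℕ} (h : PP m) (hm : m ≠ 0) (a : ℤ) :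
    jacobiSym (a.natAbs : ℤ) m = jacobiSym a m := by
  rcases Int.natAbs_eq a with h1 | h1
  · rw [← h1]
  · conv_rhs => rw [h1]
    rw [jac_neg h hm]

/-- reciprocity -/
theorem jac_recip {m : ℕ} (h : PP m) (hm : m ≠ 0) {a : ℤ} (ha : Odd a) :
    jacobiSym a m = jacobiSym m a.natAbs := by
  rw [← jac_abs h hm]
  exact jacobiSym.quadratic_reciprocity_one_mod_four' (Int.natAbs_odd.2 ha) (h.mod4 hm)

theorem jac_recip_nat {m k : ℕ} (h : PP m) (hm : m ≠ 0) (ha : Odd k) :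
    jacobiSym k m = jacobiSym m k := 
  jacobiSym.quadratic_reciprocity_one_mod_four' ha (h.mod4 hm)

theorem jac_even {D : ℤ} {M : ℕ} (hM : M ≠ 0) (hc : IsCoprime D (M : ℤ))
    (h : ∀ q : ℕ, q.Prime → q ∣ M → jacobiSym D q = -1 → Even (M.factorization q)) :
    jacobiSym D M = 1 := by
  revert hM hc h
  induction M using Nat.recOnPosPrimePosCoprime with
  | zero => intro h; exact absurd rfl h
  | one => intros; simp
  | prime_pow p n hp hn =>
    intro _ hc h
    rw [jacobiSym.pow_right]
    have hcp : IsCoprime D (p : ℤ) := by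
      push_cast at hc
      exact (IsCoprime.pow_right_iff hn).1 hc
    rcases jacobiSym.eq_one_or_neg_one (Int.isCoprime_iff_gcd_eq_one.1 hcp) with h1 | h1
    · rw [h1, one_pow]
    · have := h p hp (dvd_pow_self p hn.ne') h1
      rw [hp.factorization_pow, Finsupp.single_eq_same] at this
      rw [h1, this.neg_one_pow]
  | coprime a b ha hb hab iha ihb =>
    intro h0 hc h
    have ha0 : a ≠ 0 := by omega
    have hb0 : b ≠ 0 := by omega
    push_cast at hc
    rw [jacobiSym.mul_right' _ ha0 hb0, iha ha0 hc.of_mul_right_left, ihb hb0 hc.of_mul_right_right, one_mul]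
    · intro q hq hd h1
      have := h q hq (hd.mul_left a) h1
      rw [Nat.factorization_mul ha0 hb0, Finsupp.add_apply,
        Nat.factorization_eq_zero_of_not_dvd (n := a)] at this
      · simpa using this
      · intro h2; exact hq.one_lt.ne' (Nat.dvd_one.1 (hab ▸ Nat.dvd_gcd h2 hd))
    · intro q hq hd h1
      have := h q hq (hd.mul_right b) h1
      rw [Nat.factorization_mul ha0 hb0, Finsupp.add_apply,
        Nat.factorization_eq_zero_of_not_dvd (n := b)] at this
      · simpa using this
      · intro h2; exact hq.one_lt.ne' (Nat.dvd_one.1 (hab ▸ Nat.dvd_gcd hd h2))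

theorem val_even {D : ℤ} {q : ℕ} (hq : q.Prime) (hD : jacobiSym D q = -1) (N : ℕ) :
    ∀ X Y : ℤ, (N : ℤ) = X ^ 2 - D * Y ^ 2 → N ≠ 0 → Even (N.factorization q) := by
  induction N using Nat.strong_induction_on with
  | _ N ih =>
    intro X Y h h0
    by_cases hd : q ∣ N
    · haveI := Fact.mk hq
      have h1 := jacobiSym.prime_dvd_of_eq_neg_one hD (x := X) (y := Y)
        (by rw [← h]; exact_mod_cast hd)
      obtain ⟨⟨X', rfl⟩, ⟨Y', rfl⟩⟩ := h1
      have h2 : (N : ℤ) = q ^ 2 * (X' ^ 2 - D * Y' ^ 2) := by rw [h]; ring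
      have h3 : q ^ 2 ∣ N := by
        have : ((q ^ 2 : ℕ) : ℤ) ∣ N := by push_cast; exact ⟨_, h2⟩
        exact_mod_cast this
      obtain ⟨N', rfl⟩ := h3
      have hN' : N' ≠ 0 := right_ne_zero_of_mul h0
      have h4 := ih N' (by
        have : 1 < q ^ 2 := Nat.one_lt_pow (by norm_num) hq.one_lt
        have : 0 < N' := Nat.pos_of_ne_zero hN'
        nlinarith) X' Y' (by
          push_cast at h2
          have : (q : ℤ) ^ 2 ≠ 0 := by exact_mod_cast pow_ne_zero 2 hq.ne_zero
          exact mul_left_cancel₀ this h2) hN'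
      rw [Nat.factorization_mul (pow_ne_zero 2 hq.ne_zero) hN', Finsupp.add_apply,
        hq.factorization_pow, Finsupp.single_eq_same]
      exact even_two.add h4
    · rw [Nat.factorization_eq_zero_of_not_dvd hd]; exact Even.zero

/-- parity of valuations of one factor of a norm -/
theorem val_even_partner {D : ℤ} {q : ℕ} (hq : q.Prime) (hD : jacobiSym D q = -1) {M M' : ℕ}
    (hM : M ≠ 0) (hM' : ¬ q ∣ M') (X Y : ℤ) (h : (M : ℤ) * M' = X ^ 2 - D * Y ^ 2) :
    Even (M.factorization q) := by
  have hM0 : M' ≠ 0 := fun h => hM' (h ▸ dvd_zero q)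
  have := val_even hq hD (M * M') X Y (by push_cast; exact h) (mul_ne_zero hM hM0)
  rwa [Nat.factorization_mul hM hM0, Finsupp.add_apply, Nat.factorization_eq_zero_of_not_dvd hM',
    add_zero] at this

/-- parity of valuations of one factor of a multiple of a square -/
theorem val_even_partner' {q : ℕ} (hq : q.Prime) {M M' m k : ℕ}
    (hM : M ≠ 0) (hM' : ¬ q ∣ M') (hm : ¬ q ∣ m) (h : M * M' = m * k ^ 2) :
    Even (M.factorization q) := by
  have hM0 : M' ≠ 0 := fun h => hM' (h ▸ dvd_zero q)
  have hm0 : m ≠ 0 := fun h => hm (h ▸ dvd_zero q)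
  have hk : k ^ 2 ≠ 0 := by
    intro h1; rw [h1, mul_zero] at h
    exact mul_ne_zero hM hM0 h
  have h1 := congrArg (fun z => z.factorization q) h
  simp only [Nat.factorization_mul hM hM0, Nat.factorization_mul hm0 hk, Finsupp.add_apply,
    Nat.factorization_eq_zero_of_not_dvd hM', Nat.factorization_eq_zero_of_not_dvd hm,
    Nat.factorization_pow, Finsupp.smul_apply, smul_eq_mul] at h1
  exact ⟨k.factorization q, by omega⟩

theorem sqsplit {a b n c : ℕ} (hab : Nat.Coprime a b) (h : a * b = n * c ^ 2) (hn : 0 < n) :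
    ∃ n1 n2 k l : ℕ, n = n1 * n2 ∧ a = n1 * k ^ 2 ∧ b = n2 * l ^ 2 := by
  have h1 : n = Nat.gcd n a * Nat.gcd n b := by
    rw [← Nat.Coprime.gcd_mul n hab, h]
    simp
  obtain ⟨a', ha'⟩ := Nat.gcd_dvd_right n a
  obtain ⟨b', hb'⟩ := Nat.gcd_dvd_right n b
  set n1 := Nat.gcd n a
  set n2 := Nat.gcd n b
  have h2 : a' * b' = c ^ 2 := by
    have : n * (a' * b') = n * c ^ 2 := by
      rw [← h]
      calc n * (a' * b') = (n1 * n2) * (a' * b') := by rw [← h1]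
        _ = (n1 * a') * (n2 * b') := by ring
        _ = a * b := by rw [← ha', ← hb']
    exact Nat.eq_of_mul_eq_mul_left hn this
  have hc : Nat.Coprime a' b' :=
    (hab.coprime_dvd_left (Dvd.intro_left _ ha'.symm)).coprime_dvd_right (Dvd.intro_left _ hb'.symm)
  obtain ⟨k, hk⟩ := exists_eq_pow_of_mul_eq_pow (Nat.isUnit_iff.2 hc) h2
  obtain ⟨l, hl⟩ := exists_eq_pow_of_mul_eq_pow (Nat.isUnit_iff.2 hc.symm) ((mul_comm b' a').trans h2)
  exact ⟨n1, n2, k, l, h1, by rw [← hk]; exact ha', by rw [← hl]; exact hb'⟩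


theorem crt_sq {a : ℕ} (ha : Squarefree a) (x : ℤ)
    (h : ∀ p : ℕ, p.Prime → p ∣ a → jacobiSym x p = 1 ∨ (p : ℤ) ∣ x) :
    ∃ t : ℤ, (a : ℤ) ∣ t ^ 2 - x := by
  revert ha h
  induction a using Nat.recOnMul with
  | zero => intro h; simp at h
  | one => intros; exact ⟨0, by simp⟩
  | prime p hp =>
    intro _ h
    rcases h p hp dvd_rfl with h | h
    · haveI := Fact.mk hp
      obtain ⟨r, hr⟩ := ZMod.isSquare_of_jacobiSym_eq_one h
      refine ⟨(r.val : ℤ), ?_⟩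
      rw [← ZMod.intCast_zmod_eq_zero_iff_dvd]
      push_cast
      rw [ZMod.natCast_zmod_val, hr]; ring
    · exact ⟨0, by simpa using h⟩
  | mul a b iha ihb =>
    intro hsf h
    obtain ⟨hab, ha, hb⟩ := Nat.squarefree_mul_iff.1 hsf
    obtain ⟨t, ht⟩ := iha ha (fun p hp hd => h p hp (hd.mul_right b))
    obtain ⟨u, hu⟩ := ihb hb (fun p hp hd => h p hp (hd.mul_left a))
    have hc : IsCoprime (a : ℤ) (b : ℤ) := Nat.isCoprime_iff_coprime.2 hab
    obtain ⟨r, s, hrs⟩ := hc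
    refine ⟨t * (s * b) + u * (r * a), ?_⟩
    push_cast
    refine IsCoprime.mul_dvd (Nat.isCoprime_iff_coprime.2 hab) ?_ ?_
    · have h1 : (t * (s * b) + u * (r * a)) - t = a * (r * (u - t)) := by
        linear_combination t * hrs
      have : (t * (s * b) + u * (r * a)) ^ 2 - x = ((t * (s * b) + u * (r * a)) - t) * ((t * (s * b) + u * (r * a)) + t) + (t ^ 2 - x) := by ring
      rw [this, h1]
      exact dvd_add ((Dvd.intro _ rfl : (a : ℤ) ∣ a * (r * (u - t))).mul_right _) ht
    · have h1 : (t * (s * b) + u * (r * a)) - u = b * (s * (t - u)) := by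
        linear_combination u * hrs
      have : (t * (s * b) + u * (r * a)) ^ 2 - x = ((t * (s * b) + u * (r * a)) - u) * ((t * (s * b) + u * (r * a)) + u) + (u ^ 2 - x) := by ring
      rw [this, h1]
      exact dvd_add ((Dvd.intro _ rfl : (b : ℤ) ∣ b * (s * (t - u))).mul_right _) hu

theorem sqrt_box (N : ℕ) (hN : 0 < N) :
    N ≤ (Nat.sqrt (N - 1) + 1) ^ 2 ∧ ∀ x y : Fin (Nat.sqrt (N - 1) + 1),
      (((x : ℕ) : ℤ) - ((y : ℕ) : ℤ)) ^ 2 < N := by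
  constructor
  · have := Nat.lt_succ_sqrt (N - 1)
    simp only [Nat.succ_eq_add_one] at this
    rw [pow_two]; omega
  · intro x y
    have h1 : ((x : ℕ) : ℤ) ≤ Nat.sqrt (N - 1) := by have := x.2; omega
    have h2 : ((y : ℕ) : ℤ) ≤ Nat.sqrt (N - 1) := by have := y.2; omega
    have h3 : (0 : ℤ) ≤ ((x : ℕ) : ℤ) := by positivity
    have h4 : (0 : ℤ) ≤ ((y : ℕ) : ℤ) := by positivity
    have h5 : ((Nat.sqrt (N - 1) : ℕ) : ℤ) * (Nat.sqrt (N - 1) : ℕ) < N := by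
      have := Nat.sqrt_le (N - 1)
      have : Nat.sqrt (N - 1) * Nat.sqrt (N - 1) < N := by omega
      exact_mod_cast this
    nlinarith

theorem legendre {a b c : ℕ} (ha : 0 < a) (hb : 0 < b) (hc : 0 < c)
    (hab : Nat.Coprime a b) (hac : Nat.Coprime a c) (hbc : Nat.Coprime b c)
    (h1 : ∃ t : ℤ, (a : ℤ) ∣ t ^ 2 - b * c) (h2 : ∃ t : ℤ, (b : ℤ) ∣ t ^ 2 - a * c)
    (h3 : ∃ t : ℤ, (c : ℤ) ∣ t ^ 2 + a * b) :
    ∃ x y z : ℤ, z ≠ 0 ∧ a * x ^ 2 + b * y ^ 2 = c * z ^ 2 := by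
  by_cases hsq : IsSquare (a * c)
  · obtain ⟨r, hr⟩ := hsq
    refine ⟨c, 0, r, ?_, ?_⟩
    · rintro h
      have : r = 0 := by exact_mod_cast h
      rw [this] at hr
      have := Nat.mul_pos ha hc
      omega
    · have : (a : ℤ) * c = r * r := by exact_mod_cast hr
      linear_combination (c : ℤ) * this
  obtain ⟨t1, ht1⟩ := h1
  obtain ⟨t2, ht2⟩ := h2
  obtain ⟨t3, ht3⟩ := h3
  haveI : NeZero a := ⟨ha.ne'⟩
  haveI : NeZero b := ⟨hb.ne'⟩
  haveI : NeZero c := ⟨hc.ne'⟩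
  obtain ⟨hX1, hX2⟩ := sqrt_box (b * c) (Nat.mul_pos hb hc)
  obtain ⟨hY1, hY2⟩ := sqrt_box (a * c) (Nat.mul_pos ha hc)
  obtain ⟨hZ1, hZ2⟩ := sqrt_box (a * b) (Nat.mul_pos ha hb)
  have hY1' : a * c < (Nat.sqrt (a * c - 1) + 1) ^ 2 :=
    lt_of_le_of_ne hY1 (fun h => hsq ⟨_, h.trans (pow_two _)⟩)
  set kX := Nat.sqrt (b * c - 1) + 1
  set kY := Nat.sqrt (a * c - 1) + 1
  set kZ := Nat.sqrt (a * b - 1) + 1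
  let f : Fin kX × Fin kY × Fin kZ → ZMod a × ZMod b × ZMod c := fun v =>
    (((b * (v.2.1 : ℕ) - t1 * (v.2.2 : ℕ) : ℤ) : ZMod a),
     ((a * (v.1 : ℕ) - t2 * (v.2.2 : ℕ) : ℤ) : ZMod b),
     ((a * (v.1 : ℕ) - t3 * (v.2.1 : ℕ) : ℤ) : ZMod c))
  have hcard : Fintype.card (ZMod a × ZMod b × ZMod c) < Fintype.card (Fin kX × Fin kY × Fin kZ) := by
    simp only [Fintype.card_prod, ZMod.card, Fintype.card_fin]
    refine lt_of_pow_lt_pow_left₀ 2 (Nat.zero_le _) ?_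
    calc (a * (b * c)) ^ 2 = (b * c) * ((a * c) * (a * b)) := by ring
      _ < (b * c) * (kY ^ 2 * (a * b)) := by
        have : 0 < a * b := Nat.mul_pos ha hb
        have : 0 < b * c := Nat.mul_pos hb hc
        gcongr
      _ ≤ kX ^ 2 * (kY ^ 2 * kZ ^ 2) := by gcongr
      _ = _ := by ring
  obtain ⟨v, w, hvw, hf⟩ := Fintype.exists_ne_map_eq_of_card_lt f hcard
  simp only [f, Prod.mk.injEq] at hf
  obtain ⟨e1, e2, e3⟩ := hf
  have hX := hX2 v.1 w.1
  have hY := hY2 v.2.1 w.2.1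
  have hZ := hZ2 v.2.2 w.2.2
  rw [ZMod.intCast_eq_intCast_iff_dvd_sub] at e1 e2 e3
  set X : ℤ := ((v.1 : ℕ) : ℤ) - ((w.1 : ℕ) : ℤ) with hXd
  set Y : ℤ := ((v.2.1 : ℕ) : ℤ) - ((w.2.1 : ℕ) : ℤ) with hYd
  set Z : ℤ := ((v.2.2 : ℕ) : ℤ) - ((w.2.2 : ℕ) : ℤ) with hZd
  have hne : ¬ (X = 0 ∧ Y = 0 ∧ Z = 0) := by
    rintro ⟨h1, h2, h3⟩
    apply hvw
    ext <;> omega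
  have cab : IsCoprime (a : ℤ) b := Nat.isCoprime_iff_coprime.2 hab
  have cac : IsCoprime (a : ℤ) c := Nat.isCoprime_iff_coprime.2 hac
  have cbc : IsCoprime (b : ℤ) c := Nat.isCoprime_iff_coprime.2 hbc
  have d1 : (a : ℤ) ∣ a * X ^ 2 + b * Y ^ 2 - c * Z ^ 2 := by
    apply cab.dvd_of_dvd_mul_left
    obtain ⟨k, hk⟩ := e1
    obtain ⟨l, hl⟩ := ht1
    refine ⟨b * X ^ 2 - k * (b * Y + t1 * Z) + l * Z ^ 2, ?_⟩
    linear_combination - (b * Y + t1 * Z) * hk + Z ^ 2 * hl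
  have d2 : (b : ℤ) ∣ a * X ^ 2 + b * Y ^ 2 - c * Z ^ 2 := by
    apply cab.symm.dvd_of_dvd_mul_left
    obtain ⟨k, hk⟩ := e2
    obtain ⟨l, hl⟩ := ht2
    refine ⟨a * Y ^ 2 - k * (a * X + t2 * Z) + l * Z ^ 2, ?_⟩
    linear_combination - (a * X + t2 * Z) * hk + Z ^ 2 * hl
  have d3 : (c : ℤ) ∣ a * X ^ 2 + b * Y ^ 2 - c * Z ^ 2 := by
    apply cac.symm.dvd_of_dvd_mul_left
    obtain ⟨k, hk⟩ := e3
    obtain ⟨l, hl⟩ := ht3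
    refine ⟨- a * Z ^ 2 - k * (a * X + t3 * Y) + l * Y ^ 2, ?_⟩
    linear_combination - (a * X + t3 * Y) * hk + Y ^ 2 * hl
  have d : (a * b * c : ℤ) ∣ a * X ^ 2 + b * Y ^ 2 - c * Z ^ 2 :=
    (cac.mul_left cbc).mul_dvd (cab.mul_dvd d1 d2) d3
  have pa : (0 : ℤ) < a := by exact_mod_cast ha
  have pb : (0 : ℤ) < b := by exact_mod_cast hb
  have pc : (0 : ℤ) < c := by exact_mod_cast hc
  push_cast at hX hY hZ
  have bX : a * X ^ 2 < a * b * c := by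
    have := mul_lt_mul_of_pos_left hX pa; linarith
  have bY : b * Y ^ 2 < a * b * c := by
    have := mul_lt_mul_of_pos_left hY pb; linarith
  have bZ : c * Z ^ 2 < a * b * c := by
    have := mul_lt_mul_of_pos_left hZ pc; linarith
  have sX : 0 ≤ a * X ^ 2 := by positivity
  have sY : 0 ≤ b * Y ^ 2 := by positivity
  have sZ : 0 ≤ c * Z ^ 2 := by positivity
  obtain ⟨k, hk⟩ := d
  have pabc : (0 : ℤ) < a * b * c := by positivity
  have k1 : -1 < k := by
    by_contra h
    have : a * b * c * k ≤ a * b * c * (-1) := by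
      apply mul_le_mul_of_nonneg_left _ pabc.le; omega
    linarith
  have k2 : k < 2 := by
    by_contra h
    have : a * b * c * 2 ≤ a * b * c * k := by
      apply mul_le_mul_of_nonneg_left _ pabc.le; omega
    linarith
  have : k = 0 ∨ k = 1 := by omega
  rcases this with rfl | rfl
  · refine ⟨X, Y, Z, ?_, by linarith⟩
    intro hZ0
    apply hne
    rw [hZ0] at hk
    have hx : a * X ^ 2 = 0 := by linarith
    have hy : b * Y ^ 2 = 0 := by linarith
    refine ⟨?_, ?_, hZ0⟩
    · simpa [ha.ne'] using hx
    · simpa [hb.ne'] using hy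
  · refine ⟨X * Z + b * Y, Y * Z - a * X, Z ^ 2 + a * b, by positivity, ?_⟩
    linear_combination (Z ^ 2 + a * b) * hk

/-- The theorem of Legendre with Jacobi symbol conditions -/
theorem legendre_jac {a b c : ℕ} (ha : Squarefree a) (hb : Squarefree b) (hc : Squarefree c)
    (hab : Nat.Coprime a b) (hac : Nat.Coprime a c) (hbc : Nat.Coprime b c)
    (h1 : ∀ p : ℕ, p.Prime → p ∣ a → jacobiSym (b * c) p = 1)
    (h2 : ∀ p : ℕ, p.Prime → p ∣ b → jacobiSym (a * c) p = 1)
    (h3 : ∀ p : ℕ, p.Prime → p ∣ c → jacobiSym (-(a * b)) p = 1) :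
    ∃ x y z : ℤ, z ≠ 0 ∧ a * x ^ 2 + b * y ^ 2 = c * z ^ 2 := by
  refine legendre (Nat.pos_of_ne_zero ha.ne_zero) (Nat.pos_of_ne_zero hb.ne_zero)
    (Nat.pos_of_ne_zero hc.ne_zero) hab hac hbc (crt_sq ha _ fun p hp hd => .inl (h1 p hp hd))
    (crt_sq hb _ fun p hp hd => .inl (h2 p hp hd)) ?_
  obtain ⟨t, ht⟩ := crt_sq hc _ fun p hp hd => .inl (h3 p hp hd)
  exact ⟨t, by simpa using ht⟩

/-! linear algebra -/

noncomputable def jbit (p : ℕ) (a : ℤ) : ZMod 2 := if jacobiSym a p = -1 then 1 else 0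

theorem jbit_one (p : ℕ) : jbit p 1 = 0 := by simp [jbit]

theorem jbit_eq_zero {p : ℕ} {a : ℤ} (h : IsCoprime a (p : ℤ)) : jbit p a = 0 ↔ jacobiSym a p = 1 := by
  unfold jbit
  rcases jacobiSym.eq_one_or_neg_one (Int.isCoprime_iff_gcd_eq_one.1 h) with h1 | h1 <;> rw [h1] <;>
    simp

theorem jbit_mul {p : ℕ} {a b : ℤ} (h : IsCoprime a (p : ℤ)) (h' : IsCoprime b (p : ℤ)) :
    jbit p (a * b) = jbit p a + jbit p b := by
  unfold jbit
  rw [jacobiSym.mul_left]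
  rcases jacobiSym.eq_one_or_neg_one (Int.isCoprime_iff_gcd_eq_one.1 h) with h1 | h1 <;>
  rcases jacobiSym.eq_one_or_neg_one (Int.isCoprime_iff_gcd_eq_one.1 h') with h2 | h2 <;>
  rw [h1, h2] <;> simp
  decide

theorem jbit_prod {ι : Type*} (p : ℕ) (q : ι → ℤ) (S : Finset ι)
    (h : ∀ i ∈ S, IsCoprime (q i) (p : ℤ)) :
    jbit p (∏ i ∈ S, q i) = ∑ i ∈ S, jbit p (q i) := by
  classical
  induction S using Finset.induction_on with
  | empty => simp [jbit_one]
  | insert i S hi ih =>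
    rw [Finset.prod_insert hi, Finset.sum_insert hi, jbit_mul, ih]
    · exact fun j hj => h j (Finset.mem_insert_of_mem hj)
    · exact h i (Finset.mem_insert_self _ _)
    · exact IsCoprime.prod_left fun j hj => h j (Finset.mem_insert_of_mem hj)

theorem jbit_prod_right {ι : Type*} (a : ℤ) (q : ι → ℕ) (S : Finset ι)
    (hq : ∀ i ∈ S, (q i) ≠ 0)
    (h : ∀ i ∈ S, IsCoprime a (q i : ℤ)) :
    jbit (∏ i ∈ S, q i) a = ∑ i ∈ S, jbit (q i) a := by
  classical
  induction S using Finset.induction_on with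
  | empty => simp [jbit]
  | insert i S hi ih =>
    rw [Finset.prod_insert hi, Finset.sum_insert hi, ← ih]
    · unfold jbit
      have h0 := hq i (Finset.mem_insert_self _ _)
      have h0' : ∏ i ∈ S, q i ≠ 0 :=
        Finset.prod_ne_zero_iff.2 fun j hj => hq j (Finset.mem_insert_of_mem hj)
      rw [jacobiSym.mul_right' _ h0 h0']
      have h1 := h i (Finset.mem_insert_self _ _)
      have h2 : IsCoprime a ((∏ i ∈ S, q i : ℕ) : ℤ) := by
        push_cast
        exact IsCoprime.prod_right fun j hj => h j (Finset.mem_insert_of_mem hj)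
      rcases jacobiSym.eq_one_or_neg_one (Int.isCoprime_iff_gcd_eq_one.1 h1) with h1 | h1 <;>
      rcases jacobiSym.eq_one_or_neg_one (Int.isCoprime_iff_gcd_eq_one.1 h2) with h2 | h2 <;>
      rw [h1, h2] <;> simp
      decide
    · exact fun j hj => hq j (Finset.mem_insert_of_mem hj)
    · exact fun j hj => h j (Finset.mem_insert_of_mem hj)

/-- the Rédei type map -/
noncomputable def redei {ι : Type*} [Fintype ι] (c : ι → ι → ZMod 2) : (ι → ZMod 2) →ₗ[ZMod 2] (ι → ZMod 2) where
  toFun x i := ∑ j, c i j * (x j + x i)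
  map_add' x y := by
    ext i; simp only [Pi.add_apply, ← Finset.sum_add_distrib]
    exact Finset.sum_congr rfl fun j _ => by ring
  map_smul' r x := by
    ext i; simp only [Pi.smul_apply, smul_eq_mul, RingHom.id_apply, Finset.mul_sum]
    exact Finset.sum_congr rfl fun j _ => by ring

theorem redei_symm {ι : Type*} [Fintype ι] (c : ι → ι → ZMod 2) (hc : ∀ i j, c i j = c j i)
    (x y : ι → ZMod 2) : ∑ i, y i * redei c x i = ∑ i, x i * redei c y i := by
  have key : ∀ x y : ι → ZMod 2, ∑ i, y i * redei c x i =
      (∑ i, ∑ j, c i j * (x j * y i)) + ∑ i, ∑ j, c i j * (x i * y i) := by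
    intro x y
    rw [← Finset.sum_add_distrib]
    refine Finset.sum_congr rfl fun i _ => ?_
    rw [← Finset.sum_add_distrib]
    simp only [redei, LinearMap.coe_mk, AddHom.coe_mk, Finset.mul_sum]
    exact Finset.sum_congr rfl fun j _ => by ring
  rw [key, key, Finset.sum_comm]
  congr 1
  · refine Finset.sum_congr rfl fun i _ => Finset.sum_congr rfl fun j _ => ?_
    rw [hc j i]; ring
  · refine Finset.sum_congr rfl fun i _ => Finset.sum_congr rfl fun j _ => ?_
    ring

theorem redei_range {ι : Type*} [Fintype ι] [DecidableEq ι] (c : ι → ι → ZMod 2) (hc : ∀ i j, c i j = c j i)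
    (b : ι → ZMod 2) (h : ∀ x, redei c x = 0 → ∑ i, x i * b i = 0) : ∃ x, redei c x = b := by
  by_contra hne
  have hb : b ∉ LinearMap.range (redei c) := fun ⟨x, hx⟩ => hne ⟨x, hx⟩
  obtain ⟨φ, hφ1, hφ2⟩ := Submodule.exists_le_ker_of_notMem hb
  set x : ι → ZMod 2 := fun i => φ (Pi.single i 1)
  have hφ : ∀ y, φ y = ∑ i, x i * y i := by
    intro y
    conv_lhs => rw [pi_eq_sum_univ' y]
    rw [map_sum]
    refine Finset.sum_congr rfl fun i _ => ?_
    rw [map_smul, smul_eq_mul, mul_comm]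
  have hx : redei c x = 0 := by
    ext i
    have h1 : φ (redei c (Pi.single i 1)) = 0 := hφ2 ⟨_, rfl⟩
    rw [hφ, redei_symm c hc] at h1
    simpa [Pi.single_apply] using h1
  apply hφ1
  rw [hφ]; exact h x hx

theorem LA {n : ℕ} {a : ℤ} (hn : Squarefree n) (hP : PP n) (ha : IsCoprime a (n : ℤ))
    (H : ∀ m m' : ℕ, m * m' = n → (∀ p : ℕ, p.Prime → p ∣ m → jacobiSym m' p = 1) →
      (∀ p : ℕ, p.Prime → p ∣ m' → jacobiSym m p = 1) → jacobiSym a m = 1) :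
    ∃ m m' : ℕ, m * m' = n ∧ (∀ p : ℕ, p.Prime → p ∣ m → jacobiSym (a * m') p = 1) ∧
      (∀ p : ℕ, p.Prime → p ∣ m' → jacobiSym (a * m) p = 1) := by
  classical
  let ι := {p // p ∈ n.primeFactors}
  have hpr : ∀ i : ι, (i : ℕ).Prime := fun i => Nat.prime_of_mem_primeFactors i.2
  have hdv : ∀ i : ι, (i : ℕ) ∣ n := fun i => Nat.dvd_of_mem_primeFactors i.2
  let c : ι → ι → ZMod 2 := fun i j => jbit (i : ℕ) ((j : ℕ) : ℤ)
  have hc : ∀ i j, c i j = c j i := by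
    intro i j
    simp only [c, jbit]
    rw [jac_recip_nat (hP.dvd (hdv i)) (hpr i).ne_zero ((hP.dvd (hdv j)).odd (hpr j).ne_zero)]
  let M : (ι → ZMod 2) → ℕ := fun x => ∏ i ∈ Finset.univ.filter (fun i => x i = 1), (i : ℕ)
  let M' : (ι → ZMod 2) → ℕ := fun x => ∏ i ∈ Finset.univ.filter (fun i => ¬ x i = 1), (i : ℕ)
  have hMM : ∀ x, M x * M' x = n := by
    intro x
    simp only [M, M']
    rw [Finset.prod_filter_mul_prod_filter_not]
    rw [Finset.prod_coe_sort n.primeFactors (fun p => p)]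
    exact Nat.prod_primeFactors_of_squarefree hn
  have hcop : ∀ i j : ι, i ≠ j → IsCoprime ((i : ℕ) : ℤ) ((j : ℕ) : ℤ) := by
    intro i j hij
    rw [Nat.isCoprime_iff_coprime, Nat.coprime_primes (hpr i) (hpr j)]
    exact fun h => hij (Subtype.ext h)
  have hdM : ∀ x (p : ℕ), p.Prime → p ∣ M x → ∃ i : ι, (i : ℕ) = p ∧ x i = 1 := by
    intro x p hp hd
    obtain ⟨i, hi, hpi⟩ := (Prime.dvd_finset_prod_iff hp.prime _).1 hd
    exact ⟨i, ((Nat.prime_dvd_prime_iff_eq hp (hpr i)).1 hpi).symm, (Finset.mem_filter.1 hi).2⟩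
  have hdM' : ∀ x (p : ℕ), p.Prime → p ∣ M' x → ∃ i : ι, (i : ℕ) = p ∧ ¬ x i = 1 := by
    intro x p hp hd
    obtain ⟨i, hi, hpi⟩ := (Prime.dvd_finset_prod_iff hp.prime _).1 hd
    exact ⟨i, ((Nat.prime_dvd_prime_iff_eq hp (hpr i)).1 hpi).symm, (Finset.mem_filter.1 hi).2⟩
  have z2 : ∀ y : ZMod 2, ¬ y = 1 → y = 0 := by decide
  have cM' : ∀ x (i : ι), x i = 1 → IsCoprime ((M' x : ℕ) : ℤ) ((i : ℕ) : ℤ) := by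
    intro x i hi
    simp only [M']
    push_cast
    refine IsCoprime.prod_left fun j hj => hcop j i ?_
    rintro rfl; exact (Finset.mem_filter.1 hj).2 hi
  have cM : ∀ x (i : ι), ¬ x i = 1 → IsCoprime ((M x : ℕ) : ℤ) ((i : ℕ) : ℤ) := by
    intro x i hi
    simp only [M]
    push_cast
    refine IsCoprime.prod_left fun j hj => hcop j i ?_
    rintro rfl; exact hi (Finset.mem_filter.1 hj).2
  have r1 : ∀ x (i : ι), x i = 1 → redei c x i = jbit i (M' x : ℕ) := by
    intro x i hi
    simp only [M']
    push_cast
    rw [jbit_prod]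
    · simp only [redei, LinearMap.coe_mk, AddHom.coe_mk, hi]
      rw [Finset.sum_filter]
      refine Finset.sum_congr rfl fun j _ => ?_
      by_cases hj : x j = 1
      · simp [hj]; right; decide
      · simp [z2 _ hj, c]
    · intro j hj
      refine hcop j i ?_
      rintro rfl; exact (Finset.mem_filter.1 hj).2 hi
  have r2 : ∀ x (i : ι), ¬ x i = 1 → redei c x i = jbit i (M x : ℕ) := by
    intro x i hi
    simp only [M]
    push_cast
    rw [jbit_prod]
    · simp only [redei, LinearMap.coe_mk, AddHom.coe_mk, z2 _ hi]
      rw [Finset.sum_filter]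
      refine Finset.sum_congr rfl fun j _ => ?_
      by_cases hj : x j = 1
      · simp [hj, c]
      · simp [z2 _ hj]
    · intro j hj
      refine hcop j i ?_
      rintro rfl; exact hi (Finset.mem_filter.1 hj).2
  have ca : ∀ i : ι, IsCoprime a ((i : ℕ) : ℤ) := fun i =>
    ha.of_isCoprime_of_dvd_right (by exact_mod_cast hdv i)
  obtain ⟨x, hx⟩ := redei_range c hc (fun i => jbit i a) (by
    intro x hx
    have h1 := H (M x) (M' x) (hMM x) (by
      intro p hp hd
      obtain ⟨i, rfl, hi⟩ := hdM x p hp hd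
      rw [← jbit_eq_zero (cM' x i hi), ← r1 x i hi, hx]; rfl) (by
      intro p hp hd
      obtain ⟨i, rfl, hi⟩ := hdM' x p hp hd
      rw [← jbit_eq_zero (cM x i hi), ← r2 x i hi, hx]; rfl)
    have h2 : IsCoprime a ((M x : ℕ) : ℤ) := by
      refine ha.of_isCoprime_of_dvd_right ?_
      exact_mod_cast Dvd.intro _ (hMM x)
    rw [← jbit_eq_zero h2] at h1
    simp only [M] at h1
    rw [jbit_prod_right _ _ _ (fun i _ => (hpr i).ne_zero) (fun i _ => ca i), Finset.sum_filter] at h1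
    rw [← h1]
    refine Finset.sum_congr rfl fun j _ => ?_
    by_cases hj : x j = 1
    · simp [hj]
    · simp [z2 _ hj])
  have zz : ∀ y : ZMod 2, y + y = 0 := by decide
  refine ⟨M x, M' x, hMM x, ?_, ?_⟩
  · intro p hp hd
    obtain ⟨i, rfl, hi⟩ := hdM x p hp hd
    have := cM' x i hi
    rw [← jbit_eq_zero ((ca i).mul_left this), jbit_mul (ca i) this, ← r1 x i hi, hx]
    exact zz _
  · intro p hp hd
    obtain ⟨i, rfl, hi⟩ := hdM' x p hp hd
    have := cM x i hi
    rw [← jbit_eq_zero ((ca i).mul_left this), jbit_mul (ca i) this, ← r2 x i hi, hx]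
    exact zz _


/-- an abstract ring `ℤ[√-n]` with conjugation -/
structure QF (R : Type*) [CommRing R] (n : ℕ) where
  s : R
  hs : s * s = -(n : R)
  rep : ∀ x : R, ∃ X Y : ℤ, x = X + Y * s
  uniq : ∀ X Y : ℤ, (X : R) + Y * s = 0 → X = 0 ∧ Y = 0
  σ : R →+* R
  hσ : σ s = -s

theorem sf_dvd {n : ℕ} (hn : Squarefree n) {g t : ℤ} (h : g ^ 2 ∣ n * t ^ 2) : g ∣ t := by
  rcases eq_or_ne g 0 with rfl | hg
  · obtain ⟨k, hk⟩ := h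
    have h0 : (n : ℤ) * t ^ 2 = 0 := by rw [hk]; ring
    have : (n : ℤ) ≠ 0 := by exact_mod_cast hn.ne_zero
    have : t = 0 := by simpa [this, hn.ne_zero] using h0
    rw [this]
  obtain ⟨d, g', t', hd, hc, h1, h2⟩ := Int.exists_gcd_one' (m := g) (n := t) (Int.gcd_pos_of_ne_zero_left _ hg)
  · rw [h1, h2] at h
    have hd0 : (d : ℤ) ^ 2 ≠ 0 := by positivity
    have h3 : g' ^ 2 ∣ n * t' ^ 2 := by
      have : (d : ℤ) ^ 2 * g' ^ 2 ∣ d ^ 2 * (n * t' ^ 2) := by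
        obtain ⟨k, hk⟩ := h
        exact ⟨k, by linear_combination hk⟩
      exact Int.dvd_of_mul_dvd_mul_left hd0 this
    have h4 : g' ^ 2 ∣ n := (((Int.isCoprime_iff_gcd_eq_one.2 hc).pow).dvd_of_dvd_mul_right h3)
    have h5 : IsUnit g' := (Int.squarefree_natCast.2 hn) g' (by rw [← pow_two]; exact h4)
    rw [h1, h2]
    exact mul_dvd_mul_right h5.dvd _

namespace QF

variable {R : Type*} [CommRing R] {n : ℕ}

theorem cast_inj (q : QF R n) {a b : ℤ} (h : (a : R) = b) : a = b := by
  have := (q.uniq (a - b) 0 (by push_cast; rw [h]; ring)).1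
  omega

theorem natcast_ne (q : QF R n) {a : ℕ} (h : a ≠ 0) : (a : R) ≠ 0 := by
  intro h1
  have : ((a : ℤ) : R) = ((0 : ℤ) : R) := by push_cast; exact h1
  have := q.cast_inj this
  exact h (by exact_mod_cast this)

theorem σσ (q : QF R n) (x : R) : q.σ (q.σ x) = x := by
  obtain ⟨X, Y, rfl⟩ := q.rep x
  simp [q.hσ]

theorem mapmap (q : QF R n) (J : Ideal R) : (J.map q.σ).map q.σ = J := by
  rw [Ideal.map_map]
  have : q.σ.comp q.σ = RingHom.id R := by ext x; exact q.σσ x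
  rw [this, Ideal.map_id]

theorem map_span_nat (q : QF R n) (a : ℕ) : (Ideal.span {(a : R)}).map q.σ = Ideal.span {(a : R)} := by
  rw [Ideal.map_span]; simp

theorem map_ne_bot (q : QF R n) {J : Ideal R} (h : J ≠ ⊥) : J.map q.σ ≠ ⊥ := by
  intro h1; apply h
  rw [← q.mapmap J, h1, Ideal.map_bot]

theorem norm_eq (q : QF R n) (X Y : ℤ) : ((X : R) + Y * q.s) * q.σ (X + Y * q.s) = ((X ^ 2 + n * Y ^ 2 : ℤ) : R) := by
  simp only [map_add, map_mul, map_intCast, q.hσ]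
  push_cast
  linear_combination -(Y : R) ^ 2 * q.hs

theorem dvd_iff (q : QF R n) (g X Y : ℤ) : (g : R) ∣ X + Y * q.s ↔ g ∣ X ∧ g ∣ Y := by
  constructor
  · rintro ⟨r, hr⟩
    obtain ⟨U, V, rfl⟩ := q.rep r
    have := q.uniq (X - g * U) (Y - g * V) (by push_cast; linear_combination hr)
    exact ⟨⟨U, by linarith [this.1]⟩, ⟨V, by linarith [this.2]⟩⟩
  · rintro ⟨⟨a, rfl⟩, ⟨b, rfl⟩⟩
    exact ⟨a + b * q.s, by push_cast; ring⟩

theorem cast_dvd (q : QF R n) (g X : ℤ) : (g : R) ∣ (X : R) ↔ g ∣ X := by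
  have := q.dvd_iff g X 0
  simpa using this

theorem span_nat_inj (q : QF R n) {a b : ℕ} (h : Ideal.span {(a : R)} = Ideal.span {(b : R)}) : a = b := by
  have h1 : (a : R) ∣ b := Ideal.mem_span_singleton.1 (h ▸ Ideal.mem_span_singleton_self (b : R))
  have h2 : (b : R) ∣ a := Ideal.mem_span_singleton.1 (h ▸ Ideal.mem_span_singleton_self (a : R))
  have h1' := (q.cast_dvd a b).1 (by exact_mod_cast h1)
  have h2' := (q.cast_dvd b a).1 (by exact_mod_cast h2)
  exact Nat.dvd_antisymm (by exact_mod_cast h1') (by exact_mod_cast h2')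

theorem norm_ideal (q : QF R n) (hn : Squarefree n) (hn4 : n % 4 = 1) {J : Ideal R} (hJ : J ≠ ⊥) :
    ∃ g : ℕ, g ≠ 0 ∧ J * J.map q.σ = Ideal.span {(g : R)} := by
  let T : Ideal ℤ := Ideal.span {z | ∃ α ∈ J, (z : R) = α * q.σ α}
  obtain ⟨g0, hg0⟩ := (IsPrincipalIdealRing.principal T).principal
  have hg0' : T = Ideal.span {g0} := hg0
  have hgT : T = Ideal.span {((g0.natAbs : ℕ) : ℤ)} := by
    rw [hg0']; exact (Ideal.span_singleton_eq_span_singleton.2 (Int.associated_natAbs g0))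
  set g : ℕ := g0.natAbs
  have hmem : ∀ z : ℤ, z ∈ T ↔ (g : ℤ) ∣ z := by
    intro z; rw [hgT, Ideal.mem_span_singleton]
  have hN : ∀ X Y : ℤ, (X : R) + Y * q.s ∈ J → (g : ℤ) ∣ X ^ 2 + n * Y ^ 2 := by
    intro X Y h
    rw [← hmem]
    exact Ideal.subset_span ⟨_, h, (q.norm_eq X Y).symm⟩
  have hle : J * J.map q.σ ≤ Ideal.span {(g : R)} := by
    rw [Ideal.mul_le]
    intro α hα y hy
    refine Submodule.span_induction (p := fun y _ => α * y ∈ Ideal.span {(g : R)}) ?_ ?_ ?_ ?_ hy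
    · rintro _ ⟨β, hβ, rfl⟩
      have hβ' : β ∈ J := hβ
      obtain ⟨A, B, rfl⟩ := q.rep α
      obtain ⟨C, D, rfl⟩ := q.rep β
      have e1 : ((A : R) + B * q.s) * q.σ (C + D * q.s) =
          ((A * C + n * B * D : ℤ) : R) + ((B * C - A * D : ℤ) : R) * q.s := by
        simp only [map_add, map_mul, map_intCast, q.hσ]
        push_cast
        linear_combination -(B * D : R) * q.hs
      rw [e1, Ideal.mem_span_singleton]
      have := (q.dvd_iff (g : ℤ) (A * C + n * B * D) (B * C - A * D)).2
      rw [Int.cast_natCast] at this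
      apply this
      have n1 := hN A B hα
      have n2 := hN C D hβ'
      have n3 := hN (A + C) (B + D) (by
        have h := J.add_mem hα hβ'
        have e : ((A + C : ℤ) : R) + ((B + D : ℤ) : R) * q.s = (A + B * q.s) + (C + D * q.s) := by
          push_cast; ring
        rw [e]; exact h)
      have d1 : (g : ℤ) ∣ 2 * (A * C + n * B * D) := by
        have h := (n3.sub n1).sub n2
        have e : 2 * (A * C + n * B * D) = (A + C) ^ 2 + n * (B + D) ^ 2 - (A ^ 2 + n * B ^ 2) -
          (C ^ 2 + n * D ^ 2) := by ring
        rw [e]; exact h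
      have d2 : (g : ℤ) ^ 2 ∣ (A * C + n * B * D) ^ 2 + n * (B * C - A * D) ^ 2 := by
        have h := mul_dvd_mul n1 n2
        have e : (A * C + n * B * D) ^ 2 + n * (B * C - A * D) ^ 2 = (A ^ 2 + n * B ^ 2) *
          (C ^ 2 + n * D ^ 2) := by ring
        rw [e, pow_two]; exact h
      generalize A * C + n * B * D = U at *
      generalize B * C - A * D = V at *
      obtain ⟨U', hU'⟩ := d1
      obtain ⟨k, hk⟩ := d2
      have d3 : (g : ℤ) ∣ 2 * V := by
        apply sf_dvd hn
        exact ⟨4 * k - U' ^ 2, by linear_combination 4 * hk - (2 * U + g * U') * hU'⟩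
      obtain ⟨V', hV'⟩ := d3
      rcases eq_or_ne g 0 with h0 | h0
      · rw [h0] at hU' hV' ⊢
        have hU : U = 0 := by push_cast at hU'; omega
        have hV : V = 0 := by push_cast at hV'; omega
        simp [hU, hV]
      have e4 : U' ^ 2 + n * V' ^ 2 = 4 * k := by
        have : ((g : ℤ) ^ 2) ≠ 0 := by positivity
        apply mul_left_cancel₀ this
        linear_combination 4 * hk - (2 * U + g * U') * hU' - n * (2 * V + g * V') * hV'
      have hm : ∀ x : ℤ, x ^ 2 % 4 = 0 ∧ x % 2 = 0 ∨ x ^ 2 % 4 = 1 ∧ x % 2 = 1 := by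
        intro x
        rcases Int.even_or_odd' x with ⟨m, rfl | rfl⟩
        · left; ring_nf; omega
        · right; ring_nf; omega
      have e5 : (U' ^ 2 + n * V' ^ 2) % 4 = 0 := by omega
      have hn4' : (n : ℤ) % 4 = 1 := by omega
      rw [Int.add_emod, Int.mul_emod, hn4'] at e5
      have : U' % 2 = 0 ∧ V' % 2 = 0 := by
        rcases hm U' with ⟨h1, h2⟩ | ⟨h1, h2⟩ <;> rcases hm V' with ⟨h3, h4⟩ | ⟨h3, h4⟩ <;>
          rw [h1, h3] at e5 <;> simp at e5 <;> exact ⟨h2, h4⟩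
      obtain ⟨⟨U2, rfl⟩, ⟨V2, rfl⟩⟩ := And.imp Int.dvd_of_emod_eq_zero Int.dvd_of_emod_eq_zero this
      exact ⟨⟨U2, by linarith⟩, ⟨V2, by linarith⟩⟩
    · simp
    · intro x y _ _ hx hy; rw [mul_add]; exact Ideal.add_mem _ hx hy
    · intro a x _ hx
      rw [smul_eq_mul, mul_left_comm]; exact Ideal.mul_mem_left _ _ hx
  have hge : (g : R) ∈ J * J.map q.σ := by
    have h1 : T ≤ (J * J.map q.σ).comap (Int.castRingHom R) := by
      rw [Ideal.span_le]
      rintro z ⟨α, hα, hz⟩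
      simp only [SetLike.mem_coe, Ideal.mem_comap, eq_intCast]
      rw [hz]
      exact Ideal.mul_mem_mul hα (Ideal.mem_map_of_mem _ hα)
    have h2 := h1 ((hmem g).2 dvd_rfl)
    simpa using h2
  refine ⟨g, ?_, le_antisymm hle ((Ideal.span_singleton_le_iff_mem _).2 hge)⟩
  intro h0
  apply hJ
  rw [eq_bot_iff]
  intro α hα
  obtain ⟨X, Y, rfl⟩ := q.rep α
  have := hN X Y hα
  rw [h0] at this
  simp only [CharP.cast_eq_zero, zero_dvd_iff] at this
  have hnp : (0 : ℤ) < n := by omega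
  have hY : n * Y ^ 2 = 0 := by nlinarith [sq_nonneg X, mul_nonneg hnp.le (sq_nonneg Y)]
  have hX : X ^ 2 = 0 := by linarith
  have hY' : Y = 0 := by
    rcases mul_eq_zero.1 hY with h | h
    · omega
    · exact pow_eq_zero_iff (two_ne_zero) |>.1 h
  have hX' : X = 0 := pow_eq_zero_iff (two_ne_zero) |>.1 hX
  simp [hX', hY']

end QF


section
open Classical in
/-- the class of an ideal -/
noncomputable def cl {R : Type*} [CommRing R] [IsDedekindDomain R] (I : Ideal R) : ClassGroup R :=
  if h : I ≠ ⊥ then ClassGroup.mk0 ⟨I, mem_nonZeroDivisors_iff_ne_zero.2 h⟩ else 1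

variable {R : Type*} [CommRing R] [IsDedekindDomain R]

theorem cl_def {I : Ideal R} (h : I ≠ ⊥) :
    cl I = ClassGroup.mk0 ⟨I, mem_nonZeroDivisors_iff_ne_zero.2 h⟩ := by
  rw [cl, dif_pos h]

theorem cl_mul {I J : Ideal R} (hI : I ≠ ⊥) (hJ : J ≠ ⊥) : cl (I * J) = cl I * cl J := by
  rw [cl_def hI, cl_def hJ, cl_def (mul_ne_zero hI hJ), ← map_mul]; rfl

theorem cl_pow {I : Ideal R} (hI : I ≠ ⊥) (k : ℕ) : cl (I ^ k) = cl I ^ k := by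
  rw [cl_def hI, cl_def (pow_ne_zero k hI), ← map_pow]; rfl

theorem cl_eq_one_iff {I : Ideal R} (hI : I ≠ ⊥) : cl I = 1 ↔ ∃ α, I = Ideal.span {α} := by
  rw [cl_def hI, ClassGroup.mk0_eq_one_iff]
  exact ⟨fun h => h.principal, fun h => ⟨h⟩⟩

theorem cl_span (a : R) : cl (Ideal.span {a}) = 1 := by
  by_cases h : Ideal.span {a} = ⊥
  · rw [cl, dif_neg (not_not.2 h)]
  · exact (cl_eq_one_iff h).2 ⟨a, rfl⟩

theorem cl_surj (c : ClassGroup R) : ∃ I : Ideal R, I ≠ ⊥ ∧ cl I = c := by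
  obtain ⟨⟨I, hI⟩, rfl⟩ := ClassGroup.mk0_surjective c
  have h : I ≠ ⊥ := mem_nonZeroDivisors_iff_ne_zero.1 hI
  exact ⟨I, h, cl_def h⟩

theorem span_ne_bot {a : R} (h : a ≠ 0) : Ideal.span {a} ≠ ⊥ := by
  simpa using h

end

namespace QF
variable {R : Type*} [CommRing R] [IsDedekindDomain R] {n : ℕ}

theorem cl_map (q : QF R n) (hn : Squarefree n) (hn4 : n % 4 = 1) {J : Ideal R} (hJ : J ≠ ⊥) :
    cl (J.map q.σ) = (cl J)⁻¹ := by
  obtain ⟨g, _, hg⟩ := q.norm_ideal hn hn4 hJ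
  have := congrArg cl hg
  rw [cl_mul hJ (q.map_ne_bot hJ), cl_span] at this
  exact (inv_eq_of_mul_eq_one_right this).symm

/-- Hilbert 90 type lemma -/
theorem hilbert (q : QF R n) (hn : Squarefree n) (hn4 : n % 4 = 1) {I : Ideal R} (hI : I ≠ ⊥) {a k : ℕ}
    (hk : k ≠ 0) (ha : I * I.map q.σ = Ideal.span {(a : R)}) (X Y : ℤ)
    (hN : X ^ 2 + n * Y ^ 2 = a * k ^ 2) : ∃ b, cl I = b ^ 2 := by
  set η : R := X + Y * q.s
  have hη : η * q.σ η = (a : R) * k ^ 2 := by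
    rw [q.norm_eq, hN]; push_cast; rfl
  set K : Ideal R := Ideal.span {(k : R)}
  have hK : K ≠ ⊥ := span_ne_bot (q.natcast_ne hk)
  set I' := K * I
  have hI' : I' ≠ ⊥ := mul_ne_zero hK hI
  set J := I' ⊔ Ideal.span {η}
  have hJ : J ≠ ⊥ := fun h => hI' (by rw [eq_bot_iff, ← h]; exact le_sup_left)
  have hII : I' * I'.map q.σ = Ideal.span {η} * Ideal.span {q.σ η} := by
    simp only [I', K]
    rw [Ideal.map_mul, q.map_span_nat, mul_mul_mul_comm, ha, Ideal.span_singleton_mul_span_singleton,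
      Ideal.span_singleton_mul_span_singleton, Ideal.span_singleton_mul_span_singleton, hη]
    congr 2; ring
  have key : J.map q.σ * I' = Ideal.span {q.σ η} * J := by
    simp only [J]
    rw [Ideal.map_sup, Ideal.map_span, Set.image_singleton, Ideal.sup_mul, Ideal.mul_sup, mul_comm _ I', hII]
    rw [sup_comm, mul_comm (Ideal.span {η})]
  have hση : q.σ η ≠ 0 := by
    intro h
    have h1 : (q.σ (q.σ η)) = 0 := by rw [h, map_zero]
    rw [h, mul_zero] at hη
    have h2 : (a : R) ≠ 0 := by
      intro h2
      rw [h2] at ha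
      simp only [Ideal.span_singleton_zero] at ha
      exact mul_ne_zero hI (q.map_ne_bot hI) ha
    exact mul_ne_zero h2 (pow_ne_zero 2 (q.natcast_ne hk)) hη.symm
  have h := congrArg cl key
  rw [cl_mul (q.map_ne_bot hJ) hI', cl_mul (span_ne_bot hση) hJ, cl_span, one_mul, q.cl_map hn hn4 hJ,
    cl_mul hK hI, cl_span, one_mul] at h
  exact ⟨cl J, by rw [pow_two]; exact inv_mul_eq_iff_eq_mul.1 h⟩

/-! the ambiguous ideals -/
/-- the ideal `(m, √-n)` -/
def P (q : QF R n) (m : ℕ) : Ideal R := Ideal.span {(m : R), q.s}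
/-- the ideal `(2, 1+√-n)` -/
def P2 (q : QF R n) : Ideal R := Ideal.span {(2 : R), 1 + q.s}

theorem map_P (q : QF R n) (m : ℕ) : (q.P m).map q.σ = q.P m := by
  unfold P
  rw [Ideal.map_span, Set.image_pair, map_natCast, q.hσ]
  apply le_antisymm
  · rw [Ideal.span_le, Set.insert_subset_iff, Set.singleton_subset_iff]
    exact ⟨Ideal.subset_span (by simp), neg_mem (Ideal.subset_span (by simp))⟩
  · rw [Ideal.span_le, Set.insert_subset_iff, Set.singleton_subset_iff]
    refine ⟨Ideal.subset_span (by simp), neg_mem_iff.1 (Ideal.subset_span (by simp))⟩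

theorem map_P2 (q : QF R n) : (q.P2).map q.σ = q.P2 := by
  have h : (q.P2).map q.σ ≤ q.P2 := by
    unfold P2
    rw [Ideal.map_span, Set.image_pair, map_add, map_ofNat, q.hσ, map_one]
    rw [Ideal.span_le, Set.insert_subset_iff, Set.singleton_subset_iff]
    refine ⟨Ideal.subset_span (by simp), Ideal.mem_span_pair.2 ⟨1, -1, by ring⟩⟩
  refine le_antisymm h ?_
  have := Ideal.map_mono (f := q.σ) h
  rwa [q.mapmap] at this

theorem P_ne_bot (q : QF R n) {m : ℕ} (hm : m ≠ 0) : q.P m ≠ ⊥ := by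
  intro h
  have h1 : (m : R) ∈ q.P m := Ideal.subset_span (by simp)
  rw [h] at h1
  exact q.natcast_ne hm h1

theorem P2_ne_bot (q : QF R n) : q.P2 ≠ ⊥ := by
  intro h
  have h1 : (2 : R) ∈ q.P2 := Ideal.subset_span (by simp)
  rw [h] at h1
  exact q.natcast_ne (a := 2) two_ne_zero (by exact_mod_cast h1)

theorem P_mul (q : QF R n) (hn : Squarefree n) {a b : ℕ} (h : a * b ∣ n) : q.P (a * b) = q.P a * q.P b := by
  have hc : Nat.Coprime a b := Nat.coprime_of_squarefree_mul (hn.squarefree_of_dvd h)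
  obtain ⟨u, v, huv⟩ := Nat.isCoprime_iff_coprime.2 hc
  have huv' : (u : R) * a + v * b = 1 := by exact_mod_cast congrArg (Int.cast : ℤ → R) huv
  obtain ⟨c, hc⟩ := h
  have hc' : (n : R) = a * b * c := by exact_mod_cast congrArg (Nat.cast : ℕ → R) hc
  unfold P
  rw [Ideal.span_pair_mul_span_pair]
  apply le_antisymm
  · rw [Ideal.span_le, Set.insert_subset_iff, Set.singleton_subset_iff]
    constructor
    · push_cast; exact Ideal.subset_span (by simp)
    · have h1 : (a : R) * q.s ∈ Ideal.span {(a : R) * b, a * q.s, q.s * b, q.s * q.s} := Ideal.subset_span (by simp)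
      have h2 : q.s * (b : R) ∈ Ideal.span {(a : R) * b, a * q.s, q.s * b, q.s * q.s} := Ideal.subset_span (by simp)
      have h3 := add_mem (Ideal.mul_mem_left _ (u : R) h1) (Ideal.mul_mem_left _ (v : R) h2)
      have e : (u : R) * (a * q.s) + v * (q.s * b) = q.s := by linear_combination q.s * huv'
      rw [e] at h3; exact h3
  · rw [Ideal.span_le]
    rintro x (rfl | rfl | rfl | rfl)
    · exact Ideal.subset_span (by simp)
    · exact Ideal.mul_mem_left _ _ (Ideal.subset_span (by simp))
    · exact Ideal.mul_mem_right _ _ (Ideal.subset_span (by simp))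
    · exact Ideal.mul_mem_right _ _ (Ideal.subset_span (by simp))

theorem P_sq (q : QF R n) (hn : Squarefree n) {a : ℕ} (h : a ∣ n) : q.P a * q.P a = Ideal.span {(a : R)} := by
  obtain ⟨c, hc⟩ := h
  have hcop : Nat.Coprime a c := Nat.coprime_of_squarefree_mul (hc ▸ hn)
  obtain ⟨u, v, huv⟩ := Nat.isCoprime_iff_coprime.2 hcop
  have huv' : (u : R) * a + v * c = 1 := by exact_mod_cast congrArg (Int.cast : ℤ → R) huv
  have hc' : (n : R) = a * c := by exact_mod_cast congrArg (Nat.cast : ℕ → R) hc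
  unfold P
  rw [Ideal.span_pair_mul_span_pair]
  apply le_antisymm
  · rw [Ideal.span_le]
    rintro x (rfl | rfl | rfl | rfl) <;> rw [SetLike.mem_coe, Ideal.mem_span_singleton]
    · exact Dvd.intro _ rfl
    · exact Dvd.intro _ rfl
    · exact Dvd.intro_left _ rfl
    · exact ⟨-c, by rw [q.hs, hc']; ring⟩
  · rw [Ideal.span_singleton_le_iff_mem]
    have h1 : (a : R) * a ∈ Ideal.span {(a : R) * a, a * q.s, q.s * a, q.s * q.s} := Ideal.subset_span (by simp)
    have h2 : q.s * q.s ∈ Ideal.span {(a : R) * a, a * q.s, q.s * a, q.s * q.s} := Ideal.subset_span (by simp)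
    have h3 := add_mem (Ideal.mul_mem_left _ (u : R) h1) (Ideal.mul_mem_left _ (-v : R) h2)
    have e : (u : R) * (a * a) + (-v) * (q.s * q.s) = a := by
      linear_combination (a : R) * huv' - v * q.hs + v * hc'
    rw [e] at h3; exact h3

theorem P2_sq (q : QF R n) (hn4 : n % 4 = 1) : q.P2 * q.P2 = Ideal.span {(2 : R)} := by
  obtain ⟨c, hc⟩ : ∃ c, n = 4 * c + 1 := ⟨n / 4, by omega⟩
  have hc' : (n : R) = 4 * c + 1 := by exact_mod_cast congrArg (Nat.cast : ℕ → R) hc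
  unfold P2
  rw [Ideal.span_pair_mul_span_pair]
  apply le_antisymm
  · rw [Ideal.span_le]
    rintro x (rfl | rfl | rfl | rfl) <;> rw [SetLike.mem_coe, Ideal.mem_span_singleton]
    · exact Dvd.intro _ rfl
    · exact Dvd.intro _ rfl
    · exact Dvd.intro_left _ rfl
    · exact ⟨q.s - 2 * c, by linear_combination q.hs - hc'⟩
  · rw [Ideal.span_singleton_le_iff_mem]
    set S := Ideal.span {(2 : R) * 2, 2 * (1 + q.s), (1 + q.s) * 2, (1 + q.s) * (1 + q.s)} with hS
    have h1 : (2 : R) * 2 ∈ S := Ideal.subset_span (by simp)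
    have h2 : (2 : R) * (1 + q.s) ∈ S := Ideal.subset_span (by simp)
    have h3 : (1 + q.s) * (1 + q.s) ∈ S := Ideal.subset_span (by simp)
    have h4 := sub_mem (sub_mem h2 h3) (Ideal.mul_mem_left _ (c : R) h1)
    have e : 2 * (1 + q.s) - (1 + q.s) * (1 + q.s) - c * (2 * 2) = 2 := by
      linear_combination - q.hs + hc'
    rw [e] at h4; exact h4

/-- the generator of the norm of a principal ideal -/
theorem principal_norm (q : QF R n) {I : Ideal R} {m : ℕ} (hI : I * I.map q.σ = Ideal.span {(m : R)}) {α : R}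
    (hα : I = Ideal.span {α}) : ∃ X Y : ℤ, α = X + Y * q.s ∧ X ^ 2 + n * Y ^ 2 = m := by
  obtain ⟨X, Y, rfl⟩ := q.rep α
  refine ⟨X, Y, rfl, ?_⟩
  rw [hα, Ideal.map_span, Set.image_singleton, Ideal.span_singleton_mul_span_singleton, q.norm_eq] at hI
  have h0 : 0 ≤ X ^ 2 + (n : ℤ) * Y ^ 2 := by positivity
  obtain ⟨k, hk⟩ := Int.eq_ofNat_of_zero_le h0
  rw [hk] at hI ⊢
  rw [Int.cast_natCast] at hI
  rw [q.span_nat_inj hI]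

theorem cl_P_eq_one (q : QF R n) (hn : Squarefree n) {m : ℕ} (hm : m ∣ n) (h : cl (q.P m) = 1) : m = 1 ∨ m = n := by
  have hm0 : m ≠ 0 := fun h => hn.ne_zero (Nat.eq_zero_of_zero_dvd (h ▸ hm))
  obtain ⟨α, hα⟩ := (cl_eq_one_iff (q.P_ne_bot hm0)).1 h
  obtain ⟨X, Y, _, hXY⟩ := q.principal_norm (by rw [q.map_P, q.P_sq hn hm]) hα
  have hle : (m : ℤ) ≤ n := by exact_mod_cast Nat.le_of_dvd (Nat.pos_of_ne_zero hn.ne_zero) hm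
  have hnp : (0 : ℤ) < n := by have := hn.ne_zero; omega
  rcases eq_or_ne Y 0 with rfl | hY
  · left
    have h1 : X.natAbs * X.natAbs ∣ m := by
      have : ((X.natAbs * X.natAbs : ℕ) : ℤ) ∣ m := by
        rw [← hXY]; push_cast; rw [abs_mul_abs_self]; exact ⟨1, by ring⟩
      exact_mod_cast this
    have h2 := Nat.isUnit_iff.1 ((hn.squarefree_of_dvd hm) _ h1)
    have h3 : X ^ 2 = 1 := by rw [← Int.natAbs_sq, h2]; rfl
    rw [h3] at hXY
    simp at hXY
    exact_mod_cast hXY.symm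
  · right
    have h1 : 1 ≤ Y ^ 2 := by have := sq_nonneg Y; have : Y ^ 2 ≠ 0 := pow_ne_zero 2 hY; omega
    have : (n : ℤ) * 1 ≤ n * Y ^ 2 := by gcongr
    have : (m : ℤ) = n := by nlinarith [sq_nonneg X]
    exact_mod_cast this

theorem P2P_sq (q : QF R n) (hn : Squarefree n) (hn4 : n % 4 = 1) {m : ℕ} (hm : m ∣ n) :
    (q.P2 * q.P m) * (q.P2 * q.P m).map q.σ = Ideal.span {((2 * m : ℕ) : R)} := by
  rw [Ideal.map_mul, q.map_P, q.map_P2, mul_mul_mul_comm, q.P2_sq hn4, q.P_sq hn hm,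
    Ideal.span_singleton_mul_span_singleton]
  push_cast; rfl

theorem cl_P2P (q : QF R n) (hn : Squarefree n) (hn4 : n % 4 = 1) (hn1 : 1 < n) {m : ℕ} (hm : m ∣ n) :
    cl (q.P2 * q.P m) ≠ 1 := by
  intro h
  have hm0 : m ≠ 0 := fun h => hn.ne_zero (Nat.eq_zero_of_zero_dvd (h ▸ hm))
  obtain ⟨α, hα⟩ := (cl_eq_one_iff (mul_ne_zero q.P2_ne_bot (q.P_ne_bot hm0))).1 h
  obtain ⟨X, Y, _, hXY⟩ := q.principal_norm (q.P2P_sq hn hn4 hm) hα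
  push_cast at hXY
  have hnp : (0 : ℤ) < n := by omega
  obtain ⟨c, hc⟩ := hm
  have hc' : (n : ℤ) = m * c := by exact_mod_cast hc
  have nsq : ∀ k : ℕ, k ≠ 1 → Squarefree k → (k : ℤ) ≠ X ^ 2 := by
    intro k hk hsf h
    have : k = X.natAbs * X.natAbs := by
      have : (k : ℤ) = ((X.natAbs * X.natAbs : ℕ) : ℤ) := by
        push_cast; rw [abs_mul_abs_self, h]; ring
      exact_mod_cast this
    have h1 := Nat.isUnit_iff.1 (hsf X.natAbs (this ▸ dvd_rfl))
    rw [h1] at this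
    exact hk this
  rcases eq_or_ne Y 0 with rfl | hY
  · refine nsq (2 * m) (by omega) ?_ (by push_cast; linarith)
    have hodd : Nat.Coprime 2 m := by
      rw [Nat.coprime_two_left, Nat.odd_iff]
      by_contra h2
      have : 2 ∣ n := (Nat.dvd_of_mod_eq_zero (by omega : m % 2 = 0)).trans (Dvd.intro _ hc.symm)
      omega
    exact (Nat.squarefree_mul_iff.2 ⟨hodd, Nat.prime_two.squarefree, hn.squarefree_of_dvd (Dvd.intro _ hc.symm)⟩)
  · have h1 : 1 ≤ Y ^ 2 := by have := sq_nonneg Y; have : Y ^ 2 ≠ 0 := pow_ne_zero 2 hY; omega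
    have hY2 : (n : ℤ) * 1 ≤ n * Y ^ 2 := by gcongr
    have hmp : (0 : ℤ) < m := by omega
    have hX := sq_nonneg X
    have hc2 : c < 3 := by
      by_contra h3
      have : (m : ℤ) * 3 ≤ m * c := by
        apply mul_le_mul_of_nonneg_left _ hmp.le; omega
      omega
    have hc1 : c = 1 := by
      have : c ≠ 0 := by rintro rfl; omega
      have : c ≠ 2 := by rintro rfl; omega
      omega
    subst hc1
    have hmn : m = n := by omega
    subst hmn
    have hYs : Y ^ 2 = 1 := by
      by_contra hne
      have hY4 : 4 ≤ Y ^ 2 := by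
        have : Y ≠ 1 := by rintro rfl; exact hne rfl
        have : Y ≠ -1 := by rintro rfl; exact hne rfl
        have : 2 ≤ Y ∨ Y ≤ -2 := by omega
        rcases this with h | h <;> nlinarith
      have : (m : ℤ) * 4 ≤ m * Y ^ 2 := by gcongr
      omega
    rw [hYs] at hXY
    exact nsq m (by omega) hn (by linarith)

end QF


theorem two_elts {α : Type*} [Group α] {S : α → Prop} (h : Nat.card {c : α // S c} = 2) (h1 : S 1) {c0 : α}
    (hc0 : S c0) (hne : c0 ≠ 1) {c : α} (hc : S c) : c = 1 ∨ c = c0 := by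
  obtain ⟨x, y, _, hu⟩ := Nat.card_eq_two_iff.1 h
  have m1 : (⟨1, h1⟩ : {c // S c}) ∈ ({x, y} : Set _) := hu ▸ Set.mem_univ _
  have m2 : (⟨c0, hc0⟩ : {c // S c}) ∈ ({x, y} : Set _) := hu ▸ Set.mem_univ _
  have m3 : (⟨c, hc⟩ : {c // S c}) ∈ ({x, y} : Set _) := hu ▸ Set.mem_univ _
  simp only [Set.mem_insert_iff, Set.mem_singleton_iff, Subtype.ext_iff] at m1 m2 m3
  rcases m1 with m1 | m1 <;> rcases m2 with m2 | m2 <;> rcases m3 with m3 | m3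
  all_goals first
    | (left; exact m3.trans m1.symm)
    | (right; exact m3.trans m2.symm)
    | (exact absurd (m2.trans m1.symm) hne)

namespace QF
variable {R : Type*} [CommRing R] [IsDedekindDomain R] {n : ℕ}

theorem cl_P_sq (q : QF R n) (hn : Squarefree n) {m : ℕ} (hm : m ∣ n) : cl (q.P m) ^ 2 = 1 := by
  have hm0 : m ≠ 0 := fun h => hn.ne_zero (Nat.eq_zero_of_zero_dvd (h ▸ hm))
  rw [pow_two, ← cl_mul (q.P_ne_bot hm0) (q.P_ne_bot hm0), q.P_sq hn hm, cl_span]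

theorem cl_P2_sq (q : QF R n) (hn4 : n % 4 = 1) : cl (q.P2) ^ 2 = 1 := by
  rw [pow_two, ← cl_mul q.P2_ne_bot q.P2_ne_bot, q.P2_sq hn4, cl_span]

theorem cl_P_mul (q : QF R n) (hn : Squarefree n) {m f : ℕ} (hm : m ∣ n) (hf : f ∣ n) :
    ∃ h, h ∣ n ∧ cl (q.P m) * cl (q.P f) = cl (q.P h) ∧ (h = 1 → m = f) ∧ (h = n → m * f = n) := by
  have hm0 : m ≠ 0 := fun h => hn.ne_zero (Nat.eq_zero_of_zero_dvd (h ▸ hm))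
  have hf0 : f ≠ 0 := fun h => hn.ne_zero (Nat.eq_zero_of_zero_dvd (h ▸ hf))
  obtain ⟨a, b, hab, ha, hb⟩ := Nat.exists_coprime m f
  set g := Nat.gcd m f with hg
  have ha0 : a ≠ 0 := by rintro rfl; simp at ha; exact hm0 ha
  have hb0 : b ≠ 0 := by rintro rfl; simp at hb; exact hf0 hb
  have hg0 : g ≠ 0 := by intro h; rw [h] at ha; simp at ha; exact hm0 ha
  have hgn : g ∣ n := (Nat.gcd_dvd_left m f).trans hm
  have habn : a * b ∣ n := hab.mul_dvd_of_dvd_of_dvd ((Dvd.intro _ ha.symm).trans hm) ((Dvd.intro _ hb.symm).trans hf)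
  refine ⟨a * b, habn, ?_, ?_, ?_⟩
  · have h1 : q.P m = q.P a * q.P g := by rw [ha]; exact q.P_mul hn (ha ▸ hm)
    have h2 : q.P f = q.P b * q.P g := by rw [hb]; exact q.P_mul hn (hb ▸ hf)
    rw [h1, h2, q.P_mul hn habn, cl_mul (q.P_ne_bot ha0) (q.P_ne_bot hg0),
      cl_mul (q.P_ne_bot hb0) (q.P_ne_bot hg0), cl_mul (q.P_ne_bot ha0) (q.P_ne_bot hb0), mul_mul_mul_comm,
      ← pow_two (cl (q.P g)), q.cl_P_sq hn hgn, mul_one]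
  · intro h
    obtain ⟨h1, h2⟩ := mul_eq_one.1 h
    rw [ha, hb, h1, h2]
  · intro h
    have h1 : a * g ∣ a * b := by rw [h, ← ha]; exact hm
    have h2 : g ∣ b := Nat.dvd_of_mul_dvd_mul_left (Nat.pos_of_ne_zero ha0) h1
    have h3 : Nat.Coprime b g := Nat.coprime_of_squarefree_mul (hn.squarefree_of_dvd (hb ▸ hf))
    have h4 : g = 1 := Nat.dvd_one.1 (by
      have := Nat.dvd_gcd h2 dvd_rfl
      rwa [h3] at this)
    rw [ha, hb, h4, mul_one, mul_one]
    exact h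

/-- an odd norm gives a square class -/
theorem norm_odd (q : QF R n) (hn : Squarefree n) (hn4 : n % 4 = 1) {m m' : ℕ} (hm : m * m' = n) {X Y Z : ℤ}
    (hZ : Z ≠ 0) (h : m * X ^ 2 + m' * Y ^ 2 = Z ^ 2) : ∃ b, cl (q.P m) = b ^ 2 := by
  have hm0 : m ≠ 0 := fun h => hn.ne_zero (by rw [← hm, h, zero_mul])
  have hd : m ∣ n := Dvd.intro _ hm
  have hm' : (n : ℤ) = m * m' := by exact_mod_cast hm.symm
  refine q.hilbert hn hn4 (q.P_ne_bot hm0) (k := Z.natAbs) (by simpa using hZ) (by rw [q.map_P, q.P_sq hn hd]) (m * X) Y ?_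
  rw [Int.natAbs_sq, ← h, hm']; ring

theorem norm_even (q : QF R n) (hn : Squarefree n) (hn4 : n % 4 = 1) {m m' : ℕ} (hm : m * m' = n) {X Y Z : ℤ}
    (hZ : Z ≠ 0) (h : m * X ^ 2 + m' * Y ^ 2 = 2 * Z ^ 2) : ∃ b, cl (q.P2 * q.P m) = b ^ 2 := by
  have hm0 : m ≠ 0 := fun h => hn.ne_zero (by rw [← hm, h, zero_mul])
  have hd : m ∣ n := Dvd.intro _ hm
  have hm' : (n : ℤ) = m * m' := by exact_mod_cast hm.symm
  refine q.hilbert hn hn4 (mul_ne_zero q.P2_ne_bot (q.P_ne_bot hm0)) (k := Z.natAbs) (by simpa using hZ)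
    (q.P2P_sq hn hn4 hd) (m * X) Y ?_
  rw [Int.natAbs_sq, hm']; push_cast; linear_combination (m : ℤ) * h

theorem T4 (q : QF R n) (hn : Squarefree n) (hn4 : n % 4 = 1) {I : Ideal R} {e : ℕ} (hI : I ≠ ⊥)
    (hσ : I.map q.σ = I) (hIe : I * I = Ideal.span {(e : R)}) (he : Squarefree e)
    (hb : ∃ b, cl I = b ^ 4) :
    ∃ (X Y : ℤ) (w : ℕ), w ≠ 0 ∧ IsCoprime X Y ∧ X ^ 2 + n * Y ^ 2 = e * w ^ 4 := by
  obtain ⟨b, hb⟩ := hb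
  obtain ⟨B0, hB0, hB0c⟩ := cl_surj b⁻¹
  let S : Set (Ideal R) := {B | B ≠ ⊥ ∧ cl I * cl B ^ 4 = 1}
  have hS : S.Nonempty := ⟨B0, hB0, by rw [hB0c, hb]; group⟩
  obtain ⟨B, ⟨hB, hBc⟩, hmax⟩ : ∃ B : Ideal R, B ∈ S ∧ ∀ I ∈ S, ¬ B < I :=
    set_has_maximal_iff_noetherian.2 (inferInstance : IsNoetherian R R) S hS
  -- removing a factor
  have remove : ∀ Q : Ideal R, Q ≠ ⊤ → B ≤ Q → cl Q ^ 4 = 1 → False := by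
    intro Q hQ hBQ hQ4
    obtain ⟨B', hB'⟩ := Ideal.dvd_iff_le.2 hBQ
    have hQ0 : Q ≠ ⊥ := fun h => hB (by rw [hB', h, Ideal.bot_mul])
    have hB'0 : B' ≠ ⊥ := fun h => hB (by rw [hB', h, Ideal.mul_bot])
    have hB'S : B' ∈ S := ⟨hB'0, by
      rw [hB', cl_mul hQ0 hB'0, mul_pow, hQ4, one_mul] at hBc; exact hBc⟩
    refine hmax B' hB'S (lt_of_le_of_ne (hB'.le.trans Ideal.mul_le_right) ?_)
    intro h
    apply hQ
    have : Q * B' = 1 * B' := by rw [← hB', one_mul, h]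
    have := mul_right_cancel₀ hB'0 this
    rw [this, Ideal.one_eq_top]
  have hsup : B ⊔ B.map q.σ = ⊤ := by
    by_contra hne
    obtain ⟨M, hM, hle⟩ := Ideal.exists_le_maximal _ hne
    have hM1 : B ≤ M := le_sup_left.trans hle
    have hM2 : B.map q.σ ≤ M := le_sup_right.trans hle
    have hM0 : M ≠ ⊥ := fun h => hB (by rw [eq_bot_iff, ← h]; exact hM1)
    have hM3 : B ≤ M.map q.σ := by
      have := Ideal.map_mono (f := q.σ) hM2
      rwa [q.mapmap] at this
    obtain ⟨g, hg0, hg⟩ := q.norm_ideal hn hn4 hM0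
    by_cases hMM : M.map q.σ = M
    · rw [hMM] at hg
      refine remove M hM.ne_top hM1 ?_
      have := congrArg cl hg
      rw [cl_mul hM0 hM0, cl_span] at this
      calc cl M ^ 4 = (cl M * cl M) ^ 2 := by rw [← pow_two, ← pow_mul]
        _ = 1 := by rw [this, one_pow]
    · have hc : IsCoprime M (M.map q.σ) := by
        rw [Ideal.isCoprime_iff_sup_eq]
        by_contra h
        have h1 : M ⊔ M.map q.σ = M := (hM.eq_of_le h le_sup_left).symm
        have h2 : M.map q.σ ≤ M := le_trans le_sup_right h1.le
        have h3 : M ≤ M.map q.σ := by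
          have := Ideal.map_mono (f := q.σ) h2
          rwa [q.mapmap] at this
        exact hMM (le_antisymm h2 h3)
      refine remove (M * M.map q.σ) ?_ ?_ ?_
      · intro h
        exact hM.ne_top (top_le_iff.1 (h.ge.trans Ideal.mul_le_left))
      · rw [← Ideal.inf_eq_mul_of_isCoprime hc]; exact le_inf hM1 hM3
      · rw [hg, cl_span, one_pow]
  obtain ⟨w, hw0, hw⟩ := q.norm_ideal hn hn4 hB
  have hIB : I * B ^ 4 ≠ ⊥ := mul_ne_zero hI (pow_ne_zero 4 hB)
  obtain ⟨η, hη⟩ := (cl_eq_one_iff hIB).1 (by rw [cl_mul hI (pow_ne_zero 4 hB), cl_pow hB]; exact hBc)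
  have hnorm : (I * B ^ 4) * (I * B ^ 4).map q.σ = Ideal.span {((e * w ^ 4 : ℕ) : R)} := by
    rw [Ideal.map_mul, Ideal.map_pow, hσ, mul_mul_mul_comm, hIe, ← mul_pow, hw, Ideal.span_singleton_pow,
      Ideal.span_singleton_mul_span_singleton]
    push_cast; rfl
  obtain ⟨X, Y, hηX, hXY⟩ := q.principal_norm hnorm hη
  refine ⟨X, Y, w, hw0, ?_, by rw [hXY]; push_cast; rfl⟩
  rw [Int.isCoprime_iff_gcd_eq_one]
  by_contra hgcd
  obtain ⟨p, hp, hpd⟩ := Nat.exists_prime_and_dvd hgcd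
  have hpX : (p : ℤ) ∣ X := (Int.natCast_dvd_natCast.2 hpd).trans (Int.gcd_dvd_left _ _)
  have hpY : (p : ℤ) ∣ Y := (Int.natCast_dvd_natCast.2 hpd).trans (Int.gcd_dvd_right _ _)
  have hpη : (p : R) ∣ η := by
    have := (q.dvd_iff p X Y).2 ⟨hpX, hpY⟩
    rw [hηX]; simpa using this
  have l1 : I * B ^ 4 ≤ Ideal.span {(p : R)} := by
    rw [hη, Ideal.span_singleton_le_span_singleton]; exact hpη
  have l2 : I * (B.map q.σ) ^ 4 ≤ Ideal.span {(p : R)} := by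
    have := Ideal.map_mono (f := q.σ) l1
    rwa [q.map_span_nat, Ideal.map_mul, Ideal.map_pow, hσ] at this
  have hsup4 : B ^ 4 ⊔ (B.map q.σ) ^ 4 = ⊤ := by
    rw [← Ideal.isCoprime_iff_sup_eq] at hsup ⊢
    exact hsup.pow
  have l3 : I ≤ Ideal.span {(p : R)} := by
    calc I = I * (B ^ 4 ⊔ (B.map q.σ) ^ 4) := by rw [hsup4, Ideal.mul_top]
      _ ≤ _ := by rw [Ideal.mul_sup]; exact sup_le l1 l2
  have l4 := Ideal.mul_mono l3 l3
  rw [hIe, Ideal.span_singleton_mul_span_singleton, Ideal.span_singleton_le_span_singleton] at l4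
  have l5 := (q.cast_dvd (p * p) e).1 (by exact_mod_cast l4)
  have l6 : p * p ∣ e := by exact_mod_cast l5
  exact hp.one_lt.ne' (Nat.isUnit_iff.1 (he p l6))

end QF


theorem not_both_dvd {p : ℕ} (hp : p.Prime) {x y : ℤ} (h : IsCoprime x y) (hx : (p : ℤ) ∣ x)
    (hy : (p : ℤ) ∣ y) : False :=
  (Nat.prime_iff_prime_int.1 hp).not_unit (h.isUnit_of_dvd' hx hy)

theorem prim_aux {a b : ℕ} (hab : Squarefree (a * b)) {x y z k : ℤ} (hxy : IsCoprime x y)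
    (h : a * x ^ 2 + b * y ^ 2 = k * z ^ 2) {p : ℕ} (hp : p.Prime) (hz : (p : ℤ) ∣ z) :
    ¬ (p : ℤ) ∣ a ∧ ¬ (p : ℤ) ∣ x := by
  have hpi := Nat.prime_iff_prime_int.1 hp
  have key : (p : ℤ) ∣ a ∨ (p : ℤ) ∣ x → False := by
    intro hor
    have h1 : (p : ℤ) ∣ b * y ^ 2 := by
      have e : (b : ℤ) * y ^ 2 = k * z ^ 2 - a * x ^ 2 := by linarith
      rw [e]
      refine dvd_sub (Dvd.dvd.mul_left (dvd_pow hz two_ne_zero) _) ?_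
      rcases hor with h | h
      · exact h.mul_right _
      · exact (dvd_pow h two_ne_zero).mul_left _
    have h2 : (p : ℤ) ∣ y := by
      obtain ⟨hc, -, hb⟩ := Nat.squarefree_mul_iff.1 hab
      rcases hor with h3 | h3
      · rcases hpi.dvd_or_dvd h1 with h4 | h4
        · exfalso
          exact hp.one_lt.ne' (Nat.dvd_one.1 (hc ▸ Nat.dvd_gcd (by exact_mod_cast h3) (by exact_mod_cast h4)))
        · exact hpi.dvd_of_dvd_pow h4
      · have : (p : ℤ) ^ 2 ∣ b * y ^ 2 := by
          have e : (b : ℤ) * y ^ 2 = k * z ^ 2 - a * x ^ 2 := by linarith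
          rw [e]
          exact dvd_sub (Dvd.dvd.mul_left (pow_dvd_pow_of_dvd hz 2) _) (Dvd.dvd.mul_left (pow_dvd_pow_of_dvd h3 2) _)
        exact sf_dvd hb this
    have h5 : (p : ℤ) ∣ x := by
      obtain ⟨hc, ha, hb⟩ := Nat.squarefree_mul_iff.1 hab
      apply sf_dvd ha
      have e : (a : ℤ) * x ^ 2 = k * z ^ 2 - b * y ^ 2 := by linarith
      rw [e]
      exact dvd_sub (Dvd.dvd.mul_left (pow_dvd_pow_of_dvd hz 2) _) (Dvd.dvd.mul_left (pow_dvd_pow_of_dvd h2 2) _)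
    exact not_both_dvd hp hxy h5 h2
  exact ⟨fun h => key (.inl h), fun h => key (.inr h)⟩

theorem prim_sol {a b : ℕ} (hab : Squarefree (a * b)) {x y z k : ℤ} (hxy : IsCoprime x y)
    (h : a * x ^ 2 + b * y ^ 2 = k * z ^ 2) {p : ℕ} (hp : p.Prime) (hz : (p : ℤ) ∣ z) :
    ¬ (p : ℤ) ∣ a ∧ ¬ (p : ℤ) ∣ b ∧ ¬ (p : ℤ) ∣ x ∧ ¬ (p : ℤ) ∣ y := by
  obtain ⟨h1, h2⟩ := prim_aux hab hxy h hp hz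
  obtain ⟨h3, h4⟩ := prim_aux (mul_comm a b ▸ hab) hxy.symm (by rw [add_comm]; exact h) hp hz
  exact ⟨h1, h3, h2, h4⟩

theorem coprime_of_primes {x y : ℤ} (hy : y ≠ 0)
    (h : ∀ p : ℕ, p.Prime → (p : ℤ) ∣ y → ¬ (p : ℤ) ∣ x) : IsCoprime x y := by
  rw [Int.isCoprime_iff_gcd_eq_one]
  by_contra hg
  obtain ⟨p, hp, hpd⟩ := Nat.exists_prime_and_dvd hg
  exact h p hp ((Int.natCast_dvd_natCast.2 hpd).trans (Int.gcd_dvd_right _ _))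
    ((Int.natCast_dvd_natCast.2 hpd).trans (Int.gcd_dvd_left _ _))

theorem leg_kernel {m m' : ℕ} (hn : Squarefree (m * m'))
    (h1 : ∀ p : ℕ, p.Prime → p ∣ m → jacobiSym m' p = 1)
    (h2 : ∀ p : ℕ, p.Prime → p ∣ m' → jacobiSym m p = 1) :
    ∃ X Y Z : ℤ, Z ≠ 0 ∧ m * X ^ 2 + m' * Y ^ 2 = Z ^ 2 := by
  obtain ⟨hc, ha, hb⟩ := Nat.squarefree_mul_iff.1 hn
  obtain ⟨x, y, z, hz, h⟩ := legendre_jac ha hb squarefree_one hc (Nat.coprime_one_right _) (Nat.coprime_one_right _)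
    (by simpa using h1) (by simpa using h2) (by
      intro p hp hd
      exact absurd (Nat.dvd_one.1 hd) hp.one_lt.ne')
  exact ⟨x, y, z, hz, by simpa using h⟩

namespace QF
variable {R : Type*} [CommRing R] [IsDedekindDomain R] {n : ℕ}

theorem T5 (q : QF R n) (hn : Squarefree n) (hn4 : n % 4 = 1) (hP : PP n) {f f' : ℕ} (hf : f * f' = n)
    {x y : ℤ} {z : ℕ} (hxy : IsCoprime x y) (hz0 : 0 < z) (hz4 : z % 4 = 1)
    (h : f * x ^ 2 + f' * y ^ 2 = 2 * (z : ℤ) ^ 2)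
    (Hk : ∀ m m' : ℕ, m * m' = n → ∀ X Y Z : ℤ, Z ≠ 0 → m * X ^ 2 + m' * Y ^ 2 = Z ^ 2 → m = 1 ∨ m = n) :
    ∃ b, cl (q.P2 * q.P f) = b ^ 4 := by
  have hn0 := hn.ne_zero
  have hsf : Squarefree (f * f') := hf ▸ hn
  have hfn : f ∣ n := Dvd.intro _ hf
  have hf0 : f ≠ 0 := by rintro rfl; simp at hf; exact hn0 hf.symm
  have hn' : (n : ℤ) = f * f' := by exact_mod_cast hf.symm
  have hz0' : (z : ℤ) ≠ 0 := by exact_mod_cast hz0.ne'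
  have hsol := fun (p : ℕ) (hp : p.Prime) (hz : (p : ℤ) ∣ z) => prim_sol hsf hxy h hp hz
  have hN : (f * x) ^ 2 + n * y ^ 2 = (2 * f : ℕ) * (z : ℤ) ^ 2 := by
    rw [hn']; push_cast; linear_combination (f : ℤ) * h
  have hcz : IsCoprime ((2 * f * x : ℤ)) (z : ℤ) := by
    refine coprime_of_primes hz0' fun p hp hd hd2 => ?_
    obtain ⟨h1, h2, h3, h4⟩ := hsol p hp hd
    have hpi := Nat.prime_iff_prime_int.1 hp
    rcases hpi.dvd_or_dvd hd2 with h5 | h5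
    · rcases hpi.dvd_or_dvd h5 with h6 | h6
      · have : p ∣ 2 := by exact_mod_cast h6
        have : p = 2 := (Nat.prime_dvd_prime_iff_eq hp Nat.prime_two).1 this
        subst this
        omega
      · exact h1 h6
    · exact h3 h5
  have hcfx : IsCoprime (f * x : ℤ) (z : ℤ) := hcz.of_isCoprime_of_dvd_left ⟨2, by ring⟩
  have hcy : IsCoprime y (z : ℤ) := coprime_of_primes hz0' fun p hp hd => (hsol p hp hd).2.2.2
  have hcn : IsCoprime (z : ℤ) (n : ℤ) := by
    refine (coprime_of_primes hz0' fun p hp hd hd2 => ?_).symm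
    obtain ⟨h1, h2, h3, h4⟩ := hsol p hp hd
    have hpi := Nat.prime_iff_prime_int.1 hp
    rw [hn'] at hd2
    exact (hpi.dvd_or_dvd hd2).elim h1 h2
  have hJn : jacobiSym z n = 1 := by
    have hodd : Odd z := by rw [Nat.odd_iff]; omega
    rw [jac_recip_nat hP hn0 hodd]
    have h1 : jacobiSym (-n) z = 1 := by
      refine jac_sq (x := y) (t := f * x) ?_ hcfx
      exact ⟨-((2 * f : ℕ) * z), by linear_combination -hN⟩
    rwa [neg_eq_neg_one_mul, jacobiSym.mul_left, jacobiSym.at_neg_one hodd, ZMod.χ₄_nat_one_mod_four hz4, one_mul] at h1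
  obtain ⟨m, m', hmm, hm1, hm2⟩ := LA hn hP hcn (by
    intro m m' hmm h1 h2
    obtain ⟨X, Y, Z, hZ, hXYZ⟩ := leg_kernel (hmm ▸ hn) h1 h2
    rcases Hk m m' hmm X Y Z hZ hXYZ with rfl | rfl
    · simp
    · exact hJn)
  have hsm : Squarefree (m * m') := hmm ▸ hn
  obtain ⟨hmc, hms, hms'⟩ := Nat.squarefree_mul_iff.1 hsm
  have hmn : m ∣ n := Dvd.intro _ hmm
  have hm0 : m ≠ 0 := hms.ne_zero
  have hn'' : (n : ℤ) = m * m' := by exact_mod_cast hmm.symm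
  have hcn' : Nat.Coprime z n := Nat.isCoprime_iff_coprime.1 hcn
  obtain ⟨X, Y, W, hW, hXYW⟩ := legendre (Nat.pos_of_ne_zero hm0) (Nat.pos_of_ne_zero hms'.ne_zero) hz0 hmc
    (hcn'.coprime_dvd_right hmn).symm (hcn'.coprime_dvd_right (Dvd.intro_left _ hmm)).symm
    (crt_sq hms _ fun p hp hd => .inl (by rw [mul_comm]; exact hm1 p hp hd))
    (crt_sq hms' _ fun p hp hd => .inl (by rw [mul_comm]; exact hm2 p hp hd)) (by
      obtain ⟨u, v, huv⟩ := hcy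
      refine ⟨f * x * u, ?_⟩
      rw [← hn'']
      have : (z : ℤ) ∣ u ^ 2 * ((f * x) ^ 2 + n * y ^ 2) + n * (1 - u * y) * (1 + u * y) := by
        refine dvd_add ?_ ?_
        · rw [hN]; exact ⟨u ^ 2 * (2 * f : ℕ) * z, by ring⟩
        · refine Dvd.dvd.mul_right (Dvd.dvd.mul_left ⟨v, by linear_combination -huv⟩ _) _
      have e : u ^ 2 * ((f * x) ^ 2 + n * y ^ 2) + n * (1 - u * y) * (1 + u * y) = (f * x * u) ^ 2 + n := by ring
      rwa [e] at this)
  -- the ideal `(z, ξ)`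
  set ξ : R := ((f * x : ℤ) : R) + y * q.s with hξ
  have hξN : ξ * q.σ ξ = ((2 * f : ℕ) : R) * z ^ 2 := by
    rw [q.norm_eq, hN]; push_cast; ring
  set E : Ideal R := Ideal.span {(z : R), ξ} with hE
  have hzR : (z : R) ≠ 0 := q.natcast_ne hz0.ne'
  have hE0 : E ≠ ⊥ := by
    intro h0
    have : (z : R) ∈ E := Ideal.subset_span (by simp)
    rw [h0] at this; exact hzR this
  have hσξ : q.σ ξ = ((f * x : ℤ) : R) - y * q.s := by
    rw [hξ]; simp [q.hσ]; ring
  have hEE : E * E.map q.σ = Ideal.span {(z : R)} := by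
    rw [hE, Ideal.map_span, Set.image_pair, map_natCast, Ideal.span_pair_mul_span_pair]
    apply le_antisymm
    · rw [Ideal.span_le]
      rintro r (rfl | rfl | rfl | rfl) <;> rw [SetLike.mem_coe, Ideal.mem_span_singleton]
      · exact Dvd.intro _ rfl
      · exact Dvd.intro _ rfl
      · exact Dvd.intro_left _ rfl
      · rw [hξN]; exact ⟨((2 * f : ℕ) : R) * z, by ring⟩
    · rw [Ideal.span_singleton_le_iff_mem]
      set S := Ideal.span {(z : R) * z, z * q.σ ξ, ξ * z, ξ * q.σ ξ}
      have m1 : (z : R) * z ∈ S := Ideal.subset_span (by simp)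
      have m2 : (z : R) * q.σ ξ ∈ S := Ideal.subset_span (by simp)
      have m3 : ξ * z ∈ S := Ideal.subset_span (by simp)
      obtain ⟨u, v, huv⟩ := hcz
      have huv' : (u : R) * (2 * f * x) + v * z = 1 := by exact_mod_cast congrArg (Int.cast : ℤ → R) huv
      have m4 := add_mem (Ideal.mul_mem_left _ (u : R) (add_mem m2 m3)) (Ideal.mul_mem_left _ (v : R) m1)
      have e : (u : R) * (z * q.σ ξ + ξ * z) + v * (z * z) = z := by
        rw [hσξ, hξ]; push_cast; linear_combination (z : R) * huv'
      rw [e] at m4; exact m4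
  set I : Ideal R := q.P2 * q.P f with hI
  have hPf0 := q.P_ne_bot hf0
  have hI0 : I ≠ ⊥ := mul_ne_zero q.P2_ne_bot hPf0
  have hIσ : I.map q.σ = I := by rw [hI, Ideal.map_mul, q.map_P, q.map_P2]
  have hII : I * I = Ideal.span {((2 * f : ℕ) : R)} := by
    have := q.P2P_sq hn hn4 hfn
    rwa [← hI, hIσ] at this
  have hoddf : Odd f := (hP.dvd hfn).odd hf0
  have hpar : (2 : ℤ) ∣ f * x - y := by
    have hf'o : Odd f' := (hP.dvd (Dvd.intro_left _ hf)).odd (by rintro rfl; simp at hf; exact hn0 hf.symm)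
    have h1 : Even (f * x ^ 2 + f' * y ^ 2 : ℤ) := by rw [h]; exact ⟨_, two_mul _⟩
    rw [← even_iff_two_dvd]
    have hfi : ¬ Even (f : ℤ) := by rw [Int.not_even_iff_odd]; exact_mod_cast hoddf
    have hfi' : ¬ Even (f' : ℤ) := by rw [Int.not_even_iff_odd]; exact_mod_cast hf'o
    simp [Int.even_add, Int.even_sub, Int.even_mul, Int.even_pow, hfi, hfi'] at h1 ⊢
    exact h1
  have hξI : ξ ∈ I := by
    obtain ⟨k, hk⟩ := hpar
    obtain ⟨l, hl⟩ := hoddf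
    have hk' : (f : R) * x - y = 2 * k := by exact_mod_cast congrArg (Int.cast : ℤ → R) hk
    have hl' : (f : R) = 2 * l + 1 := by exact_mod_cast congrArg (Nat.cast : ℕ → R) hl
    have a1 : ξ ∈ q.P2 := Ideal.mem_span_pair.2 ⟨(k : R), (y : R), by rw [hξ]; push_cast; linear_combination -hk'⟩
    have a2 : ξ ∈ q.P f := Ideal.mem_span_pair.2 ⟨(x : R), (y : R), by rw [hξ]; push_cast; ring⟩
    have hc : IsCoprime q.P2 (q.P f) := by
      rw [Ideal.isCoprime_iff_sup_eq, Ideal.eq_top_iff_one]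
      have b1 : (2 : R) ∈ q.P2 := Ideal.subset_span (by simp)
      have b2 : (f : R) ∈ q.P f := Ideal.subset_span (by simp)
      have b3 := add_mem (Ideal.mem_sup_left (T := q.P f) (Ideal.mul_mem_left _ (-(l : R)) b1)) (Ideal.mem_sup_right (S := q.P2) b2)
      have e : -(l : R) * 2 + f = 1 := by rw [hl']; ring
      rwa [e] at b3
    rw [hI, ← Ideal.inf_eq_mul_of_isCoprime hc]
    exact ⟨a1, a2⟩
  have hξI' : q.σ ξ ∈ I := by rw [← hIσ]; exact Ideal.mem_map_of_mem _ hξI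
  have h2f : ((2 * f : ℕ) : R) ≠ 0 := q.natcast_ne (by omega)
  have hle : I * (E * E) ≤ Ideal.span {ξ} := by
    rw [Ideal.mul_le]
    intro p hp r hr
    have hp' : p * q.σ ξ ∈ Ideal.span {((2 * f : ℕ) : R)} := by rw [← hII]; exact Ideal.mul_mem_mul hp hξI'
    obtain ⟨t, ht⟩ := Ideal.mem_span_singleton.1 hp'
    have hpz : p * (z * z) = t * ξ := by
      apply mul_left_cancel₀ h2f
      linear_combination ξ * ht - p * hξN
    rw [hE, Ideal.span_pair_mul_span_pair] at hr
    refine Submodule.span_induction (p := fun y _ => p * y ∈ Ideal.span {ξ}) ?_ ?_ ?_ ?_ hr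
    · rintro r (rfl | rfl | rfl | rfl) <;> rw [Ideal.mem_span_singleton]
      · exact ⟨t, by rw [hpz]; ring⟩
      · exact ⟨p * z, by ring⟩
      · exact ⟨p * z, by ring⟩
      · exact ⟨p * ξ, by ring⟩
    · simp
    · intro x y _ _ hx hy; rw [mul_add]; exact Ideal.add_mem _ hx hy
    · intro a x _ hx
      rw [smul_eq_mul, mul_left_comm]; exact Ideal.mul_mem_left _ _ hx
  obtain ⟨Q, hQ⟩ := Ideal.dvd_iff_le.2 hle
  have hξ0 : ξ ≠ 0 := by
    intro h0; rw [h0, zero_mul] at hξN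
    exact mul_ne_zero h2f (pow_ne_zero 2 hzR) hξN.symm
  have hQ1 : Q = ⊤ := by
    have h1 : (I * (E * E)) * (I * (E * E)).map q.σ = Ideal.span {((2 * f : ℕ) : R) * z ^ 2} := by
      rw [Ideal.map_mul, hIσ, Ideal.map_mul, mul_mul_mul_comm, hII, mul_mul_mul_comm, hEE,
        Ideal.span_singleton_mul_span_singleton, Ideal.span_singleton_mul_span_singleton, pow_two]
    rw [hQ, Ideal.map_mul, Ideal.map_span, Set.image_singleton, mul_mul_mul_comm, Ideal.span_singleton_mul_span_singleton, hξN] at h1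
    have h2 : Q * Q.map q.σ = 1 := by
      apply mul_left_cancel₀ (span_ne_bot (mul_ne_zero h2f (pow_ne_zero 2 hzR)))
      rw [h1, mul_one]
    rw [Ideal.one_eq_top] at h2
    exact top_le_iff.1 (h2.ge.trans Ideal.mul_le_left)
  rw [hQ1, Ideal.mul_top] at hQ
  have hcl : cl I * (cl E * cl E) = 1 := by
    rw [← cl_mul hE0 hE0, ← cl_mul hI0 (mul_ne_zero hE0 hE0), hQ, cl_span]
  have hPm0 := q.P_ne_bot hm0
  obtain ⟨L, hL⟩ := q.hilbert hn hn4 (I := E * q.P m) (mul_ne_zero hE0 hPm0) (a := z * m) (k := W.natAbs)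
    (by simpa using hW) (by
      rw [Ideal.map_mul, mul_mul_mul_comm, hEE, q.map_P, q.P_sq hn hmn, Ideal.span_singleton_mul_span_singleton]
      push_cast; rfl) (m * X) Y (by
      rw [Int.natAbs_sq, hn'']; push_cast; linear_combination (m : ℤ) * hXYW)
  rw [cl_mul hE0 hPm0] at hL
  have hsq := q.cl_P_sq hn hmn
  refine ⟨L⁻¹, ?_⟩
  have h3 : cl E * cl E = L ^ 4 := by
    calc cl E * cl E = (cl E * cl (q.P m)) ^ 2 := by rw [mul_pow, hsq, mul_one, pow_two]
      _ = L ^ 4 := by rw [hL, ← pow_mul]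
  rw [h3] at hcl
  rw [inv_pow]
  exact eq_inv_of_mul_eq_one_left hcl

end QF


section conj
theorem conj_exists {k R : Type*} [CommRing k] [CommRing R] [Algebra k R] (s : R) (n : k)
    (hs : s * s = -algebraMap k R n)
    (rep : ∀ x : R, ∃ X Y : k, x = algebraMap k R X + algebraMap k R Y * s)
    (uniq : ∀ X Y : k, algebraMap k R X + algebraMap k R Y * s = 0 → X = 0 ∧ Y = 0) :
    ∃ σ : R →+* R, σ s = -s ∧ ∀ a b : k, σ (algebraMap k R a + algebraMap k R b * s) = algebraMap k R a - algebraMap k R b * s := by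
  choose A B hAB using rep
  have key : ∀ (a b : k), A (algebraMap k R a + algebraMap k R b * s) = a ∧
      B (algebraMap k R a + algebraMap k R b * s) = b := by
    intro a b
    have h := hAB (algebraMap k R a + algebraMap k R b * s)
    have h2 := uniq (a - A (algebraMap k R a + algebraMap k R b * s)) (b - B (algebraMap k R a + algebraMap k R b * s))
      (by rw [map_sub, map_sub]; linear_combination h)
    exact ⟨(sub_eq_zero.1 h2.1).symm, (sub_eq_zero.1 h2.2).symm⟩
  have hf : ∀ (x : R) (a b : k), x = algebraMap k R a + algebraMap k R b * s →
      algebraMap k R (A x) - algebraMap k R (B x) * s = algebraMap k R a - algebraMap k R b * s := by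
    rintro x a b rfl
    rw [(key a b).1, (key a b).2]
  refine ⟨{ toFun := fun x => algebraMap k R (A x) - algebraMap k R (B x) * s
            map_one' := ?_, map_mul' := ?_, map_zero' := ?_, map_add' := ?_ }, ?_, ?_⟩
  · rw [hf 1 1 0 (by simp)]; simp
  · intro x y
    rw [hf (x * y) (A x * A y - n * B x * B y) (A x * B y + B x * A y)]
    · simp only [map_sub, map_add, map_mul]
      linear_combination -(algebraMap k R (B x) * algebraMap k R (B y)) * hs
    · conv_lhs => rw [hAB x, hAB y]
      simp only [map_sub, map_add, map_mul]
      linear_combination (algebraMap k R (B x) * algebraMap k R (B y)) * hs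
  · rw [hf 0 0 0 (by simp)]; simp
  · intro x y
    rw [hf (x + y) (A x + A y) (B x + B y)]
    · simp only [map_add]; ring
    · conv_lhs => rw [hAB x, hAB y]
      simp only [map_add]; ring
  · show algebraMap k R (A s) - algebraMap k R (B s) * s = -s
    rw [hf s 0 1 (by simp)]; simp
  · intro a b
    exact hf _ a b rfl
end conj

open NumberField in
theorem QF_exists {n : ℕ} (hn : Squarefree n) (hn4 : n % 4 = 1)
    (K : Type) [Field K] [NumberField K] (hdeg : Module.finrank ℚ K = 2)
    (s : K) (hs : s ^ 2 = -(n : K)) :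
    Nonempty (QF (𝓞 K) n) ∧ ∀ e : ℕ, (∃ x : K, x ≠ 0 ∧ Algebra.norm ℚ x = (e : ℚ)) →
      ∃ X Y Z : ℤ, Z ≠ 0 ∧ X ^ 2 + n * Y ^ 2 = e * Z ^ 2 := by
  have hn0 := hn.ne_zero
  have hnp : (0 : ℚ) < n := by positivity
  have uniqK : ∀ X Y : ℚ, algebraMap ℚ K X + algebraMap ℚ K Y * s = 0 → X = 0 ∧ Y = 0 := by
    intro X Y h
    have h1 : algebraMap ℚ K (X ^ 2 + n * Y ^ 2) = 0 := by
      simp only [map_add, map_mul, map_pow, map_natCast]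
      linear_combination (algebraMap ℚ K X - algebraMap ℚ K Y * s) * h + (algebraMap ℚ K Y)^2 * hs
    have h2 : X ^ 2 + n * Y ^ 2 = 0 := (map_eq_zero _).1 h1
    have hX := sq_nonneg X
    have hY := sq_nonneg Y
    constructor
    · have : X ^ 2 = 0 := by nlinarith
      simpa using this
    · have : (n : ℚ) * Y ^ 2 = 0 := by nlinarith
      simpa [hn0] using this
  have hli : LinearIndependent ℚ ![(1 : K), s] := by
    rw [LinearIndependent.pair_iff]
    intro a b h
    apply uniqK
    simpa [Algebra.smul_def] using h
  let b := basisOfLinearIndependentOfCardEqFinrank hli (by simp [hdeg])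
  have hb0 : b 0 = 1 := by simp [b]
  have hb1 : b 1 = s := by simp [b]
  have repK : ∀ x : K, ∃ X Y : ℚ, x = algebraMap ℚ K X + algebraMap ℚ K Y * s := by
    intro x
    have := b.sum_repr x
    rw [Fin.sum_univ_two, hb0, hb1] at this
    refine ⟨b.repr x 0, b.repr x 1, ?_⟩
    conv_lhs => rw [← this]
    simp [Algebra.smul_def]
  have normK : ∀ X Y : ℚ, Algebra.norm ℚ (algebraMap ℚ K X + algebraMap ℚ K Y * s) = X ^ 2 + n * Y ^ 2 := by
    intro X Y
    have e0 : (algebraMap ℚ K X + algebraMap ℚ K Y * s) * b 0 = X • b 0 + Y • b 1 := by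
      rw [hb0, hb1]; simp [Algebra.smul_def]
    have e1 : (algebraMap ℚ K X + algebraMap ℚ K Y * s) * b 1 = (-n * Y) • b 0 + X • b 1 := by
      rw [hb0, hb1]; simp [Algebra.smul_def]; linear_combination (Y : K) * hs
    rw [Algebra.norm_eq_matrix_det b, Matrix.det_fin_two]
    simp only [Algebra.leftMulMatrix_eq_repr_mul, e0, e1, map_add, map_smul, Module.Basis.repr_self]
    simp
    ring
  obtain ⟨σ, hσs, hσ⟩ := conj_exists (k := ℚ) s (n : ℚ) (by rw [← pow_two, hs]; simp) repK uniqK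
  have hsint : IsIntegral ℤ s := by
    refine ⟨Polynomial.X ^ 2 + Polynomial.C (n : ℤ), ?_, ?_⟩
    · exact Polynomial.monic_X_pow_add_C _ two_ne_zero
    · simp [hs]
  refine ⟨?_, ?_⟩
  · let S : 𝓞 K := ⟨s, hsint⟩
    have hSc : ((S : 𝓞 K) : K) = s := rfl
    have hS : S * S = -(n : 𝓞 K) := by
      apply RingOfIntegers.ext
      push_cast [hSc]
      rw [← pow_two, hs]
    have ratint : ∀ t : ℚ, IsIntegral ℤ (algebraMap ℚ K t) → ∃ z : ℤ, t = z := by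
      intro t ht
      have h1 : IsIntegral ℤ t := (isIntegral_algebraMap_iff (algebraMap ℚ K).injective).1 ht
      obtain ⟨z, hz⟩ := IsIntegrallyClosed.isIntegral_iff.1 h1
      exact ⟨z, by rw [← hz]; simp⟩
    have rep : ∀ x : 𝓞 K, ∃ X Y : ℤ, x = X + Y * S := by
      intro x
      obtain ⟨a, c, hac⟩ := repK x
      have hx : IsIntegral ℤ (x : K) := RingOfIntegers.isIntegral_coe x
      have hx' : IsIntegral ℤ (σ x) := map_isIntegral_int σ hx
      have hσx : σ x = algebraMap ℚ K a - algebraMap ℚ K c * s := by rw [hac]; exact hσ a c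
      obtain ⟨A, hA⟩ := ratint (2 * a) (by
        have := hx.add hx'
        have e : (x : K) + σ x = algebraMap ℚ K (2 * a) := by rw [hσx, hac]; simp; ring
        rwa [e] at this)
      obtain ⟨N, hN⟩ := ratint (a ^ 2 + n * c ^ 2) (by
        have := hx.mul hx'
        have e : (x : K) * σ x = algebraMap ℚ K (a ^ 2 + n * c ^ 2) := by
          rw [hσx, hac]; simp; linear_combination -(c : K) ^ 2 * hs
        rwa [e] at this)
      have h4 : (n : ℚ) * (2 * c) ^ 2 = ((4 * N - A ^ 2 : ℤ) : ℚ) := by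
        push_cast; rw [← hN, ← hA]; ring
      obtain ⟨B, hB⟩ : ∃ B : ℤ, 2 * c = B := by
        set r := 2 * c
        have hr : r * r.den = r.num := Rat.mul_den_eq_num r
        have h5 : (n : ℤ) * r.num ^ 2 = (4 * N - A ^ 2) * (r.den : ℤ) ^ 2 := by
          have : (n : ℚ) * r.num ^ 2 = ((4 * N - A ^ 2 : ℤ) : ℚ) * (r.den : ℚ) ^ 2 := by
            rw [← h4, ← hr]; ring
          exact_mod_cast this
        have h6 : (r.den : ℤ) ∣ r.num := sf_dvd hn ⟨4 * N - A ^ 2, by rw [h5]; ring⟩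
        have h7 : r.den = 1 := by
          have h8 := r.reduced
          have h9 : r.den ∣ r.num.natAbs := by simpa using Int.natAbs_dvd_natAbs.2 h6
          exact Nat.eq_one_of_dvd_coprimes h8 h9 dvd_rfl
        exact ⟨r.num, by rw [← hr, h7]; simp⟩
      have h5 : A ^ 2 + n * B ^ 2 = 4 * N := by
        have : (A : ℚ) ^ 2 + n * B ^ 2 = 4 * N := by rw [← hA, ← hB, ← hN]; ring
        exact_mod_cast this
      obtain ⟨k, hk⟩ : ∃ k : ℤ, (n : ℤ) = 4 * k + 1 := ⟨n / 4, by omega⟩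
      have h6 : Even A ∧ Even B := by
        rw [hk] at h5
        rcases Int.even_or_odd' A with ⟨a', ha | ha⟩ <;> rcases Int.even_or_odd' B with ⟨b', hb | hb⟩
        · exact ⟨⟨a', by omega⟩, ⟨b', by omega⟩⟩
        · exfalso; rw [ha, hb] at h5; ring_nf at h5; omega
        · exfalso; rw [ha, hb] at h5; ring_nf at h5; omega
        · exfalso; rw [ha, hb] at h5; ring_nf at h5; omega
      obtain ⟨⟨X, hX⟩, ⟨Y, hY⟩⟩ := h6
      refine ⟨X, Y, ?_⟩
      have ha : a = X := by rw [hX] at hA; push_cast at hA; linarith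
      have hc : c = Y := by rw [hY] at hB; push_cast at hB; linarith
      apply RingOfIntegers.ext
      rw [hac, ha, hc]
      push_cast [hSc]
      simp
    have uniq : ∀ X Y : ℤ, (X : 𝓞 K) + Y * S = 0 → X = 0 ∧ Y = 0 := by
      intro X Y h
      have h1 : (X : K) + Y * s = 0 := by
        have := congrArg (fun t : 𝓞 K => (t : K)) h
        push_cast [hSc] at this
        simpa using this
      have := uniqK X Y (by simpa using h1)
      exact_mod_cast this
    obtain ⟨τ, hτ, _⟩ := conj_exists (k := ℤ) (R := 𝓞 K) S (n : ℤ) (by rw [hS]; simp) (by simpa using rep) (by simpa using uniq)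
    exact ⟨⟨S, hS, rep, uniq, τ, hτ⟩⟩
  · rintro e ⟨x, _, hx⟩
    obtain ⟨a, c, hac⟩ := repK x
    rw [hac, normK] at hx
    refine ⟨a.num * c.den, c.num * a.den, a.den * c.den, by positivity, ?_⟩
    have h1 : a * a.den = a.num := Rat.mul_den_eq_num a
    have h2 : c * c.den = c.num := Rat.mul_den_eq_num c
    have : ((a.num * c.den : ℚ)) ^ 2 + n * (c.num * a.den) ^ 2 = e * (a.den * c.den) ^ 2 := by
      rw [← h1, ← h2, ← hx]; ring
    exact_mod_cast this


theorem f_dvd_of {f f' : ℕ} (hn : Squarefree (f * f')) {X Y r : ℤ}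
    (h : X ^ 2 + (f * f' : ℕ) * Y ^ 2 = f * r) : ∃ x, X = f * x ∧ f * x ^ 2 + f' * Y ^ 2 = r := by
  have hf : Squarefree (f : ℤ) := Int.squarefree_natCast.2 (hn.squarefree_of_dvd (Dvd.intro _ rfl))
  have h1 : (f : ℤ) ∣ X ^ 2 := ⟨r - f' * Y ^ 2, by push_cast at h; linear_combination h⟩
  obtain ⟨x, rfl⟩ := (hf.dvd_pow_iff_dvd two_ne_zero).1 h1
  refine ⟨x, rfl, ?_⟩
  apply mul_left_cancel₀ hf.ne_zero
  push_cast at h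
  linear_combination h

theorem prim_of {k : ℕ} (hk : Squarefree k) {a b : ℕ} (ha : 0 < a) (hb : 0 < b) {x y z : ℤ} (hz : z ≠ 0)
    (h : a * x ^ 2 + b * y ^ 2 = k * z ^ 2) :
    ∃ (x' y' : ℤ) (z' : ℕ), 0 < z' ∧ IsCoprime x' y' ∧ a * x' ^ 2 + b * y' ^ 2 = k * (z' : ℤ) ^ 2 := by
  have hk0 : (0 : ℤ) < k := by have := hk.ne_zero; omega
  have ha' : (0 : ℤ) < a := by omega
  have hb' : (0 : ℤ) < b := by omega
  have hg : 0 < Int.gcd x y := by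
    rw [Int.gcd_pos_iff]
    by_contra hc
    push Not at hc
    rw [hc.1, hc.2] at h
    have : 0 < k * z ^ 2 := by positivity
    rw [← h] at this; simp at this
  obtain ⟨g, x', y', hg, hc, h1, h2⟩ := Int.exists_gcd_one' hg
  have hd : (g : ℤ) ∣ z := sf_dvd hk ⟨a * x' ^ 2 + b * y' ^ 2, by rw [← h, h1, h2]; ring⟩
  obtain ⟨w, rfl⟩ := hd
  have hw : w ≠ 0 := by rintro rfl; simp at hz
  have hg0 : (g : ℤ) ^ 2 ≠ 0 := by positivity
  refine ⟨x', y', w.natAbs, by omega, Int.isCoprime_iff_gcd_eq_one.2 hc, ?_⟩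
  rw [Int.natAbs_sq]
  apply mul_left_cancel₀ hg0
  rw [h1, h2] at h
  linear_combination h

theorem w_odd_of {n : ℕ} (hn4 : n % 4 = 1) {X Y r : ℤ} {w : ℕ} (hc : IsCoprime X Y) (h : X ^ 2 + n * Y ^ 2 = r * w ^ 4) :
    w % 2 = 1 := by
  by_contra hw
  obtain ⟨v, rfl⟩ : ∃ v, w = 2 * v := ⟨w / 2, by omega⟩
  obtain ⟨k, hk⟩ : ∃ k : ℤ, (n : ℤ) = 4 * k + 1 := ⟨n / 4, by omega⟩
  rw [hk] at h
  push_cast at h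
  have h2 : ∀ t : ℤ, 2 * t ≠ 1 := fun t => by omega
  rcases Int.even_or_odd' X with ⟨a, ha | ha⟩ <;> rcases Int.even_or_odd' Y with ⟨b, hb | hb⟩
  · exact not_both_dvd Nat.prime_two hc ⟨a, ha⟩ ⟨b, hb⟩
  all_goals
    rw [ha, hb] at h; ring_nf at h; omega

section
variable {G : Type*} [CommGroup G]

theorem card8_iff (h4 : Nat.card {c : G // c ^ 2 = 1 ∧ ∃ b, c = b ^ 2} = 2) {c0 : G} (h1 : c0 ^ 2 = 1)
    (h2 : ∃ b, c0 = b ^ 2) (hne : c0 ≠ 1) :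
    Nat.card {c : G // c ^ 2 = 1 ∧ ∃ b, c = b ^ 4} = 2 ↔ ∃ b, c0 = b ^ 4 := by
  have hsub : ∀ c : G, (c ^ 2 = 1 ∧ ∃ b, c = b ^ 4) → c = 1 ∨ c = c0 := by
    rintro c ⟨h, b, rfl⟩
    exact two_elts h4 ⟨one_pow _, 1, (one_pow _).symm⟩ ⟨h1, h2⟩ hne ⟨h, b ^ 2, by rw [← pow_mul]⟩
  constructor
  · intro h
    obtain ⟨x, y, hxy, _⟩ := Nat.card_eq_two_iff.1 h
    have hx := hsub x.1 x.2
    have hy := hsub y.1 y.2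
    have hxy' : x.1 ≠ y.1 := fun h => hxy (Subtype.ext h)
    rcases hx with hx | hx
    · rcases hy with hy | hy
      · exact absurd (hx.trans hy.symm) hxy'
      · rw [← hy]; exact y.2.2
    · rw [← hx]; exact x.2.2
  · intro h
    rw [Nat.card_eq_two_iff]
    refine ⟨⟨1, one_pow _, 1, (one_pow _).symm⟩, ⟨c0, h1, h⟩, ?_, ?_⟩
    · intro h; exact hne (Subtype.ext_iff.1 h).symm
    · ext c
      have := hsub c.1 c.2
      simp only [Set.mem_insert_iff, Set.mem_singleton_iff, Set.mem_univ, iff_true]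
      rcases this with h | h
      · left; exact Subtype.ext h
      · right; exact Subtype.ext h
end

namespace QF
variable {R : Type*} [CommRing R] [IsDedekindDomain R] {n : ℕ}

theorem case1 (q : QF R n) (hn : Squarefree n) (hn4 : n % 4 = 1) (hP : PP n) (hn1 : 1 < n)
    (h4 : Nat.card {c : ClassGroup R // c ^ 2 = 1 ∧ ∃ b, c = b ^ 2} = 2)
    {f f' : ℕ} (hf : f * f' = n) {X Y Z : ℤ} (hZ : Z ≠ 0) (hXYZ : X ^ 2 + n * Y ^ 2 = (2 * f : ℕ) * Z ^ 2) :
    (∀ m m' : ℕ, m * m' = n → ∀ X Y Z : ℤ, Z ≠ 0 → m * X ^ 2 + m' * Y ^ 2 = Z ^ 2 → m = 1 ∨ m = n) ∧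
    (∀ m m' : ℕ, m * m' = n → ∀ X Y Z : ℤ, Z ≠ 0 → m * X ^ 2 + m' * Y ^ 2 = 2 * Z ^ 2 → m = f ∨ m = f') ∧
    (∃ (x y : ℤ) (z : ℕ), 0 < z ∧ IsCoprime x y ∧ f * x ^ 2 + f' * y ^ 2 = 2 * (z : ℤ) ^ 2) ∧
    (Nat.card {c : ClassGroup R // c ^ 2 = 1 ∧ ∃ b, c = b ^ 4} = 2 →
      ∃ (x y : ℤ) (w : ℕ), w % 2 = 1 ∧ IsCoprime x y ∧ f * x ^ 2 + f' * y ^ 2 = 2 * (w : ℤ) ^ 4) ∧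
    (∀ (x y : ℤ) (z : ℕ), 0 < z → z % 4 = 1 → IsCoprime x y → f * x ^ 2 + f' * y ^ 2 = 2 * (z : ℤ) ^ 2 →
      Nat.card {c : ClassGroup R // c ^ 2 = 1 ∧ ∃ b, c = b ^ 4} = 2) := by
  have hn0 := hn.ne_zero
  have hfn : f ∣ n := Dvd.intro _ hf
  have hf0 : f ≠ 0 := by rintro rfl; simp at hf; omega
  have hf0' : f' ≠ 0 := by rintro rfl; simp at hf; omega
  have hsf : Squarefree (f * f') := hf ▸ hn
  obtain ⟨x0, -, hx0⟩ := f_dvd_of hsf (X := X) (Y := Y) (r := 2 * Z ^ 2) (by rw [hf, hXYZ]; push_cast; ring)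
  have hPf := q.P_ne_bot hf0
  have c01 : cl (q.P2 * q.P f) ^ 2 = 1 := by
    rw [cl_mul q.P2_ne_bot hPf, mul_pow, q.cl_P2_sq hn4, q.cl_P_sq hn hfn, one_mul]
  have c02 := q.norm_even hn hn4 hf hZ hx0
  have c0ne := q.cl_P2P hn hn4 hn1 hfn
  have hcard := card8_iff h4 c01 c02 c0ne
  have hA : ∀ m m' : ℕ, m * m' = n → ∀ X Y Z : ℤ, Z ≠ 0 → m * X ^ 2 + m' * Y ^ 2 = Z ^ 2 → m = 1 ∨ m = n := by
    intro m m' hm X Y Z hZ h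
    have hmn : m ∣ n := Dvd.intro _ hm
    have hs := q.cl_P_sq hn hmn
    rcases two_elts h4 ⟨one_pow _, 1, (one_pow _).symm⟩ ⟨c01, c02⟩ c0ne ⟨hs, q.norm_odd hn hn4 hm hZ h⟩ with h5 | h5
    · exact q.cl_P_eq_one hn hmn h5
    · exfalso
      obtain ⟨k, hk, hk2, -, -⟩ := q.cl_P_mul hn hmn hfn
      have hk0 : k ≠ 0 := fun h => hn.ne_zero (Nat.eq_zero_of_zero_dvd (h ▸ hk))
      apply q.cl_P2P hn hn4 hn1 hk
      rw [cl_mul q.P2_ne_bot (q.P_ne_bot hk0), ← hk2]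
      rw [cl_mul q.P2_ne_bot hPf] at h5
      calc cl q.P2 * (cl (q.P m) * cl (q.P f)) = cl (q.P m) * (cl q.P2 * cl (q.P f)) := mul_left_comm _ _ _
        _ = 1 := by rw [← h5, ← pow_two, hs]
  refine ⟨hA, ?_, ?_, ?_, ?_⟩
  · intro m m' hm X Y Z hZ h
    have hmn : m ∣ n := Dvd.intro _ hm
    have hm0 : m ≠ 0 := by rintro rfl; simp at hm; omega
    have hs : cl (q.P2 * q.P m) ^ 2 = 1 := by
      rw [cl_mul q.P2_ne_bot (q.P_ne_bot hm0), mul_pow, q.cl_P2_sq hn4, q.cl_P_sq hn hmn, one_mul]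
    rcases two_elts h4 ⟨one_pow _, 1, (one_pow _).symm⟩ ⟨c01, c02⟩ c0ne ⟨hs, q.norm_even hn hn4 hm hZ h⟩ with h5 | h5
    · exact absurd h5 (q.cl_P2P hn hn4 hn1 hmn)
    · rw [cl_mul q.P2_ne_bot (q.P_ne_bot hm0), cl_mul q.P2_ne_bot hPf, mul_right_inj] at h5
      obtain ⟨k, hk, hk2, hka, hkb⟩ := q.cl_P_mul hn hmn hfn
      rw [h5, ← pow_two, q.cl_P_sq hn hfn] at hk2
      rcases q.cl_P_eq_one hn hk hk2.symm with h | h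
      · left; exact hka h
      · right
        have := hkb h
        rw [← hf, mul_comm] at this
        exact Nat.eq_of_mul_eq_mul_left (Nat.pos_of_ne_zero hf0) this
  · exact_mod_cast prim_of (k := 2) Nat.prime_two.squarefree (Nat.pos_of_ne_zero hf0) (Nat.pos_of_ne_zero hf0') hZ (by exact_mod_cast hx0)
  · intro h
    have h2f : Squarefree (2 * f) := by
      rw [Nat.squarefree_mul_iff]
      refine ⟨?_, Nat.prime_two.squarefree, hn.squarefree_of_dvd hfn⟩
      rw [Nat.coprime_two_left]
      have h1 : Odd n := Nat.odd_iff.2 (by omega)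
      rw [← hf] at h1
      exact (Nat.odd_mul.1 h1).1
    obtain ⟨X, Y, w, hw, hc, hX⟩ := q.T4 hn hn4 (I := q.P2 * q.P f) (e := 2 * f) (mul_ne_zero q.P2_ne_bot hPf)
      (by rw [Ideal.map_mul, q.map_P2, q.map_P]) (by
        have := q.P2P_sq hn hn4 hfn
        rwa [Ideal.map_mul, q.map_P2, q.map_P] at this) h2f (hcard.1 h)
    obtain ⟨x, rfl, hx⟩ := f_dvd_of hsf (X := X) (Y := Y) (r := 2 * w ^ 4) (by rw [hf, hX]; push_cast; ring)
    exact ⟨x, Y, w, w_odd_of hn4 hc hX, (IsCoprime.of_mul_left_right hc), hx⟩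
  · intro x y z hz hz4 hxy h
    exact hcard.2 (q.T5 hn hn4 hP hf hxy hz hz4 h hA)

theorem case2 (q : QF R n) (hn : Squarefree n) (hn4 : n % 4 = 1) (hn1 : 1 < n)
    (h4 : Nat.card {c : ClassGroup R // c ^ 2 = 1 ∧ ∃ b, c = b ^ 2} = 2)
    {f f' : ℕ} (hf : f * f' = n) (hf1 : f ≠ 1) (hfn' : f ≠ n) {X Y Z : ℤ} (hZ : Z ≠ 0) (hXYZ : X ^ 2 + n * Y ^ 2 = f * Z ^ 2) :
    (∀ m m' : ℕ, m * m' = n → ∀ X Y Z : ℤ, Z ≠ 0 → m * X ^ 2 + m' * Y ^ 2 = Z ^ 2 →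
      m = 1 ∨ m = n ∨ m = f ∨ m = f') ∧
    (∀ m m' : ℕ, m * m' = n → ∀ X Y Z : ℤ, Z ≠ 0 → m * X ^ 2 + m' * Y ^ 2 = 2 * Z ^ 2 → False) ∧
    (∃ X Y Z : ℤ, Z ≠ 0 ∧ f * X ^ 2 + f' * Y ^ 2 = Z ^ 2) ∧
    (Nat.card {c : ClassGroup R // c ^ 2 = 1 ∧ ∃ b, c = b ^ 4} = 2 →
      ∃ (x y : ℤ) (w : ℕ), w % 2 = 1 ∧ IsCoprime x y ∧ f * x ^ 2 + f' * y ^ 2 = (w : ℤ) ^ 4) := by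
  have hn0 := hn.ne_zero
  have hfn : f ∣ n := Dvd.intro _ hf
  have hf0 : f ≠ 0 := by rintro rfl; simp at hf; omega
  have hsf : Squarefree (f * f') := hf ▸ hn
  obtain ⟨x0, -, hx0⟩ := f_dvd_of hsf (X := X) (Y := Y) (r := Z ^ 2) (by rw [hf, hXYZ])
  have hPf := q.P_ne_bot hf0
  have c01 := q.cl_P_sq hn hfn
  have c02 := q.norm_odd hn hn4 hf hZ hx0
  have c0ne : cl (q.P f) ≠ 1 := by
    intro h
    rcases q.cl_P_eq_one hn hfn h with h | h
    · exact hf1 h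
    · exact hfn' h
  have hcard := card8_iff h4 c01 c02 c0ne
  refine ⟨?_, ?_, ⟨x0, Y, Z, hZ, hx0⟩, ?_⟩
  · intro m m' hm X Y Z hZ h
    have hmn : m ∣ n := Dvd.intro _ hm
    have hs := q.cl_P_sq hn hmn
    rcases two_elts h4 ⟨one_pow _, 1, (one_pow _).symm⟩ ⟨c01, c02⟩ c0ne ⟨hs, q.norm_odd hn hn4 hm hZ h⟩ with h5 | h5
    · rcases q.cl_P_eq_one hn hmn h5 with h | h <;> simp [h]
    · obtain ⟨k, hk, hk2, hka, hkb⟩ := q.cl_P_mul hn hmn hfn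
      rw [h5, ← pow_two, q.cl_P_sq hn hfn] at hk2
      rcases q.cl_P_eq_one hn hk hk2.symm with h | h
      · right; right; left; exact hka h
      · right; right; right
        have := hkb h
        rw [← hf, mul_comm] at this
        exact Nat.eq_of_mul_eq_mul_left (Nat.pos_of_ne_zero hf0) this
  · intro m m' hm X Y Z hZ h
    have hmn : m ∣ n := Dvd.intro _ hm
    have hm0 : m ≠ 0 := by rintro rfl; simp at hm; omega
    have hs : cl (q.P2 * q.P m) ^ 2 = 1 := by
      rw [cl_mul q.P2_ne_bot (q.P_ne_bot hm0), mul_pow, q.cl_P2_sq hn4, q.cl_P_sq hn hmn, one_mul]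
    rcases two_elts h4 ⟨one_pow _, 1, (one_pow _).symm⟩ ⟨c01, c02⟩ c0ne ⟨hs, q.norm_even hn hn4 hm hZ h⟩ with h5 | h5
    · exact absurd h5 (q.cl_P2P hn hn4 hn1 hmn)
    · obtain ⟨k, hk, hk2, -, -⟩ := q.cl_P_mul hn hmn hfn
      have hk0 : k ≠ 0 := fun h => hn.ne_zero (Nat.eq_zero_of_zero_dvd (h ▸ hk))
      apply q.cl_P2P hn hn4 hn1 hk
      rw [cl_mul q.P2_ne_bot (q.P_ne_bot hk0), ← hk2, ← mul_assoc, ← cl_mul q.P2_ne_bot (q.P_ne_bot hm0), h5, ← pow_two, c01]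
  · intro h
    obtain ⟨X, Y, w, hw, hc, hX⟩ := q.T4 hn hn4 (I := q.P f) (e := f) hPf
      (q.map_P f) (q.P_sq hn hfn) (hn.squarefree_of_dvd hfn) (hcard.1 h)
    obtain ⟨x, rfl, hx⟩ := f_dvd_of hsf (X := X) (Y := Y) (r := w ^ 4) (by rw [hf, hX])
    exact ⟨x, Y, w, w_odd_of hn4 hc hX, (IsCoprime.of_mul_left_right hc), hx⟩

end QF


theorem odd_sq_mod8 {x : ℤ} (h : x % 2 = 1) : x ^ 2 % 8 = 1 := by
  obtain ⟨k, rfl⟩ : ∃ k, x = 2 * k + 1 := ⟨x / 2, by omega⟩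
  have : (2 * k + 1) ^ 2 = 4 * (k * (k + 1)) + 1 := by ring
  rw [this]
  have := Int.even_mul_succ_self k
  obtain ⟨j, hj⟩ := this
  omega

set_option maxHeartbeats 1600000 in
/-- first torsor analysis -/
theorem TA {n α β γ δ : ℕ} (hn : n % 8 = 1) (hα : α % 2 = 1) (hβ : β % 2 = 0)
    (hc : Nat.Coprime (n * α) β) (hβ0 : 0 < β)
    (h1 : n * α ^ 2 + β ^ 2 = γ ^ 2) (h2 : δ ^ 2 + β ^ 2 = n * α ^ 2) :
    ∃ (r s n1 n2 : ℕ) (δ' : ℤ), β = 2 * r * s ∧ n1 * n2 = n ∧ n1 % 8 = (1 + β) % 8 ∧ β % 4 = 0 ∧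
      δ' % 8 = 1 ∧ δ' ^ 2 = (δ : ℤ) ^ 2 ∧
      (∀ p : ℕ, p.Prime → p % 4 = 1 → p ∣ n1 → jacobiSym n2 p = jacobiSym (r * s) p) ∧
      (∀ p : ℕ, p.Prime → p % 4 = 1 → p ∣ n2 → jacobiSym n1 p = jacobiSym (r * s) p) := by
  have hn0 : 0 < n := by omega
  have h1' : (n : ℤ) * α ^ 2 + β ^ 2 = γ ^ 2 := by exact_mod_cast h1
  have h2' : (δ : ℤ) ^ 2 + β ^ 2 = n * α ^ 2 := by exact_mod_cast h2
  have hα8 : (α : ℤ) ^ 2 % 8 = 1 := odd_sq_mod8 (by omega)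
  have hnα8 : ((n : ℤ) * α ^ 2) % 8 = 1 := by rw [Int.mul_emod, hα8]; omega
  obtain ⟨b, rfl⟩ : ∃ b, β = 2 * b := ⟨β / 2, by omega⟩
  have hδo : (δ : ℤ) % 2 = 1 := by
    by_contra h
    obtain ⟨t, ht⟩ : ∃ t : ℤ, (δ : ℤ) = 2 * t := ⟨δ / 2, by omega⟩
    rw [ht] at h2'; push_cast at h2'; ring_nf at h2' hnα8; omega
  have hγo : (γ : ℤ) % 2 = 1 := by
    by_contra h
    obtain ⟨t, ht⟩ : ∃ t : ℤ, (γ : ℤ) = 2 * t := ⟨γ / 2, by omega⟩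
    rw [ht] at h1'; push_cast at h1'; ring_nf at h1' hnα8; omega
  have hδ8 := odd_sq_mod8 hδo
  have hb2 : b % 2 = 0 := by
    by_contra h
    have : (b : ℤ) ^ 2 % 8 = 1 := odd_sq_mod8 (by omega)
    push_cast at h2'; ring_nf at h2' hnα8; omega
  -- choose sign
  obtain ⟨δ', hδ', hδ4⟩ : ∃ δ' : ℤ, (δ' = δ ∨ δ' = -δ) ∧ (γ + δ') % 4 = 2 := by
    by_cases h : ((γ : ℤ) + δ) % 4 = 2
    · exact ⟨δ, .inl rfl, h⟩
    · exact ⟨-δ, .inr rfl, by omega⟩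
  have hδsq : δ' ^ 2 = (δ : ℤ) ^ 2 := by rcases hδ' with h | h <;> rw [h]; ring
  have hlt : (δ : ℤ) < γ := by
    have : (δ : ℤ) ^ 2 < γ ^ 2 := by rw [← h1', ← h2']; push_cast; nlinarith
    exact lt_of_pow_lt_pow_left₀ 2 (by positivity) this
  obtain ⟨P, hP⟩ : ∃ P : ℕ, (γ : ℤ) + δ' = 2 * P := ⟨(((γ : ℤ) + δ') / 2).toNat, by
    rw [Int.toNat_of_nonneg (by rcases hδ' with h | h <;> omega)]; omega⟩
  obtain ⟨Q, hQ⟩ : ∃ Q : ℕ, (γ : ℤ) - δ' = 2 * (2 * Q) := ⟨(((γ : ℤ) - δ') / 4).toNat, by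
    rw [Int.toNat_of_nonneg (by rcases hδ' with h | h <;> omega)]; omega⟩
  have hγP : (γ : ℤ) = P + 2 * Q := by linarith
  have hδP : δ' = P - 2 * Q := by linarith
  have hPQ : P * Q = b ^ 2 := by
    have : (P : ℤ) * Q = b ^ 2 := by
      have e : (γ : ℤ) ^ 2 - δ' ^ 2 = 2 * (2 * b) ^ 2 := by rw [hδsq]; push_cast at h1' h2'; linarith
      rw [hγP, hδP] at e; ring_nf at e; linarith
    exact_mod_cast this
  have hnα : (n : ℤ) * α ^ 2 = P ^ 2 + 4 * Q ^ 2 := by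
    have hb' : (b : ℤ) ^ 2 = P * Q := by exact_mod_cast hPQ.symm
    rw [← h2', ← hδsq, hδP]; push_cast; linear_combination 4 * hb'
  have hcPQ : Nat.Coprime P Q := by
    rw [Nat.coprime_iff_gcd_eq_one]
    by_contra hg
    obtain ⟨p, hp, hpd⟩ := Nat.exists_prime_and_dvd hg
    have hp1 := hpd.trans (Nat.gcd_dvd_left _ _)
    have hp2 := hpd.trans (Nat.gcd_dvd_right _ _)
    have a1 : p ∣ n * α := by
      have : p ∣ n * α ^ 2 := by
        have : n * α ^ 2 = P ^ 2 + 4 * Q ^ 2 := by exact_mod_cast hnα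
        rw [this]; exact dvd_add (dvd_pow hp1 two_ne_zero) (Dvd.dvd.mul_left (dvd_pow hp2 two_ne_zero) _)
      rcases hp.dvd_mul.1 this with h | h
      · exact h.mul_right _
      · exact (hp.dvd_of_dvd_pow h).mul_left _
    have a2 : p ∣ 2 * b := by
      have : p ∣ b ^ 2 := hPQ ▸ hp1.mul_right _
      exact (hp.dvd_of_dvd_pow this).mul_left _
    exact hp.one_lt.ne' (Nat.eq_one_of_dvd_coprimes hc a1 a2)
  obtain ⟨x1, x2, r, s, hx, hr, hs⟩ := sqsplit hcPQ (n := 1) (c := b) (by rw [hPQ, one_mul]) one_pos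
  obtain ⟨rfl, rfl⟩ := (mul_eq_one.1 hx.symm)
  rw [one_mul] at hr hs
  have hbrs : b = r * s := by
    have : b ^ 2 = (r * s) ^ 2 := by rw [← hPQ, hr, hs]; ring
    exact Nat.pow_left_injective two_ne_zero this
  have hcrs : Nat.Coprime r s := by
    rw [hr, hs] at hcPQ
    exact Nat.Coprime.coprime_dvd_left (dvd_pow_self _ two_ne_zero) (Nat.Coprime.coprime_dvd_right (dvd_pow_self _ two_ne_zero) hcPQ)
  have hr2 : r % 2 = 1 := by
    by_contra h
    obtain ⟨t, ht⟩ : ∃ t, r = 2 * t := ⟨r / 2, by omega⟩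
    have : P = 4 * t ^ 2 := by rw [hr, ht]; ring
    omega
  have hs2 : s % 2 = 0 := by
    by_contra h
    rw [hbrs, Nat.mul_mod, hr2] at hb2
    omega
  obtain ⟨t, ht⟩ : ∃ t, s = 2 * t := ⟨s / 2, by omega⟩
  have hrZ := odd_sq_mod8 (x := r) (by omega)
  -- the two factors
  obtain ⟨F2, hF2⟩ : ∃ F2 : ℕ, (F2 : ℤ) = r ^ 2 - 2 * r * s + 2 * s ^ 2 :=
    ⟨((r : ℤ) ^ 2 - 2 * r * s + 2 * s ^ 2).toNat, Int.toNat_of_nonneg (by nlinarith [sq_nonneg ((r : ℤ) - s), sq_nonneg (s : ℤ)])⟩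
  obtain ⟨F1, hF1⟩ : ∃ F1 : ℕ, F1 = r ^ 2 + 2 * r * s + 2 * s ^ 2 := ⟨_, rfl⟩
  have hF1' : (F1 : ℤ) = r ^ 2 + 2 * r * s + 2 * s ^ 2 := by exact_mod_cast hF1
  have hFF : F1 * F2 = n * α ^ 2 := by
    have : (F1 : ℤ) * F2 = n * α ^ 2 := by
      rw [hnα, hF1', hF2, hr, hs]; push_cast; ring
    exact_mod_cast this
  have hrs4 : ∀ p : ℕ, p.Prime → p ∣ F1 → p ∣ F2 → False := by
    intro p hp hp1 hp2
    have hpi := Nat.prime_iff_prime_int.1 hp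
    have i1 : (p : ℤ) ∣ F1 := Int.natCast_dvd_natCast.2 hp1
    have i2 : (p : ℤ) ∣ F2 := Int.natCast_dvd_natCast.2 hp2
    have hp2 : ¬ (p : ℤ) ∣ 4 := by
      intro h
      have h2 : p ∣ 2 := (hp.dvd_of_dvd_pow (m := 2) (n := 2) (by exact_mod_cast h))
      have h3 : 2 ∣ F1 := by rw [(Nat.prime_dvd_prime_iff_eq hp Nat.prime_two).1 h2] at hp1; exact hp1
      have h4 : (2 : ℤ) ∣ F1 := by exact_mod_cast h3
      rw [hF1', ht] at h4; push_cast at h4; ring_nf at h4; omega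
    have a1 : (p : ℤ) ∣ 4 * (r * s) := by
      have := dvd_sub i1 i2; rw [hF1', hF2] at this
      have e : ((r : ℤ) ^ 2 + 2 * r * s + 2 * s ^ 2 - (r ^ 2 - 2 * r * s + 2 * s ^ 2)) = 4 * (r * s) := by ring
      rwa [e] at this
    have hcz : IsCoprime (r : ℤ) s := Nat.isCoprime_iff_coprime.2 hcrs
    have n2 : ¬ (p : ℤ) ∣ 2 := fun h => hp2 (h.trans ⟨2, rfl⟩)
    rcases (hpi.dvd_or_dvd a1).resolve_left hp2 |> hpi.dvd_or_dvd with h | h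
    · have : (p : ℤ) ∣ 2 * s ^ 2 := by
        obtain ⟨k, hk⟩ := h
        obtain ⟨j, hj⟩ := i1
        exact ⟨j - k * (r + 2 * s), by linear_combination hj - hF1' - hk * (r + 2 * s)⟩
      exact not_both_dvd hp hcz h (hpi.dvd_of_dvd_pow ((hpi.dvd_or_dvd this).resolve_left n2))
    · have : (p : ℤ) ∣ r ^ 2 := by
        obtain ⟨k, hk⟩ := h
        obtain ⟨j, hj⟩ := i1
        exact ⟨j - k * (2 * r + 2 * s), by linear_combination hj - hF1' - hk * (2 * r + 2 * s)⟩
      exact not_both_dvd hp hcz (hpi.dvd_of_dvd_pow this) h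
  have hcF : Nat.Coprime F1 F2 := by
    rw [Nat.coprime_iff_gcd_eq_one]
    by_contra hg
    obtain ⟨p, hp, hpd⟩ := Nat.exists_prime_and_dvd hg
    exact hrs4 p hp (hpd.trans (Nat.gcd_dvd_left _ _)) (hpd.trans (Nat.gcd_dvd_right _ _))
  obtain ⟨n1, n2, t1, t2, hn12, e1, e2⟩ := sqsplit hcF hFF hn0
  have ht1 : t1 % 2 = 1 := by
    by_contra h
    obtain ⟨v, hv⟩ : ∃ v, t1 = 2 * v := ⟨t1 / 2, by omega⟩
    have : (F1 : ℤ) = 2 * (2 * n1 * v ^ 2) := by rw [e1, hv]; push_cast; ring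
    rw [hF1', ht] at this; push_cast at this; ring_nf at this; ring_nf at hrZ; omega
  have e1z : (n1 : ℤ) * t1 ^ 2 = r ^ 2 + 2 * r * s + 2 * s ^ 2 := by rw [← hF1', e1]; push_cast; ring
  have e2z : (n2 : ℤ) * t2 ^ 2 = r ^ 2 - 2 * r * s + 2 * s ^ 2 := by rw [← hF2, e2]; push_cast; ring
  have loc : ∀ (p : ℕ) (a : ℤ) (t : ℕ) (c : ℤ), p.Prime → p % 4 = 1 → (c = 2 ∨ c = -2) → ¬ (p : ℤ) ∣ a * t ^ 2 →
      (p : ℤ) ∣ a * t ^ 2 - c ^ 2 * ((r * s : ℕ) : ℤ) ∨ (p : ℤ) ∣ a * t ^ 2 + c ^ 2 * ((r * s : ℕ) : ℤ) →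
      jacobiSym a p = jacobiSym (r * s) p := by
    intro p a t c hp hp4 hc hnd hor
    have hpi := Nat.prime_iff_prime_int.1 hp
    have hPP : PP p := fun q hq hd => by rw [(Nat.prime_dvd_prime_iff_eq hq hp).1 hd]; exact hp4
    have ht0 : ¬ (p : ℤ) ∣ t := fun h => hnd ((dvd_pow h two_ne_zero).mul_left _)
    have hc0 : ¬ (p : ℤ) ∣ c := by
      intro h
      have h2 : (p : ℤ) ∣ 2 := by rcases hc with rfl | rfl; exact h; exact (Int.dvd_neg.2 h)
      have h3 : p ∣ 2 := by exact_mod_cast h2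
      have := Nat.le_of_dvd two_pos h3
      have := hp.two_le
      omega
    have s1 : jacobiSym (a * t ^ 2) p = jacobiSym a p := by
      rw [jacobiSym.mul_left, jacobiSym.sq_one', mul_one]
      rw [Int.gcd_comm]
      exact Int.isCoprime_iff_gcd_eq_one.1 (hpi.coprime_iff_not_dvd.2 ht0)
    have s2 : jacobiSym (c ^ 2 * ((r * s : ℕ) : ℤ)) p = jacobiSym (r * s) p := by
      rw [jacobiSym.mul_left, jacobiSym.sq_one', one_mul]
      · push_cast; rfl
      rw [Int.gcd_comm]
      exact Int.isCoprime_iff_gcd_eq_one.1 (hpi.coprime_iff_not_dvd.2 hc0)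
    rw [← s1, ← s2]
    rcases hor with h | h
    · exact jac_congr h
    · rw [← jac_neg hPP hp.ne_zero (c ^ 2 * _)]
      exact jac_congr (by rwa [sub_neg_eq_add])
  refine ⟨r, s, n1, n2, δ', by rw [hbrs]; ring, hn12.symm, ?_, ?_, ?_, hδsq, ?_, ?_⟩
  · have t8 := odd_sq_mod8 (x := t1) (by omega)
    have e3 : ((n1 : ℤ) * t1 ^ 2) % 8 = (1 + 2 * b) % 8 := by
      rw [e1z, hbrs, ht]; push_cast
      have e : (r : ℤ) ^ 2 + 2 * r * (2 * t) + 2 * (2 * t) ^ 2 = r ^ 2 + 2 * (r * (2 * t)) + 8 * t ^ 2 := by ring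
      rw [e]; omega
    rw [Int.mul_emod, t8] at e3
    omega
  · omega
  · have : δ' = r ^ 2 - 8 * t ^ 2 := by rw [hδP, hr, hs, ht]; push_cast; ring
    omega
  · intro p hp hp4 hd
    have hpF : p ∣ F1 := e1 ▸ hd.mul_right _
    refine loc p n2 t2 2 hp hp4 (.inl rfl) ?_ (.inr ?_)
    · intro h; apply hrs4 p hp hpF; rw [e2]; exact_mod_cast h
    · rw [e2z]
      obtain ⟨k, hk⟩ := Int.natCast_dvd_natCast.2 hpF
      exact ⟨k, by push_cast; linear_combination hk - hF1'⟩
  · intro p hp hp4 hd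
    have hpF : p ∣ F2 := e2 ▸ hd.mul_right _
    refine loc p n1 t1 2 hp hp4 (.inl rfl) ?_ (.inl ?_)
    · intro h; apply hrs4 p hp _ hpF; rw [e1]; exact_mod_cast h
    · rw [e1z]
      obtain ⟨k, hk⟩ := Int.natCast_dvd_natCast.2 hpF
      exact ⟨k, by push_cast; linear_combination hk - hF2⟩

theorem jac_pm {a : ℤ} {m : ℕ} (h : IsCoprime a (m : ℤ)) : jacobiSym a m = 1 ∨ jacobiSym a m = -1 :=
  jacobiSym.eq_one_or_neg_one (Int.isCoprime_iff_gcd_eq_one.1 h)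

theorem jac_comm {a b : ℕ} (hPa : PP a) (ha : a ≠ 0) (hPb : PP b) (hb : b ≠ 0) :
    jacobiSym a b = jacobiSym b a := jac_recip_nat hPb hb (hPa.odd ha)

theorem jac_mul_right {a : ℤ} {b c : ℕ} (hb : b ≠ 0) (hc : c ≠ 0) :
    jacobiSym a (b * c) = jacobiSym a b * jacobiSym a c := jacobiSym.mul_right' a hb hc

/-- genus theory part of the first torsor -/
theorem TA_genus {n d d' n1 n2 : ℕ} {k : ℤ} {rs : ℤ} (hn : Squarefree n) (hP : PP n) (hd : d * d' = n) (h12 : n1 * n2 = n)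
    (hk1 : ∀ p : ℕ, p.Prime → p ∣ d → jacobiSym (k * d') p = 1)
    (hk2 : ∀ p : ℕ, p.Prime → p ∣ d' → jacobiSym (k * d) p = 1)
    (a1 : ∀ p : ℕ, p.Prime → p ∣ n1 → jacobiSym n2 p = jacobiSym rs p)
    (a2 : ∀ p : ℕ, p.Prime → p ∣ n2 → jacobiSym n1 p = jacobiSym rs p) :
    jacobiSym rs d = jacobiSym k n1 := by
  have hn0 := hn.ne_zero
  have hcop : Nat.Coprime n1 n2 := Nat.coprime_of_squarefree_mul (h12 ▸ hn)
  have hcop' : Nat.Coprime d d' := Nat.coprime_of_squarefree_mul (hd ▸ hn)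
  obtain ⟨f1, f2, hf, hf1, hf2⟩ : ∃ f1 f2, d = f1 * f2 ∧ f1 ∣ n1 ∧ f2 ∣ n2 := by
    refine ⟨Nat.gcd d n1, Nat.gcd d n2, ?_, Nat.gcd_dvd_right _ _, Nat.gcd_dvd_right _ _⟩
    rw [← Nat.Coprime.gcd_mul d hcop, h12, Nat.gcd_eq_left (Dvd.intro _ hd)]
  obtain ⟨g1, hg1⟩ := hf1
  obtain ⟨g2, hg2⟩ := hf2
  subst hf hg1 hg2
  have hf0 : f1 * f2 ≠ 0 := by intro h; rw [h] at hd; simp at hd; exact hn0 hd.symm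
  have hd' : d' = g1 * g2 := by
    apply Nat.eq_of_mul_eq_mul_left (Nat.pos_of_ne_zero hf0)
    rw [hd, ← h12]; ring
  subst hd'
  have hf10 : f1 ≠ 0 := by rintro rfl; simp at hf0
  have hf20 : f2 ≠ 0 := by rintro rfl; simp at hf0
  have hg10 : g1 ≠ 0 := by rintro rfl; simp at hd; exact hn0 hd.symm
  have hg20 : g2 ≠ 0 := by rintro rfl; simp at hd; exact hn0 hd.symm
  have P1 : PP f1 := hP.dvd ⟨f2 * (g1 * g2), by rw [← hd]; ring⟩
  have P2 : PP f2 := hP.dvd ⟨f1 * (g1 * g2), by rw [← hd]; ring⟩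
  have Q1 : PP g1 := hP.dvd ⟨f1 * f2 * g2, by rw [← hd]; ring⟩
  have Q2 : PP g2 := hP.dvd ⟨f1 * f2 * g1, by rw [← hd]; ring⟩
  have e1 : jacobiSym rs f1 = jacobiSym f2 f1 * jacobiSym g2 f1 := by
    rw [← jacobiSym.mul_left, ← jac_prod hf10 (fun p hp hpd => a1 p hp (hpd.mul_right _))]; push_cast; rfl
  have e2 : jacobiSym rs f2 = jacobiSym f1 f2 * jacobiSym g1 f2 := by
    rw [← jacobiSym.mul_left, ← jac_prod hf20 (fun p hp hpd => a2 p hp (hpd.mul_right _))]; push_cast; rfl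
  have e3 : jacobiSym k f1 * (jacobiSym g1 f1 * jacobiSym g2 f1) = 1 := by
    rw [← jacobiSym.mul_left, ← jacobiSym.mul_left]
    refine jac_prod_one hf10 fun p hp hpd => ?_
    have := hk1 p hp (hpd.mul_right _)
    push_cast at this; exact this
  have e4 : jacobiSym k g1 * (jacobiSym f1 g1 * jacobiSym f2 g1) = 1 := by
    rw [← jacobiSym.mul_left, ← jacobiSym.mul_left]
    refine jac_prod_one hg10 fun p hp hpd => ?_
    have := hk2 p hp (hpd.mul_right _)
    push_cast at this; exact this
  have cz : ∀ a b : ℕ, a ≠ 0 → b ≠ 0 → Nat.Coprime a b → jacobiSym a b * jacobiSym a b = 1 := by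
    intro a b _ _ h
    rcases jac_pm (Nat.isCoprime_iff_coprime.2 h) with h | h <;> rw [h] <;> rfl
  have hsf1 : Squarefree (f1 * f2 * (g1 * g2)) := hd ▸ hn
  have c1 : Nat.Coprime f2 f1 := (Nat.coprime_of_squarefree_mul (hsf1.squarefree_of_dvd ⟨g1 * g2, rfl⟩)).symm
  have c2 : Nat.Coprime f1 g1 := (Nat.coprime_of_squarefree_mul (hsf1.squarefree_of_dvd ⟨f2 * g2, by ring⟩))
  have k1 := cz _ _ hf20 hf10 c1
  have k2 := cz _ _ hf10 hg10 c2
  rw [jac_mul_right hf10 hf20, jac_mul_right hf10 hg10, e1, e2, jac_comm P1 hf10 P2 hf20, jac_comm Q1 hg10 P2 hf20]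
  rw [jac_comm Q1 hg10 P1 hf10] at e3
  set A := jacobiSym f2 f1
  set B := jacobiSym f1 g1
  set C := jacobiSym g2 f1
  set D := jacobiSym f2 g1
  set U := jacobiSym k f1
  set V := jacobiSym k g1
  have u2 : U * U = 1 := by
    have := Int.isUnit_iff.1 (IsUnit.of_mul_eq_one _ e3)
    rcases this with h | h <;> rw [h] <;> rfl
  have v2 : V * V = 1 := by
    have := Int.isUnit_iff.1 (IsUnit.of_mul_eq_one _ e4)
    rcases this with h | h <;> rw [h] <;> rfl
  have hC : B * C = U := by linear_combination U * e3 - B * C * u2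
  have hD : B * D = V := by linear_combination V * e4 - B * D * v2
  rw [← hC, ← hD]
  linear_combination C * D * k1 - C * D * k2


open GaussianInt in
theorem gauss_split {δ β : ℤ} {D : ℕ} {m : ℤ} (hD : D % 2 = 1) (hc : IsCoprime δ β) (h : δ ^ 2 + β ^ 2 = D * m) :
    ∃ c e a b : ℤ, c ^ 2 + e ^ 2 = D ∧ δ = c * a - e * b ∧ β = c * b + e * a := by
  let z : GaussianInt := ⟨δ, β⟩
  let w : GaussianInt := ((D : ℤ) : GaussianInt)
  have hw : w = ⟨D, 0⟩ := Zsqrtd.ext (by simp [w]) (by simp [w])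
  let g := EuclideanDomain.gcd z w
  obtain ⟨q, hq⟩ := EuclideanDomain.gcd_dvd_left z w
  obtain ⟨r, hr⟩ := EuclideanDomain.gcd_dvd_right z w
  change z = g * q at hq
  change w = g * r at hr
  have hbez : g = z * EuclideanDomain.gcdA z w + w * EuclideanDomain.gcdB z w := EuclideanDomain.gcd_eq_gcd_ab z w
  set A := EuclideanDomain.gcdA z w
  set B := EuclideanDomain.gcdB z w
  have hzz : z * star z = w * (m : GaussianInt) := by
    rw [hw]
    apply Zsqrtd.ext
    · simp [z]; linear_combination h
    · simp [z]; ring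
  have hws : star w = w := by rw [hw]; apply Zsqrtd.ext <;> simp
  have h1 : w ∣ g * star g := by
    rw [hbez, star_add, star_mul, star_mul, hws]
    refine ⟨(m : GaussianInt) * (A * star A) + z * A * star B + B * star z * star A + B * star B * w, ?_⟩
    linear_combination (A * star A) * hzz
  have h2 : g * star g ∣ w := by
    obtain ⟨u, v, huv⟩ := hc
    have a1 : g * star g ∣ w * w := by
      refine ⟨r * star r, ?_⟩
      nth_rewrite 2 [← hws]
      rw [hr, star_mul]; ring
    have a2 : g * star g ∣ w * z := by
      refine ⟨q * star r, ?_⟩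
      nth_rewrite 1 [← hws]
      rw [hr, hq, star_mul]; ring
    have a3 : g * star g ∣ w * star z := by
      refine ⟨r * star q, ?_⟩
      rw [hr, hq, star_mul]; ring
    have e1 : (u : GaussianInt) * (z + star z) + (v : GaussianInt) * (⟨0, -1⟩ * (z - star z)) = 2 := by
      apply Zsqrtd.ext
      · simp [z]; linear_combination 2 * huv
      · simp [z]
    obtain ⟨k, hk⟩ : ∃ k : ℤ, (D : ℤ) = 2 * k + 1 := ⟨D / 2, by omega⟩
    have e2 : w = 2 * (k : GaussianInt) + 1 := by
      rw [hw, hk]; apply Zsqrtd.ext <;> simp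
    have e3 : w = w * w - k * ((u : GaussianInt) * (w * z + w * star z) + (v : GaussianInt) * (⟨0, -1⟩ * (w * z - w * star z))) := by
      linear_combination (-w) * e2 + (k : GaussianInt) * w * e1
    rw [e3]
    exact dvd_sub a1 (Dvd.dvd.mul_left (dvd_add (Dvd.dvd.mul_left (dvd_add a2 a3) _) (Dvd.dvd.mul_left (Dvd.dvd.mul_left (dvd_sub a2 a3) _) _)) _)
  obtain ⟨N, hN⟩ : ∃ N : ℤ, N = g.re ^ 2 + g.im ^ 2 := ⟨_, rfl⟩
  have hgg : g * star g = (N : GaussianInt) := by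
    apply Zsqrtd.ext
    · simp; rw [hN]; ring
    · simp; ring
  rw [hgg] at h1 h2
  have h1' : (D : ℤ) ∣ N := by
    obtain ⟨t, ht⟩ := h1
    exact ⟨t.re, by have := congrArg Zsqrtd.re ht; simpa [hw] using this⟩
  have h2' : N ∣ (D : ℤ) := by
    obtain ⟨t, ht⟩ := h2
    exact ⟨t.re, by have := congrArg Zsqrtd.re ht; simpa [hw] using this⟩
  have h3 : g.re ^ 2 + g.im ^ 2 = D := hN ▸ Int.dvd_antisymm (by rw [hN]; positivity) (by positivity) h2' h1'
  refine ⟨g.re, g.im, q.re, q.im, h3, ?_, ?_⟩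
  · have := congrArg Zsqrtd.re hq; simp [z] at this; linarith
  · have := congrArg Zsqrtd.im hq; simp [z] at this; linarith

theorem gauss_split' {δ β : ℤ} {D : ℕ} {m : ℤ} (hD : D % 2 = 1) (hc : IsCoprime δ β) (hδ : δ % 2 = 1)
    (hβ : β % 2 = 0) (hD0 : D ≠ 0) (h : δ ^ 2 + β ^ 2 = D * m) :
    ∃ c e a b : ℤ, c ^ 2 + e ^ 2 = D ∧ δ = c * a - e * b ∧ β = c * b + e * a ∧ c % 2 = 1 ∧ e % 2 = 0 ∧
      a % 2 = 1 ∧ b % 2 = 0 ∧ a ^ 2 + b ^ 2 = m ∧ IsCoprime a b := by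
  have key : ∃ c e a b : ℤ, c ^ 2 + e ^ 2 = D ∧ δ = c * a - e * b ∧ β = c * b + e * a ∧ c % 2 = 1 ∧ e % 2 = 0 := by
    obtain ⟨c, e, a, b, h1, h2, h3⟩ := gauss_split hD hc h
    rcases Int.even_or_odd' c with ⟨c', hc' | hc'⟩ <;> rcases Int.even_or_odd' e with ⟨e', he' | he'⟩
    · exfalso; rw [hc', he'] at h1; ring_nf at h1; omega
    · exact ⟨-e, c, b, -a, by linear_combination h1, by linear_combination h2, by linear_combination h3, by omega, by omega⟩
    · exact ⟨c, e, a, b, h1, h2, h3, by omega, by omega⟩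
    · exfalso; rw [hc', he'] at h1; ring_nf at h1; omega
  obtain ⟨c, e, a, b, h1, h2, h3, h4, h5⟩ := key
  obtain ⟨c', rfl⟩ : ∃ c', c = 2 * c' + 1 := ⟨c / 2, by omega⟩
  obtain ⟨e', rfl⟩ : ∃ e', e = 2 * e' := ⟨e / 2, by omega⟩
  refine ⟨2 * c' + 1, 2 * e', a, b, h1, h2, h3, h4, h5, ?_, ?_, ?_, ?_⟩
  · rw [h2] at hδ; ring_nf at hδ; omega
  · rw [h3] at hβ; ring_nf at hβ; omega
  · have hD' : (D : ℤ) ≠ 0 := by exact_mod_cast hD0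
    apply mul_left_cancel₀ hD'
    rw [← h, ← h1, h2, h3]; ring
  · obtain ⟨u, v, huv⟩ := hc
    exact ⟨u * (2 * c' + 1) + v * (2 * e'), -u * (2 * e') + v * (2 * c' + 1), by rw [h2, h3] at huv; linear_combination huv⟩


theorem PP.ndvd_two {d p : ℕ} (h : PP d) (hp : p.Prime) (hd : p ∣ d) : ¬ (p : ℤ) ∣ 2 := by
  intro h2
  have h3 : p ∣ 2 := by exact_mod_cast h2
  have := h p hp hd
  have := Nat.le_of_dvd two_pos h3
  have := hp.two_le
  omega

theorem theta_exists {d D : ℕ} (hsf : Squarefree (d * D)) (hP : PP d) (hP' : PP D) (E : ℤ) :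
    ∃ a : ℤ, a % 2 = 1 ∧ (D : ℤ) ∣ a ∧ ∀ p : ℕ, p.Prime → p ∣ d →
      ((p : ℤ) ∣ E → (p : ℤ) ∣ a - 4) ∧ (¬ (p : ℤ) ∣ E → (p : ℤ) ∣ a) := by
  have hdD : d * D ≠ 0 := hsf.ne_zero
  have hd0 : d ≠ 0 := left_ne_zero_of_mul hdD
  have hD0 : D ≠ 0 := right_ne_zero_of_mul hdD
  obtain ⟨g, hg⟩ : ∃ g, g = Int.gcd d E := ⟨_, rfl⟩
  have hgd : g ∣ d := by rw [hg]; exact Int.natCast_dvd_natCast.1 (Int.gcd_dvd_left _ _)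
  obtain ⟨m, hm⟩ := hgd
  have hcop : Nat.Coprime g (m * D) := Nat.coprime_of_squarefree_mul (by rw [← mul_assoc, ← hm]; exact hsf)
  obtain ⟨u, v, huv⟩ := Nat.isCoprime_iff_coprime.2 hcop
  push_cast at huv
  have props : ∀ a : ℤ, (g : ℤ) ∣ a - 4 → ((m : ℤ) * D) ∣ a → (D : ℤ) ∣ a ∧ ∀ p : ℕ, p.Prime → p ∣ d →
      ((p : ℤ) ∣ E → (p : ℤ) ∣ a - 4) ∧ (¬ (p : ℤ) ∣ E → (p : ℤ) ∣ a) := by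
    intro a h1 h2
    refine ⟨(Dvd.intro_left _ rfl).trans h2, fun p hp hpd => ⟨fun hE => ?_, fun hE => ?_⟩⟩
    · refine dvd_trans ?_ h1
      rw [hg]
      exact Int.dvd_coe_gcd (Int.natCast_dvd_natCast.2 hpd) hE
    · rw [hm] at hpd
      rcases hp.dvd_mul.1 hpd with h | h
      · exfalso; apply hE
        refine (Int.natCast_dvd_natCast.2 h).trans ?_
        rw [hg]; exact Int.gcd_dvd_right _ _
      · exact ((Int.natCast_dvd_natCast.2 h).trans (Dvd.intro _ rfl)).trans h2
  set a0 : ℤ := 4 * v * (m * D)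
  have hodd : ((d : ℤ) * D) % 2 = 1 := by
    have h1 := (hP.odd hd0).mul (hP'.odd hD0)
    have := Nat.odd_iff.1 h1
    exact_mod_cast this
  have hdm : (d : ℤ) * D = g * (m * D) := by rw [hm]; push_cast; ring
  by_cases ha : a0 % 2 = 1
  · exact ⟨a0, ha, props a0 ⟨-4 * u, by simp only [a0]; linear_combination 4 * huv⟩ ⟨4 * v, by simp only [a0]; ring⟩⟩
  · refine ⟨a0 + d * D, by omega, props _ ⟨-4 * u + m * D, ?_⟩ ⟨4 * v + g, ?_⟩⟩
    · rw [hdm]; simp only [a0]; linear_combination 4 * huv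
    · rw [hdm]; simp only [a0]; ring

theorem jac_coprime_ndvd {a : ℤ} {m : ℕ} (hm : m ≠ 0) (h : ∀ p : ℕ, p.Prime → p ∣ m → ¬ (p : ℤ) ∣ a) :
    IsCoprime a (m : ℤ) :=
  coprime_of_primes (by exact_mod_cast hm) fun p hp hd => h p hp (Int.natCast_dvd_natCast.1 hd)

theorem burde {k d D : ℕ} (hk : k = 1 ∨ k = 2) (hsf : Squarefree (d * D)) (hP : PP d) (hP' : PP D)
    {C E I : ℤ} (hCE : C ^ 2 + E ^ 2 = k * D) (hI : (d : ℤ) ∣ I ^ 2 + 1) {x y : ℤ} {Z : ℕ} (hZ : 0 < Z)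
    (hx : x ≠ 0) (hxy : IsCoprime x y) (h : d * x ^ 2 + D * y ^ 2 = k * (Z : ℤ) ^ 2) :
    ∃ (M M' u : ℕ) (c1 e1 : ℤ), u % 8 = 1 ∧ c1 % 8 = C % 8 ∧ e1 % 8 = E % 8 ∧ (M : ℤ) = k * u * Z + c1 * y ∧
      (M' : ℤ) = k * u * Z - c1 * y ∧ (M : ℤ) * M' = k * u ^ 2 * d * x ^ 2 + e1 ^ 2 * y ^ 2 ∧ 0 < M ∧ 0 < M' ∧
      jacobiSym (C - I * E) d * jacobiSym 2 d * jacobiSym M d * jacobiSym y d = 1 ∧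
      ∀ j N : ℕ, M = 2 ^ j * N → N % 2 = 1 → jacobiSym (-(k * d)) N = 1 := by
  have hdD : d * D ≠ 0 := hsf.ne_zero
  have hd0 : d ≠ 0 := left_ne_zero_of_mul hdD
  have hD0 : D ≠ 0 := right_ne_zero_of_mul hdD
  have hk0 : (0 : ℤ) < k := by rcases hk with rfl | rfl <;> norm_num
  have hcop : Nat.Coprime d D := Nat.coprime_of_squarefree_mul hsf
  have hkp : ∀ p : ℕ, p.Prime → ¬ (p : ℤ) ∣ 2 → ¬ (p : ℤ) ∣ k := by
    intro p hp h2 hpk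
    rcases hk with rfl | rfl
    · exact (Nat.prime_iff_prime_int.1 hp).not_unit (isUnit_of_dvd_one (by simpa using hpk))
    · exact h2 (by simpa using hpk)
  obtain ⟨a, ha2, haD, hap⟩ := theta_exists hsf hP hP' E
  obtain ⟨u, hu⟩ : ∃ u : ℕ, (u : ℤ) = a ^ 2 + 16 := ⟨(a ^ 2 + 16).toNat, Int.toNat_of_nonneg (by positivity)⟩
  have hu0 : 0 < (u : ℤ) := by rw [hu]; positivity
  have ha8 := odd_sq_mod8 ha2
  obtain ⟨c1, hc1⟩ : ∃ c1 : ℤ, c1 = C * (a ^ 2 - 16) - 8 * a * E := ⟨_, rfl⟩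
  obtain ⟨e1, he1⟩ : ∃ e1 : ℤ, e1 = E * (a ^ 2 - 16) + 8 * a * C := ⟨_, rfl⟩
  have hce : c1 ^ 2 + e1 ^ 2 = k * D * u ^ 2 := by
    rw [hc1, he1, hu, ← hCE]; ring
  have hMM : ((k : ℤ) * u * Z + c1 * y) * (k * u * Z - c1 * y) = k * u ^ 2 * d * x ^ 2 + e1 ^ 2 * y ^ 2 := by
    linear_combination (-(k : ℤ) * u ^ 2) * h - y ^ 2 * hce
  have hpos : 0 < ((k : ℤ) * u * Z + c1 * y) * (k * u * Z - c1 * y) := by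
    rw [hMM]
    have : (0 : ℤ) < d := by positivity
    positivity
  have hsum : 0 < ((k : ℤ) * u * Z + c1 * y) + (k * u * Z - c1 * y) := by
    have : 0 < (k : ℤ) * u * Z := by positivity
    linarith
  have hM0 : 0 < (k : ℤ) * u * Z + c1 * y := by
    by_contra hc
    rcases pos_and_pos_or_neg_and_neg_of_mul_pos hpos with ⟨h1, _⟩ | ⟨h1, h2⟩ <;> linarith
  have hM0' : 0 < (k : ℤ) * u * Z - c1 * y := by
    by_contra hc
    rcases pos_and_pos_or_neg_and_neg_of_mul_pos hpos with ⟨_, h1⟩ | ⟨h1, h2⟩ <;> linarith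
  obtain ⟨M, hM⟩ : ∃ M : ℕ, (M : ℤ) = k * u * Z + c1 * y := ⟨_, Int.toNat_of_nonneg hM0.le⟩
  obtain ⟨M', hM'⟩ : ∃ M : ℕ, (M : ℤ) = k * u * Z - c1 * y := ⟨_, Int.toNat_of_nonneg hM0'.le⟩
  have hMM' : (M : ℤ) * M' = k * u ^ 2 * d * x ^ 2 + e1 ^ 2 * y ^ 2 := by rw [hM, hM', hMM]
  rw [← hM] at hM0
  rw [← hM'] at hM0'
  have hfacts : ∀ p : ℕ, p.Prime → p ∣ d → ¬ (p : ℤ) ∣ 2 ∧ ¬ (p : ℤ) ∣ k ∧ ¬ (p : ℤ) ∣ D ∧ ¬ (p : ℤ) ∣ y ∧ ¬ (p : ℤ) ∣ u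
      ∧ ¬ (p : ℤ) ∣ e1 ∧ ¬ (p : ℤ) ∣ M := by
    intro p hp hpd
    have hpi := Nat.prime_iff_prime_int.1 hp
    have hpd' : (p : ℤ) ∣ d := Int.natCast_dvd_natCast.2 hpd
    have h2 := hP.ndvd_two hp hpd
    have hk' := hkp p hp h2
    have hD' : ¬ (p : ℤ) ∣ D := fun hh => hp.one_lt.ne' (Nat.eq_one_of_dvd_coprimes hcop hpd (Int.natCast_dvd_natCast.1 hh))
    have hy : ¬ (p : ℤ) ∣ y := by
      intro hy
      have hz : (p : ℤ) ∣ Z := by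
        have : (p : ℤ) ∣ k * (Z : ℤ) ^ 2 := by
          rw [← h]; exact dvd_add (hpd'.mul_right _) ((dvd_pow hy two_ne_zero).mul_left _)
        exact hpi.dvd_of_dvd_pow ((hpi.dvd_or_dvd this).resolve_left hk')
      exact (prim_sol hsf hxy h hp hz).1 hpd'
    have hCEp : (p : ℤ) ∣ E → ¬ (p : ℤ) ∣ C := by
      intro hE hC
      have : (p : ℤ) ∣ k * D := by rw [← hCE]; exact dvd_add (dvd_pow hC two_ne_zero) (dvd_pow hE two_ne_zero)
      rcases hpi.dvd_or_dvd this with h | h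
      · exact hk' h
      · exact hD' h
    have h2pow : ∀ j : ℕ, ¬ (p : ℤ) ∣ 2 ^ j := fun j hj => h2 (hpi.dvd_of_dvd_pow hj)
    have hu' : ¬ (p : ℤ) ∣ u ∧ ¬ (p : ℤ) ∣ e1 := by
      by_cases hE : (p : ℤ) ∣ E
      · obtain ⟨t, ht⟩ := (hap p hp hpd).1 hE
        obtain ⟨E', hE'⟩ := hE
        constructor
        · rintro ⟨w, hw⟩
          apply h2pow 5
          exact ⟨w - t * (a + 4), by linear_combination hw - hu - (a + 4) * ht⟩
        · rintro ⟨w, hw⟩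
          have : (p : ℤ) ∣ 2 ^ 5 * C := ⟨w - E' * (a ^ 2 - 16) - 8 * t * C, by
            linear_combination hw - he1 - (a ^ 2 - 16) * hE' - 8 * C * ht⟩
          rcases hpi.dvd_or_dvd this with h | h
          · exact h2pow 5 h
          · exact hCEp ⟨E', hE'⟩ h
      · obtain ⟨t, ht⟩ := (hap p hp hpd).2 hE
        constructor
        · rintro ⟨w, hw⟩
          apply h2pow 4
          exact ⟨w - t * a, by linear_combination hw - hu - a * ht⟩
        · rintro ⟨w, hw⟩
          have : (p : ℤ) ∣ 2 ^ 4 * E := ⟨-w + E * t * a + 8 * t * C, by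
            linear_combination -hw + he1 + (E * a + 8 * C) * ht⟩
          rcases hpi.dvd_or_dvd this with h | h
          · exact h2pow 4 h
          · exact hE h
    refine ⟨h2, hk', hD', hy, hu'.1, hu'.2, ?_⟩
    intro hpM
    have : (p : ℤ) ∣ (e1 * y) ^ 2 := by
      obtain ⟨w, hw⟩ := hpM
      obtain ⟨d1, hd1⟩ := hpd'
      exact ⟨w * M' - k * u ^ 2 * d1 * x ^ 2, by linear_combination -hMM' + M' * hw - k * u ^ 2 * x ^ 2 * hd1⟩
    rcases hpi.dvd_or_dvd (hpi.dvd_of_dvd_pow this) with h | h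
    · exact hu'.2 h
    · exact hy h
  refine ⟨M, M', u, c1, e1, ?_, ?_, ?_, hM, hM', hMM', by omega, by omega, ?_, ?_⟩
  · omega
  · rw [hc1]
    obtain ⟨t, ht⟩ : ∃ t, a ^ 2 = 8 * t + 1 := ⟨a ^ 2 / 8, by omega⟩
    rw [ht]; ring_nf; omega
  · rw [he1]
    obtain ⟨t, ht⟩ : ∃ t, a ^ 2 = 8 * t + 1 := ⟨a ^ 2 / 8, by omega⟩
    rw [ht]; ring_nf; omega
  · rw [← jacobiSym.mul_left, ← jacobiSym.mul_left, ← jacobiSym.mul_left]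
    obtain ⟨i, hi⟩ := hI
    refine jac_prod_one hd0 fun p hp hpd => ?_
    have hpi := Nat.prime_iff_prime_int.1 hp
    obtain ⟨h2, hk', hD', hy, hu', he1', hMp⟩ := hfacts p hp hpd
    obtain ⟨d1, hd1⟩ := Int.natCast_dvd_natCast.2 hpd
    have hθ : ¬ (p : ℤ) ∣ (a - 4 * I) := by
      intro hh
      apply hu'
      obtain ⟨w, hw⟩ := hh
      exact ⟨w * (a + 4 * I) + 16 * d1 * i, by linear_combination hu + (a + 4 * I) * hw + 16 * hi + 16 * i * hd1⟩
    have hcI : ¬ (p : ℤ) ∣ (C - I * E) := by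
      intro hh
      obtain ⟨w, hw⟩ := hh
      have : (p : ℤ) ∣ k * D := ⟨w * (C + I * E) + d1 * i * E ^ 2, by
        linear_combination -hCE + (C + I * E) * hw + E ^ 2 * hi + E ^ 2 * i * hd1⟩
      rcases hpi.dvd_or_dvd this with h | h
      · exact hk' h
      · exact hD' h
    refine jac_sq_prime (x := (a - 4 * I)) (t := u * k * Z + c1 * y - I * e1 * y) hp ?_ ?_
    · -- c1 - I e1 ≡ (C - I E)(a-4I)^2
      obtain ⟨j, hj⟩ : ∃ j, (C - I * E) * (a - 4 * I) ^ 2 = c1 - I * e1 + (I ^ 2 + 1) * j := by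
        refine ⟨16 * C + 8 * a * E - 16 * I * E, ?_⟩
        rw [hc1, he1]; ring
      have hk2 : ((k : ℤ) * u * Z) ^ 2 = k * u ^ 2 * (d * x ^ 2) + (c1 ^ 2 + e1 ^ 2) * y ^ 2 := by
        linear_combination (-(k : ℤ) * u ^ 2) * h - y ^ 2 * hce
      have e : (C - I * E) * 2 * M * y * (a - 4 * I) ^ 2 - (u * k * Z + c1 * y - I * e1 * y) ^ 2
          = (I ^ 2 + 1) * (2 * M * y * j - e1 ^ 2 * y ^ 2) - k * u ^ 2 * d * x ^ 2 := by
        rw [hM]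
        linear_combination 2 * (k * u * Z + c1 * y) * y * hj - hk2
      rw [e, hi, hd1]
      exact ⟨d1 * i * (2 * M * y * j - e1 ^ 2 * y ^ 2) - k * u ^ 2 * d1 * x ^ 2, by ring⟩
    · intro hh
      obtain ⟨j, hj⟩ : ∃ j, (C - I * E) * (a - 4 * I) ^ 2 = c1 - I * e1 + (I ^ 2 + 1) * j := by
        refine ⟨16 * C + 8 * a * E - 16 * I * E, ?_⟩
        rw [hc1, he1]; ring
      have hk2 : ((k : ℤ) * u * Z) ^ 2 = k * u ^ 2 * (d * x ^ 2) + (c1 ^ 2 + e1 ^ 2) * y ^ 2 := by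
        linear_combination (-(k : ℤ) * u ^ 2) * h - y ^ 2 * hce
      have e : (C - I * E) * 2 * M * y * (a - 4 * I) ^ 2 - (u * k * Z + c1 * y - I * e1 * y) ^ 2
          = (I ^ 2 + 1) * (2 * M * y * j - e1 ^ 2 * y ^ 2) - k * u ^ 2 * d * x ^ 2 := by
        rw [hM]
        linear_combination 2 * (k * u * Z + c1 * y) * y * hj - hk2
      rw [hi, hd1] at e
      have hdv : (p : ℤ) ∣ (C - I * E) * 2 * M * y * (a - 4 * I) ^ 2 := by
        obtain ⟨w, hw⟩ := hh
        rw [hw] at e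
        exact ⟨p * w ^ 2 + d1 * i * (2 * M * y * j - e1 ^ 2 * y ^ 2) - k * u ^ 2 * d1 * x ^ 2, by linear_combination e⟩
      rcases hpi.dvd_or_dvd hdv with h1 | h1
      · rcases hpi.dvd_or_dvd h1 with h1 | h1
        · rcases hpi.dvd_or_dvd h1 with h1 | h1
          · rcases hpi.dvd_or_dvd h1 with h1 | h1
            · exact hcI h1
            · exact h2 h1
          · exact hMp h1
        · exact hy h1
      · exact hθ (hpi.dvd_of_dvd_pow h1)
  · intro j N hN hN2
    have hN0 : N ≠ 0 := by omega
    have hnd : ∀ q : ℕ, q.Prime → q ∣ N → ¬ (q : ℤ) ∣ 2 ∧ ¬ (q : ℤ) ∣ k ∧ ¬ (q : ℤ) ∣ d := by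
      intro q hq hqN
      have h2 : ¬ (q : ℤ) ∣ 2 := by
        intro hh
        have h3 : q ∣ 2 := by exact_mod_cast hh
        have := (Nat.prime_dvd_prime_iff_eq hq Nat.prime_two).1 h3
        subst this; omega
      refine ⟨h2, hkp q hq h2, fun hh => ?_⟩
      have := (hfacts q hq (Int.natCast_dvd_natCast.1 hh)).2.2.2.2.2.2
      apply this
      rw [hN]; exact Int.natCast_dvd_natCast.2 (hqN.mul_left _)
    refine jac_even hN0 (jac_coprime_ndvd hN0 fun q hq hqN hh => ?_) fun q hq hqN hjac => ?_
    · obtain ⟨_, hb, hc⟩ := hnd q hq hqN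
      rcases (Nat.prime_iff_prime_int.1 hq).dvd_or_dvd ((Int.dvd_neg).1 hh) with h | h
      · exact hb h
      · exact hc h
    · obtain ⟨h2, hqk, hqd⟩ := hnd q hq hqN
      have hqi := Nat.prime_iff_prime_int.1 hq
      have hqM : (q : ℤ) ∣ M := by rw [hN]; exact Int.natCast_dvd_natCast.2 (hqN.mul_left _)
      have hfac : M.factorization q = N.factorization q := by
        rw [hN, Nat.factorization_mul (by positivity) hN0, Nat.factorization_pow]
        have : (2 : ℕ).factorization q = 0 := Nat.factorization_eq_zero_of_not_dvd (fun hh => h2 (by exact_mod_cast hh))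
        simp [this]
      rw [← hfac]
      refine val_even_partner hq hjac (by omega) ?_ (e1 * y) (u * x) (by rw [hMM']; ring)
      intro hqM'
      have hqM'' : (q : ℤ) ∣ M' := Int.natCast_dvd_natCast.2 hqM'
      have d1 : (q : ℤ) ∣ u * Z := by
        have : (q : ℤ) ∣ 2 * (k * (u * Z)) := by
          obtain ⟨r, hr⟩ := hqM
          obtain ⟨t, ht⟩ := hqM''
          exact ⟨r + t, by linear_combination hr + ht - hM - hM'⟩
        exact (hqi.dvd_or_dvd ((hqi.dvd_or_dvd this).resolve_left h2)).resolve_left hqk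
      have d2 : (q : ℤ) ∣ c1 * y := by
        have : (q : ℤ) ∣ 2 * (c1 * y) := by
          obtain ⟨r, hr⟩ := hqM
          obtain ⟨t, ht⟩ := hqM''
          exact ⟨r - t, by linear_combination hr - ht - hM + hM'⟩
        exact (hqi.dvd_or_dvd this).resolve_left h2
      have contra : jacobiSym (-(k * d)) q = 1 → False := by intro h1; rw [h1] at hjac; norm_num at hjac
      apply contra
      by_cases hqu : (q : ℤ) ∣ u
      · have hqc : ¬ (q : ℤ) ∣ c1 := by
          intro hh
          obtain ⟨r, hr⟩ := hh
          obtain ⟨t, ht⟩ := hqu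
          have e3 : (q : ℤ) ∣ 2 ^ 10 * (k * D) := by
            refine ⟨(C * t - r) * (32 * C - 8 * a * E) + 64 * t * E ^ 2, ?_⟩
            have hh1 : c1 = C * (u - 32) - 8 * a * E := by rw [hc1, hu]; ring
            have hh2 : a ^ 2 = u - 16 := by rw [hu]; ring
            rw [← hCE]
            linear_combination C * (32 * C - 8 * a * E) * ht - (32 * C - 8 * a * E) * hr + 64 * E ^ 2 * ht
              + (32 * C - 8 * a * E) * hh1 + 64 * E ^ 2 * hh2
          rcases hqi.dvd_or_dvd e3 with h1 | h1
          · exact h2 (hqi.dvd_of_dvd_pow h1)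
          · have h3 := (hqi.dvd_or_dvd h1).resolve_left hqk
            obtain ⟨w, hw⟩ := h3.trans haD
            have : (q : ℤ) ∣ 2 ^ 4 := ⟨t - w * a, by linear_combination ht - hu - a * hw⟩
            exact h2 (hqi.dvd_of_dvd_pow this)
        have hqy := (hqi.dvd_or_dvd d2).resolve_left hqc
        have hqZ : ¬ (q : ℤ) ∣ Z := fun hh => (prim_sol hsf hxy h hq hh).2.2.2 hqy
        have e1' : jacobiSym (d * k) q = 1 := by
          refine jac_loc (x := x) (y := Z) hq ?_ hqk hqZ
          obtain ⟨w, hw⟩ := hqy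
          exact ⟨-D * w * y, by linear_combination h - D * y * hw⟩
        have e2' : jacobiSym (-1) q = 1 := by
          refine jac_sq_prime (x := 4) (t := a) hq ?_ ?_
          · obtain ⟨t, ht⟩ := hqu
            exact ⟨-t, by linear_combination hu - ht⟩
          · intro hh
            obtain ⟨w, hw⟩ := hh
            obtain ⟨t, ht⟩ := hqu
            have : (q : ℤ) ∣ 2 ^ 4 := ⟨t - w * a, by linear_combination ht - hu - a * hw⟩
            exact h2 (hqi.dvd_of_dvd_pow this)
        have e : (-((k : ℤ) * d)) = (-1) * (d * k) := by ring
        rw [e, jacobiSym.mul_left, e1', e2']; norm_num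
      · have hqZ := (hqi.dvd_or_dvd d1).resolve_left hqu
        obtain ⟨_, hqD, hqx, hqy⟩ := prim_sol hsf hxy h hq hqZ
        have hqc := (hqi.dvd_or_dvd d2).resolve_right hqy
        have e1' : jacobiSym (1 * (k * D)) q = 1 := by
          refine jac_loc (x := e1) (y := u) hq ?_ (fun hh => (hqi.dvd_or_dvd hh).elim hqk hqD) hqu
          obtain ⟨w, hw⟩ := hqc
          exact ⟨-w * c1, by linear_combination hce - c1 * hw⟩
        have e2' : jacobiSym (d * (-D)) q = 1 := by
          refine jac_loc (x := x) (y := y) hq ?_ (fun hh => hqD (Int.dvd_neg.1 hh)) hqy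
          obtain ⟨w, hw⟩ := hqZ
          exact ⟨k * w * Z, by linear_combination h + k * Z * hw⟩
        have e3' : jacobiSym ((D : ℤ) ^ 2) q = 1 :=
          jacobiSym.sq_one' (Nat.isCoprime_iff_coprime.1 (jac_coprime_ndvd hq.ne_zero fun p hp hpq => by
            rw [(Nat.prime_dvd_prime_iff_eq hp hq).1 hpq]; exact hqD))
        have e4 : jacobiSym (-(k * d) * (D : ℤ) ^ 2) q = 1 := by
          have e : (-((k : ℤ) * d)) * (D : ℤ) ^ 2 = (1 * (k * D)) * (d * (-D)) := by ring
          rw [e, jacobiSym.mul_left, e1', e2']; norm_num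
        rw [jacobiSym.mul_left, e3', mul_one] at e4
        exact e4


theorem split_setup {d D α β : ℕ} {δ : ℤ} (hsf : Squarefree (d * D)) (hP : PP d) (hP' : PP D)
    (hδ : δ % 2 = 1) (hβ : β % 2 = 0) (hcop : IsCoprime δ (β : ℤ)) (hcd : IsCoprime (β : ℤ) (d : ℤ))
    (h : δ ^ 2 + (β : ℤ) ^ 2 = D * (d * (α : ℤ) ^ 2)) :
    ∃ c e a b I : ℤ, c ^ 2 + e ^ 2 = D ∧ c % 2 = 1 ∧ e % 2 = 0 ∧ a % 2 = 1 ∧ b % 2 = 0 ∧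
      a ^ 2 + b ^ 2 = d * (α : ℤ) ^ 2 ∧ IsCoprime a b ∧ δ = c * a - e * b ∧ (β : ℤ) = c * b + e * a ∧
      (d : ℤ) ∣ I ^ 2 + 1 ∧ jacobiSym β d = jacobiSym 2 d * jacobiSym (c - I * e) d ∧
      jacobiSym (1 + I) d = jacobiSym (a + b) d := by
  have hdD : d * D ≠ 0 := hsf.ne_zero
  have hd0 : d ≠ 0 := left_ne_zero_of_mul hdD
  have hD0 : D ≠ 0 := right_ne_zero_of_mul hdD
  obtain ⟨c, e, a, b, h1, h2, h3, h4, h5, h6, h7, h8, h9⟩ := gauss_split' (D := D)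
    (by have := Nat.odd_iff.1 (hP'.odd hD0); exact_mod_cast this) hcop hδ (by exact_mod_cast hβ) (by exact_mod_cast hD0) h
  have had : IsCoprime a (d : ℤ) := by
    refine jac_coprime_ndvd hd0 fun p hp hpd hpa => ?_
    have hpi := Nat.prime_iff_prime_int.1 hp
    have hpd' : (p : ℤ) ∣ d := Int.natCast_dvd_natCast.2 hpd
    have : (p : ℤ) ∣ b ^ 2 := by
      obtain ⟨r, hr⟩ := hpa
      obtain ⟨t, ht⟩ := hpd'
      exact ⟨t * α ^ 2 - r * a, by linear_combination h8 + α ^ 2 * ht - a * hr⟩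
    exact not_both_dvd hp h9 hpa (hpi.dvd_of_dvd_pow this)
  obtain ⟨r, s, hrs⟩ := had
  set I : ℤ := r * b with hI
  have hIa : I * a - b = d * (-s * b) := by rw [hI]; linear_combination b * hrs
  have hI2 : (d : ℤ) ∣ I ^ 2 + 1 := by
    have : (d : ℤ) ∣ (I ^ 2 + 1) * a ^ 2 :=
      ⟨(-s * b) * (I * a + b) + α ^ 2, by linear_combination (I * a + b) * hIa + h8⟩
    exact (IsCoprime.pow_right (n := 2) ⟨s, r, by linear_combination hrs⟩ : IsCoprime (d : ℤ) (a ^ 2)).dvd_of_dvd_mul_right this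
  have hja : jacobiSym a d = 1 := by
    have hao : Odd a := Int.odd_iff.2 h6
    rw [jac_recip hP hd0 hao]
    refine jac_sq (x := α) (t := b) ?_ ?_
    · apply Int.natAbs_dvd.2
      exact ⟨a, by linear_combination -h8⟩
    · have := h9.symm
      rcases Int.natAbs_eq a with h | h
      · rw [← h]; exact this
      · rw [h] at this; simpa using this.neg_right
  have hd2 : IsCoprime (2 : ℤ) (d : ℤ) := by
    refine jac_coprime_ndvd hd0 fun p hp hpd => hP.ndvd_two hp hpd
  obtain ⟨i, hi⟩ := hI2
  have hI1 : IsCoprime (1 + I) (d : ℤ) := by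
    obtain ⟨u, v, huv⟩ := hd2
    exact ⟨u * (1 - I), v + u * i, by linear_combination huv - u * hi⟩
  have h2I : jacobiSym 2 d * jacobiSym I d = 1 := by
    rw [← jacobiSym.mul_left]
    refine jac_sq (x := 1) (t := 1 + I) ⟨-i, by linear_combination -hi⟩ hI1
  have hIJ : jacobiSym I d = jacobiSym 2 d := by
    rcases jacobiSym.eq_one_or_neg_one (b := d) (Int.isCoprime_iff_gcd_eq_one.1 hd2) with h | h <;>
      rw [h] at h2I ⊢ <;> linarith
  refine ⟨c, e, a, b, I, h1, h4, h5, h6, h7, h8, h9, h2, h3, ⟨i, hi⟩, ?_, ?_⟩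
  · rw [← hIJ, ← mul_one (jacobiSym I d), ← hja, ← jacobiSym.mul_left, ← jacobiSym.mul_left]
    refine jac_congr ⟨a * e * i + c * s * b , ?_⟩
    linear_combination h3 + a * e * hi - c * hIa
  · have e1 : jacobiSym (a * (1 + I)) d = jacobiSym (a + b) d := jac_congr ⟨(-s * b), by linear_combination hIa⟩
    rw [← e1, jacobiSym.mul_left, hja, one_mul]


theorem jac_two_nat {N : ℕ} (h : N % 2 = 1) : jacobiSym 2 N = if N % 8 = 1 ∨ N % 8 = 7 then 1 else -1 := by
  rw [jacobiSym.at_two (Nat.odd_iff.2 h), ZMod.χ₈_nat_eq_if_mod_eight]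
  simp [h]

theorem jac_neg_one_nat {N : ℕ} (h : N % 2 = 1) : jacobiSym (-1) N = if N % 4 = 1 then 1 else -1 := by
  rw [jacobiSym.at_neg_one (Nat.odd_iff.2 h), ZMod.χ₄_nat_eq_if_mod_four]
  simp [h]

theorem jac_dk {k d D : ℕ} (hk : k = 1 ∨ k = 2) (hsf : Squarefree (d * D)) {x y Z t : ℤ} (hxy : IsCoprime x y)
    (h : d * x ^ 2 + D * y ^ 2 = k * Z ^ 2) (ht : t % 2 = 1) (hty : t ∣ y) : jacobiSym (d * k) t.natAbs = 1 := by
  have ht0 : t.natAbs ≠ 0 := by omega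
  refine jac_sq (x := x) (t := k * Z) ?_ (jac_coprime_ndvd ht0 fun p hp hpt hh => ?_)
  · apply Int.natAbs_dvd.2
    obtain ⟨w, hw⟩ := hty
    exact ⟨- k * D * w * y, by linear_combination k * h - k * D * y * hw⟩
  · have hpi := Nat.prime_iff_prime_int.1 hp
    have hpt' : (p : ℤ) ∣ t := Int.natCast_dvd.2 hpt
    rcases hpi.dvd_or_dvd hh with h1 | h1
    · have h2 : p ∣ k := Int.natCast_dvd_natCast.1 h1
      have h3 : p = 2 := by
        rcases hk with rfl | rfl
        · exact absurd (Nat.dvd_one.1 h2) hp.one_lt.ne'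
        · exact (Nat.prime_dvd_prime_iff_eq hp Nat.prime_two).1 h2
      subst h3
      omega
    · exact (prim_sol hsf hxy h hp h1).2.2.2 (hpt'.trans hty)

theorem B2 {d D α β : ℕ} {δ : ℤ} (hsf : Squarefree (d * D)) (hP : PP d) (hP' : PP D) (hd8 : d % 8 = 5) (hD8 : D % 8 = 5)
    (hδ : δ % 2 = 1) (hβ : β % 2 = 0) (hcop : IsCoprime δ (β : ℤ)) (hcd : IsCoprime (β : ℤ) (d : ℤ))
    (h : δ ^ 2 + (β : ℤ) ^ 2 = D * (d * (α : ℤ) ^ 2)) {x y : ℤ} {Z : ℕ} (hZ0 : 0 < Z) (hZ : Z % 4 = 1)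
    (hxy : IsCoprime x y) (hs : d * x ^ 2 + D * y ^ 2 = (Z : ℤ) ^ 2) : jacobiSym β d = 1 := by
  have hd0 : d ≠ 0 := by omega
  obtain ⟨c, e, a, b, I, h1, h2, h3, h4, h5, h6, h7, h8, h9, h10, h11, h12⟩ :=
    split_setup hsf hP hP' hδ hβ hcop hcd h
  have hZ8 : (Z : ℤ) ^ 2 % 8 = 1 := odd_sq_mod8 (by omega)
  obtain ⟨d1, hd1⟩ : ∃ d1 : ℤ, (d : ℤ) = 8 * d1 + 5 := ⟨d / 8, by omega⟩
  obtain ⟨D1, hD1⟩ : ∃ D1 : ℤ, (D : ℤ) = 8 * D1 + 5 := ⟨D / 8, by omega⟩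
  have hx0 : x ≠ 0 := by
    rintro rfl
    have hu : IsUnit y := isCoprime_zero_left.1 hxy
    rcases Int.isUnit_iff.1 hu with rfl | rfl <;> rw [hD1] at hs <;> omega
  have hs' : (d : ℤ) * x ^ 2 + D * y ^ 2 = (1 : ℕ) * (Z : ℤ) ^ 2 := by rw [hs]; push_cast; ring
  have hJ2 : jacobiSym 2 d = -1 := by rw [jac_two_nat (by omega)]; simp [hd8]
  obtain ⟨M, M', u, c1, e1, g1, g2, g3, g4, g5, g6, g7, g8, g9, g10⟩ :=
    burde (k := 1) (C := c) (E := e) (Or.inl rfl) hsf hP hP' (by rw [h1]; push_cast; ring) h10 hZ0 hx0 hxy hs'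
  have key : jacobiSym β d * jacobiSym M d * jacobiSym y d = 1 := by
    rw [h11]; linear_combination g9
  have hc1 : c1 % 2 = 1 := by omega
  have hN : ∀ j N : ℕ, M = 2 ^ j * N → N % 2 = 1 → jacobiSym N d = if N % 4 = 1 then 1 else -1 := by
    intro j N hj hN
    have := g10 j N hj hN
    have e0 : (-(((1 : ℕ) : ℤ) * d)) = (-1) * d := by push_cast; ring
    rw [e0, jacobiSym.mul_left, jac_neg_one_nat hN] at this
    rw [jac_recip_nat hP hd0 (Nat.odd_iff.2 hN)]
    split_ifs at this ⊢ <;> linarith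
  have he4 : e % 4 = 2 := by
    have hc8 := odd_sq_mod8 h2
    obtain ⟨e', he'⟩ : ∃ e', e = 2 * e' := ⟨e / 2, by omega⟩
    by_contra hcon
    obtain ⟨e'', he''⟩ : ∃ e'', e = 4 * e'' := ⟨e / 4, by omega⟩
    rw [he'', hD1] at h1
    have : c ^ 2 = 8 * (D1 - 2 * e'' ^ 2) + 5 := by linear_combination h1
    omega
  have hJy : ∀ t : ℤ, t % 2 = 1 → t ∣ y → jacobiSym t d = 1 := by
    intro t ht hty
    rw [jac_recip hP hd0 (Int.odd_iff.2 ht)]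
    simpa using jac_dk (k := 1) (Or.inl rfl) hsf hxy hs' ht hty
  obtain ⟨u1, hu1⟩ : ∃ u1 : ℤ, (u : ℤ) = 8 * u1 + 1 := ⟨u / 8, by omega⟩
  obtain ⟨Z1, hZ1⟩ : ∃ Z1 : ℤ, (Z : ℤ) = 4 * Z1 + 1 := ⟨Z / 4, by omega⟩
  obtain ⟨c2, hc2⟩ : ∃ c2 : ℤ, c1 = 2 * c2 + 1 := ⟨c1 / 2, by omega⟩
  by_cases hy : y % 2 = 1
  · have hy8 := odd_sq_mod8 hy
    have hx4 : x % 4 = 2 := by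
      have hx2 : x % 2 = 0 := by
        by_contra hcon
        have hx8 := odd_sq_mod8 (x := x) (by omega)
        obtain ⟨x1, hx1⟩ : ∃ x1, x ^ 2 = 8 * x1 + 1 := ⟨x ^ 2 / 8, by omega⟩
        obtain ⟨y1, hy1⟩ : ∃ x1, y ^ 2 = 8 * x1 + 1 := ⟨y ^ 2 / 8, by omega⟩
        rw [hx1, hy1, hd1, hD1] at hs
        ring_nf at hs; ring_nf at hZ8; omega
      by_contra hcon
      obtain ⟨x1, hx1⟩ : ∃ x1, x = 4 * x1 := ⟨x / 4, by omega⟩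
      obtain ⟨y1, hy1⟩ : ∃ x1, y ^ 2 = 8 * x1 + 1 := ⟨y ^ 2 / 8, by omega⟩
      rw [hx1, hy1, hd1, hD1] at hs
      have : (Z : ℤ) ^ 2 = 8 * (2 * (8 * d1 + 5) * x1 ^ 2 + D1 * (8 * y1 + 1) + 5 * y1) + 5 := by linear_combination -hs
      omega
    obtain ⟨x1, hx1⟩ : ∃ x1, x = 2 * x1 := ⟨x / 2, by omega⟩
    obtain ⟨f, hf⟩ : ∃ f, e1 = 2 * f := ⟨e1 / 2, by omega⟩
    have hx8 := odd_sq_mod8 (x := x1) (by omega)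
    have hf8 := odd_sq_mod8 (x := f) (by omega)
    obtain ⟨x2, hx2⟩ : ∃ x2, x1 ^ 2 = 8 * x2 + 1 := ⟨x1 ^ 2 / 8, by omega⟩
    obtain ⟨f2, hf2⟩ : ∃ x2, f ^ 2 = 8 * x2 + 1 := ⟨f ^ 2 / 8, by omega⟩
    obtain ⟨y2, hy2⟩ : ∃ x2, y ^ 2 = 8 * x2 + 1 := ⟨y ^ 2 / 8, by omega⟩
    obtain ⟨y1, hy1⟩ : ∃ x2, y = 2 * x2 + 1 := ⟨y / 2, by omega⟩
    have hMe : (M : ℤ) % 2 = 0 := by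
      rw [g4, hu1, hZ1, hc2, hy1]; push_cast; ring_nf; omega
    obtain ⟨m, hm⟩ : ∃ m : ℕ, M = 2 * m := ⟨M / 2, by omega⟩
    have hMe' : (M' : ℤ) % 2 = 0 := by
      rw [g5, hu1, hZ1, hc2, hy1]; push_cast; ring_nf; omega
    obtain ⟨m', hm'⟩ : ∃ m : ℕ, M' = 2 * m := ⟨M' / 2, by omega⟩
    have hsum : ((m : ℤ) + m') % 4 = 1 := by
      have : (m : ℤ) + m' = u * Z := by
        have h1 : (M : ℤ) = 2 * m := by rw [hm]; push_cast; ring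
        have h2 : (M' : ℤ) = 2 * m' := by rw [hm']; push_cast; ring
        push_cast at g4 g5
        linarith
      rw [this, hu1, hZ1]; ring_nf; omega
    obtain ⟨v, hv⟩ : ∃ v : ℤ, (m : ℤ) * m' = 8 * v + 6 := by
      rw [hm, hm', hx1, hf, hd1, hu1] at g6
      push_cast at g6
      have e0 : (m : ℤ) * m' = (8 * u1 + 1) ^ 2 * (8 * d1 + 5) * x1 ^ 2 + f ^ 2 * y ^ 2 := by linarith
      rw [hx2, hf2, hy2] at e0
      obtain ⟨V, hV⟩ : ∃ V : ℤ, (8 * u1 + 1) ^ 2 * (8 * d1 + 5) = 8 * V + 5 :=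
        ⟨8 * (2 * u1 + 8 * u1 ^ 2) * d1 + 5 * (2 * u1 + 8 * u1 ^ 2) + d1, by ring⟩
      rw [hV] at e0
      exact ⟨8 * V * x2 + V + 5 * x2 + 8 * f2 * y2 + f2 + y2, by rw [e0]; ring⟩
    rw [hJy y hy dvd_rfl, mul_one] at key
    have hJM : jacobiSym M d = 1 := by
      by_cases hmo : m % 2 = 1
      · have hm4 : m % 4 = 3 := by
          obtain ⟨r, hr⟩ : ∃ r : ℤ, (m' : ℤ) = 2 * r := ⟨m' / 2, by omega⟩
          obtain ⟨r', hr'⟩ : ∃ r : ℤ, (m : ℤ) = 2 * r + 1 := ⟨m / 2, by omega⟩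
          have hro : r % 2 = 1 := by
            by_contra hcon
            obtain ⟨r2, hr2⟩ : ∃ r2, r = 2 * r2 := ⟨r / 2, by omega⟩
            rw [hr, hr', hr2] at hv
            have : 4 * ((2 * r' + 1) * r2) = 8 * v + 6 := by linear_combination hv
            omega
          omega
        have := hN 1 m (by rw [hm]; ring) hmo
        rw [hm]; push_cast
        rw [jacobiSym.mul_left, hJ2, this]; simp [hm4]
      · obtain ⟨r, hr⟩ : ∃ r : ℕ, m = 2 * r := ⟨m / 2, by omega⟩
        have hv' : (r : ℤ) * m' = 4 * v + 3 := by rw [hr] at hv; push_cast at hv; linarith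
        have hro : r % 2 = 1 := by
          by_contra hcon
          obtain ⟨r2, hr2⟩ : ∃ r2 : ℕ, r = 2 * r2 := ⟨r / 2, by omega⟩
          rw [hr2] at hv'; push_cast at hv'
          have : 2 * ((r2 : ℤ) * m') = 4 * v + 3 := by linear_combination hv'
          omega
        have hm4 : (m' : ℤ) % 4 = 3 := by omega
        have hr4 : r % 4 = 1 := by
          by_contra hcon
          obtain ⟨r2, hr2⟩ : ∃ r2 : ℤ, (r : ℤ) = 4 * r2 + 3 := ⟨r / 4, by omega⟩
          obtain ⟨m2, hm2⟩ : ∃ r2 : ℤ, (m' : ℤ) = 4 * r2 + 3 := ⟨m' / 4, by omega⟩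
          rw [hr2, hm2] at hv'
          ring_nf at hv'; omega
        have := hN 2 r (by rw [hm, hr]; ring) hro
        rw [hm, hr]; push_cast
        rw [jacobiSym.mul_left, jacobiSym.mul_left, hJ2, this]; simp [hr4]
    rw [hJM, mul_one] at key
    exact key
  · have hy4 : y % 4 = 2 := by
      by_contra hcon
      obtain ⟨y1, hy1⟩ : ∃ y1, y = 4 * y1 := ⟨y / 4, by omega⟩
      by_cases hx : x % 2 = 1
      · have hx8 := odd_sq_mod8 hx
        obtain ⟨x2, hx2⟩ : ∃ x2, x ^ 2 = 8 * x2 + 1 := ⟨x ^ 2 / 8, by omega⟩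
        rw [hx2, hy1, hd1] at hs
        have : (Z : ℤ) ^ 2 = 8 * (2 * D * y1 ^ 2 + (8 * d1 + 5) * x2 + d1) + 5 := by linear_combination -hs
        omega
      · exact not_both_dvd Nat.prime_two hxy (by push_cast; omega) (by push_cast; omega)
    obtain ⟨y1, hy1⟩ : ∃ y1, y = 2 * y1 := ⟨y / 2, by omega⟩
    have hJ : jacobiSym y d = -1 := by
      rw [hy1, jacobiSym.mul_left, hJ2, hJy y1 (by omega) ⟨2, by rw [hy1]; ring⟩]; norm_num
    have hM4 : (M : ℤ) % 4 = 3 := by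
      obtain ⟨y3, hy3⟩ : ∃ x2, y = 4 * x2 + 2 := ⟨y / 4, by omega⟩
      rw [g4, hu1, hZ1, hc2, hy3]; push_cast; ring_nf; omega
    have hM4' : M % 4 = 3 := by omega
    have hJM := hN 0 M (by ring) (by omega)
    rw [hJM, hJ, hM4'] at key
    simpa using key

theorem jac_two_int {t : ℤ} (h : t % 2 = 1) : jacobiSym 2 t.natAbs = ZMod.χ₈ (t : ZMod 8) := by
  have h1 : t.natAbs % 2 = 1 := by omega
  rw [jacobiSym.at_two (Nat.odd_iff.2 h1)]
  have hneg : ∀ x : ZMod 8, ZMod.χ₈ (-x) = ZMod.χ₈ x := by decide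
  rcases Int.natAbs_eq t with h | h
  · conv_rhs => rw [h]
    simp
  · conv_rhs => rw [h]
    simp [hneg]

theorem chi_key : ∀ C y Z : ZMod 8, C * C = 1 → y * y = 1 → Z * Z = 1 →
    ZMod.χ₈ C * ZMod.χ₈ y * ZMod.χ₈' (2 * Z + C * y) = if Z = 1 ∨ Z = 5 then 1 else -1 := by decide

theorem zmod_odd_sq {t : ℤ} (h : t % 2 = 1) : (t : ZMod 8) * t = 1 := by
  have := odd_sq_mod8 h
  obtain ⟨w, hw⟩ : ∃ w, t ^ 2 = 8 * w + 1 := ⟨t ^ 2 / 8, by omega⟩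
  have h1 : ((t ^ 2 : ℤ) : ZMod 8) = ((8 * w + 1 : ℤ) : ZMod 8) := by rw [hw]
  push_cast at h1
  have h8 : (8 : ZMod 8) = 0 := by decide
  rw [h8] at h1
  rw [← sq, h1]; ring

theorem B1 {d D α β : ℕ} {δ : ℤ} (hsf : Squarefree (d * D)) (hP : PP d) (hP' : PP D)
    (hδ : δ % 8 = 1) (hβ : β % 4 = 0) (hcop : IsCoprime δ (β : ℤ)) (hcd : IsCoprime (β : ℤ) (d : ℤ))
    (h : δ ^ 2 + (β : ℤ) ^ 2 = D * (d * (α : ℤ) ^ 2)) {x y : ℤ} {Z : ℕ} (hx : x % 2 = 1) (hy : y % 2 = 1) (hZ : Z % 2 = 1)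
    (hxy : IsCoprime x y) (hs : d * x ^ 2 + D * y ^ 2 = 2 * (Z : ℤ) ^ 2) :
    jacobiSym β d = (if β % 8 = 0 then 1 else -1) * (if Z % 4 = 1 then 1 else -1) := by
  have hd0 : d ≠ 0 := left_ne_zero_of_mul hsf.ne_zero
  obtain ⟨c, e, a, b, I, h1, h2, h3, h4, h5, h6, h7, h8, h9, h10, h11, h12⟩ :=
    split_setup hsf hP hP' (by omega) (by omega) hcop hcd h
  have hs' : (d : ℤ) * x ^ 2 + D * y ^ 2 = (2 : ℕ) * (Z : ℤ) ^ 2 := by rw [hs]; push_cast; ring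
  obtain ⟨M, M', u, c1, e1, g1, g2, g3, g4, g5, g6, g7, g8, g9, g10⟩ :=
    burde (k := 2) (C := c + e) (E := e - c) (Or.inr rfl) hsf hP hP' (by push_cast; linear_combination 2 * h1)
      h10 (by omega : 0 < Z) (by rintro rfl; omega) hxy hs'
  have e1 : jacobiSym (c + e - I * (e - c)) d = jacobiSym (c - I * e) d * jacobiSym (1 + I) d := by
    rw [← jacobiSym.mul_left]
    obtain ⟨i, hi⟩ := h10
    exact jac_congr ⟨e * i, by linear_combination e * hi⟩
  have key : jacobiSym β d * jacobiSym (a + b) d * jacobiSym M d * jacobiSym y d = 1 := by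
    rw [h11, ← h12]; rw [e1] at g9; linear_combination g9
  have hy1 : jacobiSym y d = ZMod.χ₈ (y : ZMod 8) := by
    have h1 := jac_dk (k := 2) (Or.inr rfl) hsf hxy hs' hy dvd_rfl
    rw [jac_recip hP hd0 (Int.odd_iff.2 hy)]
    push_cast at h1
    rw [jacobiSym.mul_left, jac_two_int hy] at h1
    exact Int.eq_of_mul_eq_one h1
  have hab2 : (a + b) % 2 = 1 := by omega
  have hab1 : jacobiSym (a + b) d = ZMod.χ₈ ((a + b : ℤ) : ZMod 8) := by
    rw [jac_recip hP hd0 (Int.odd_iff.2 hab2)]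
    have h0 : (a + b).natAbs ≠ 0 := by omega
    have h1 : jacobiSym (d * 2) (a + b).natAbs = 1 := by
      refine jac_sq (x := α) (t := a - b) ?_ (jac_coprime_ndvd h0 fun p hp hpt hh => ?_)
      · apply Int.natAbs_dvd.2
        exact ⟨a + b, by linear_combination -2 * h6⟩
      · have hpi := Nat.prime_iff_prime_int.1 hp
        have hpt' : (p : ℤ) ∣ a + b := Int.natCast_dvd.2 hpt
        have hp2 : ¬ (p : ℤ) ∣ 2 := by
          intro h2
          have h3 : p ∣ 2 := by exact_mod_cast h2
          have := (Nat.prime_dvd_prime_iff_eq hp Nat.prime_two).1 h3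
          subst this
          omega
        have ha : (p : ℤ) ∣ 2 * a := by have := dvd_add hpt' hh; ring_nf at this; rwa [mul_comm] at this
        have hb : (p : ℤ) ∣ 2 * b := by have := dvd_sub hpt' hh; ring_nf at this; rwa [mul_comm] at this
        exact not_both_dvd hp h7 ((hpi.dvd_or_dvd ha).resolve_left hp2) ((hpi.dvd_or_dvd hb).resolve_left hp2)
    rw [jacobiSym.mul_left, jac_two_int hab2] at h1
    exact Int.eq_of_mul_eq_one h1
  obtain ⟨c2, hc2⟩ : ∃ c2, c1 = 8 * c2 + (c + e) := ⟨(c1 - (c + e)) / 8, by omega⟩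
  obtain ⟨u2, hu2⟩ : ∃ c2 : ℤ, (u : ℤ) = 8 * c2 + 1 := ⟨u / 8, by omega⟩
  have h80 : (8 : ZMod 8) = 0 := by decide
  have hMz : (M : ZMod 8) = 2 * ((Z : ℤ) : ZMod 8) + ((c + e : ℤ) : ZMod 8) * (y : ZMod 8) := by
    have : ((M : ℤ) : ZMod 8) = (((2 : ℕ) * u * Z + c1 * y : ℤ) : ZMod 8) := by rw [g4]
    rw [hu2, hc2] at this
    push_cast at this
    rw [h80] at this
    rw [this]; push_cast; ring
  have hMo : M % 2 = 1 := by
    obtain ⟨y2, hy2⟩ : ∃ y2, y = 2 * y2 + 1 := ⟨y / 2, by omega⟩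
    obtain ⟨t2, ht2⟩ : ∃ y2, c1 = 2 * y2 + 1 := ⟨c1 / 2, by omega⟩
    rw [ht2, hy2] at g4
    have : (M : ℤ) = 2 * (u * Z + 2 * t2 * y2 + t2 + y2) + 1 := by rw [g4]; push_cast; ring
    omega
  have hM1 : jacobiSym M d = ZMod.χ₈' (M : ZMod 8) := by
    have h1 := g10 0 M (by ring) hMo
    have e0 : (-(((2 : ℕ) : ℤ) * d)) = d * (-2) := by push_cast; ring
    rw [e0, jacobiSym.mul_left, jacobiSym.at_neg_two (Nat.odd_iff.2 hMo)] at h1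
    rw [jac_recip_nat hP hd0 (Nat.odd_iff.2 hMo)]
    exact Int.eq_of_mul_eq_one h1
  have hco : (c + e) % 2 = 1 := by omega
  have hprod : ((a + b : ℤ) : ZMod 8) * ((c + e : ℤ) : ZMod 8) = 1 + ((β : ℤ) : ZMod 8) := by
    obtain ⟨e2, he2⟩ : ∃ e2, e = 2 * e2 := ⟨e / 2, by omega⟩
    obtain ⟨b2, hb2⟩ : ∃ e2, b = 2 * e2 := ⟨b / 2, by omega⟩
    obtain ⟨δ2, hδ2⟩ : ∃ e2, δ = 8 * e2 + 1 := ⟨δ / 8, by omega⟩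
    have : (a + b) * (c + e) = 8 * (e2 * b2 + δ2) + (1 + β) := by
      have : (a + b) * (c + e) = 2 * e * b + δ + β := by rw [h8, h9]; ring
      rw [this, he2, hb2, hδ2]; ring
    rw [← Int.cast_mul, this]
    push_cast
    rw [h80]; ring
  have hck := chi_key ((c + e : ℤ) : ZMod 8) y ((Z : ℤ) : ZMod 8) (zmod_odd_sq hco) (zmod_odd_sq hy) (zmod_odd_sq (by omega))
  rw [hy1, hab1, hM1, hMz] at key
  have hsC : ((a + b : ℤ) : ZMod 8) = (1 + ((β : ℤ) : ZMod 8)) * ((c + e : ℤ) : ZMod 8) := by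
    rw [← hprod, mul_assoc, zmod_odd_sq hco, mul_one]
  rw [hsC, map_mul] at key
  have hβχ : ZMod.χ₈ (1 + ((β : ℤ) : ZMod 8)) = if β % 8 = 0 then 1 else -1 := by
    have : β % 8 = 0 ∨ β % 8 = 4 := by omega
    obtain ⟨w, hw⟩ : ∃ w, β = 8 * w + β % 8 := ⟨β / 8, by omega⟩
    have h1 : ((β : ℤ) : ZMod 8) = ((β % 8 : ℕ) : ZMod 8) := by
      rw [Int.cast_natCast, ZMod.natCast_mod]
    rw [h1]
    rcases this with h | h <;> rw [h] <;> decide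
  have hZχ : (if ((Z : ℤ) : ZMod 8) = 1 ∨ ((Z : ℤ) : ZMod 8) = 5 then (1 : ℤ) else -1) = if Z % 4 = 1 then 1 else -1 := by
    have : Z % 8 = 1 ∨ Z % 8 = 3 ∨ Z % 8 = 5 ∨ Z % 8 = 7 := by omega
    obtain ⟨w, hw⟩ : ∃ w, Z = 8 * w + Z % 8 := ⟨Z / 8, by omega⟩
    have h1 : ((Z : ℤ) : ZMod 8) = ((Z % 8 : ℕ) : ZMod 8) := by
      rw [Int.cast_natCast, ZMod.natCast_mod]
    have h2 : Z % 4 = (Z % 8) % 4 := by omega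
    rw [h1, h2]
    rcases this with h | h | h | h <;> rw [h] <;> decide
  rw [← hβχ, ← hZχ, ← hck]
  apply Int.eq_of_mul_eq_one
  rw [← key]; ring


theorem loc_k {k d D : ℕ} (hk : k = 1 ∨ k = 2) (hsf : Squarefree (d * D)) (hP : PP (d * D)) {x y Z : ℤ} (hxy : IsCoprime x y)
    (h : d * x ^ 2 + D * y ^ 2 = k * Z ^ 2) {p : ℕ} (hp : p.Prime) (hpd : p ∣ d) : jacobiSym (k * D) p = 1 := by
  have hpd' : (p : ℤ) ∣ d := Int.natCast_dvd_natCast.2 hpd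
  have hpi := Nat.prime_iff_prime_int.1 hp
  have h2 := hP.ndvd_two hp (hpd.mul_right _)
  rw [mul_comm]
  refine jac_loc (x := y) (y := Z) hp ?_ ?_ ?_
  · obtain ⟨w, hw⟩ := hpd'
    exact ⟨-w * x ^ 2, by linear_combination h - x ^ 2 * hw⟩
  · intro hh
    rcases hk with rfl | rfl
    · exact hpi.not_unit (isUnit_of_dvd_one (by simpa using hh))
    · exact h2 (by simpa using hh)
  · intro hh
    exact (prim_sol hsf hxy h hp hh).1 hpd'

theorem TA_pack {n k d D α β γ δ : ℕ} (hk : k = 1 ∨ k = 2) (hn : n % 8 = 1) (hsf : Squarefree n) (hP : PP n) (hdD : d * D = n)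
    (hα : α % 2 = 1) (hβ : β % 2 = 0) (hc : Nat.Coprime (n * α) β) (hβ0 : 0 < β)
    (h1 : n * α ^ 2 + β ^ 2 = γ ^ 2) (h2 : δ ^ 2 + β ^ 2 = n * α ^ 2)
    {x y Z : ℤ} (hxy : IsCoprime x y) (h : d * x ^ 2 + D * y ^ 2 = k * Z ^ 2) :
    ∃ (δ' : ℤ) (n1 : ℕ), δ' % 8 = 1 ∧ β % 4 = 0 ∧ n1 % 8 = (1 + β) % 8 ∧ IsCoprime δ' (β : ℤ) ∧ IsCoprime (β : ℤ) (d : ℤ) ∧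
      δ' ^ 2 + (β : ℤ) ^ 2 = D * (d * (α : ℤ) ^ 2) ∧ jacobiSym β d = jacobiSym 2 d * jacobiSym k n1 := by
  obtain ⟨r, s, n1, n2, δ', t1, t2, t3, t4, t5, t6, t7, t8⟩ := TA hn hα hβ hc hβ0 h1 h2
  subst hdD
  have e0 : δ' ^ 2 + (β : ℤ) ^ 2 = D * (d * (α : ℤ) ^ 2) := by
    rw [t6]
    have : ((δ ^ 2 + β ^ 2 : ℕ) : ℤ) = ((d * D * α ^ 2 : ℕ) : ℤ) := by rw [h2]
    push_cast at this
    rw [this]; ring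
  have hcβ : ∀ p : ℕ, p.Prime → p ∣ β → ¬ p ∣ d * D * α := fun p hp hb ha =>
    hp.one_lt.ne' (Nat.eq_one_of_dvd_coprimes hc ha hb)
  refine ⟨δ', n1, t5, t4, t3, ?_, ?_, e0, ?_⟩
  · refine coprime_of_primes (by exact_mod_cast hβ0.ne') fun p hp hb hd => ?_
    have hb' := Int.natCast_dvd_natCast.1 hb
    have h3 : (p : ℤ) ∣ D * (d * (α : ℤ) ^ 2) := by
      rw [← e0]; exact dvd_add (dvd_pow hd two_ne_zero) (dvd_pow hb two_ne_zero)
    have h4 : p ∣ D * (d * α ^ 2) := by exact_mod_cast h3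
    apply hcβ p hp hb'
    rcases hp.dvd_mul.1 h4 with h | h
    · exact (h.mul_left d).mul_right α
    · rcases hp.dvd_mul.1 h with h | h
      · exact (h.mul_right D).mul_right α
      · exact (hp.dvd_of_dvd_pow h).mul_left _
  · refine jac_coprime_ndvd (left_ne_zero_of_mul hsf.ne_zero) fun p hp hd hb => ?_
    exact hcβ p hp (Int.natCast_dvd_natCast.1 hb) ((hd.mul_right D).mul_right α)
  · have hg := TA_genus (k := (k : ℤ)) (rs := (r : ℤ) * s) hsf hP rfl t2 (fun p hp hpd => loc_k hk hsf hP hxy h hp hpd)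
      (fun p hp hpd => loc_k (x := y) (y := x) (Z := Z) hk (by rwa [mul_comm]) (by rwa [mul_comm]) hxy.symm (by rw [← h]; ring) hp hpd)
      (fun p hp hpd => t7 p hp (hP p hp (t2 ▸ hpd.mul_right _)) hpd)
      (fun p hp hpd => t8 p hp (hP p hp (t2 ▸ hpd.mul_left _)) hpd)
    rw [← hg, ← jacobiSym.mul_left, t1]
    push_cast; rw [mul_assoc]

theorem odd_sol2 {d D : ℕ} (h8 : d * D % 8 = 1) (hd : d % 4 = 1) (hD : D % 4 = 1) {x y Z : ℤ} (hxy : IsCoprime x y)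
    (h : d * x ^ 2 + D * y ^ 2 = 2 * Z ^ 2) : x % 2 = 1 ∧ y % 2 = 1 ∧ Z % 2 = 1 ∧ d % 8 = D % 8 := by
  have h88 : d % 8 = D % 8 := by
    have h1 : d % 8 = 1 ∨ d % 8 = 5 := by omega
    have h2 : D % 8 = 1 ∨ D % 8 = 5 := by omega
    rw [Nat.mul_mod] at h8
    rcases h1 with h1 | h1 <;> rcases h2 with h2 | h2 <;> rw [h1, h2] at h8 <;> omega
  obtain ⟨d1, hd1⟩ : ∃ d1 : ℤ, (d : ℤ) = 4 * d1 + 1 := ⟨d / 4, by omega⟩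
  obtain ⟨D1, hD1⟩ : ∃ d1 : ℤ, (D : ℤ) = 4 * d1 + 1 := ⟨D / 4, by omega⟩
  have hpar : x % 2 = y % 2 := by
    have : (x - y) * (x - y) = 2 * (Z ^ 2 - 2 * d1 * x ^ 2 - 2 * D1 * y ^ 2 - x * y) := by
      rw [hd1, hD1] at h; linear_combination h
    have h2 : (2 : ℤ) ∣ (x - y) * (x - y) := ⟨_, this⟩
    rcases Int.prime_two.dvd_or_dvd h2 with h | h <;> omega
  have hx : x % 2 = 1 := by
    by_contra hcon
    exact not_both_dvd Nat.prime_two hxy (by push_cast; omega) (by push_cast; omega)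
  refine ⟨hx, by omega, ?_, h88⟩
  have hx8 := odd_sq_mod8 hx
  have hy8 := odd_sq_mod8 (x := y) (by omega)
  obtain ⟨x1, hx1⟩ : ∃ t, x ^ 2 = 8 * t + 1 := ⟨x ^ 2 / 8, by omega⟩
  obtain ⟨y1, hy1⟩ : ∃ t, y ^ 2 = 8 * t + 1 := ⟨y ^ 2 / 8, by omega⟩
  obtain ⟨w, hw⟩ : ∃ w : ℤ, (D : ℤ) = 8 * w + d := ⟨(D - d) / 8, by omega⟩
  by_contra hcon
  obtain ⟨z1, hz1⟩ : ∃ t, Z = 2 * t := ⟨Z / 2, by omega⟩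
  rw [hw, hx1, hy1, hd1, hz1] at h
  have : 8 * z1 ^ 2 = 8 * (4 * d1 * x1 + x1 + d1 + 8 * w * y1 + w + 4 * d1 * y1 + y1) + 2 := by linear_combination -h
  omega

theorem case1a {n d D α β γ δ : ℕ} (hn : n % 8 = 1) (hsf : Squarefree n) (hP : PP n) (hdD : d * D = n)
    (hα : α % 2 = 1) (hβ : β % 2 = 0) (hc : Nat.Coprime (n * α) β) (hβ0 : 0 < β)
    (h1 : n * α ^ 2 + β ^ 2 = γ ^ 2) (h2 : δ ^ 2 + β ^ 2 = n * α ^ 2)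
    {x y : ℤ} {Z : ℕ} (hxy : IsCoprime x y) (h : d * x ^ 2 + D * y ^ 2 = 2 * (Z : ℤ) ^ 2) :
    jacobiSym 2 d = if Z % 4 = 1 then 1 else -1 := by
  obtain ⟨δ', n1, g1, g2, g3, g4, g5, g6, g7⟩ := TA_pack (k := 2) (Or.inr rfl) hn hsf hP hdD hα hβ hc hβ0 h1 h2 hxy
    (Z := Z) (by rw [h]; push_cast; ring)
  subst hdD
  have hPd : PP d := hP.dvd ⟨D, rfl⟩
  have hPD : PP D := hP.dvd ⟨d, by ring⟩
  obtain ⟨hx, hy, hZ, -⟩ := odd_sol2 hn (hPd.mod4 (left_ne_zero_of_mul hsf.ne_zero)) (hPD.mod4 (right_ne_zero_of_mul hsf.ne_zero)) hxy h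
  have hB := B1 hsf hPd hPD g1 g2 g4 g5 g6 hx hy (by omega) hxy h
  have hn1 : jacobiSym ((2 : ℕ) : ℤ) n1 = if β % 8 = 0 then 1 else -1 := by
    push_cast
    rw [jac_two_nat (by omega)]
    have : (n1 % 8 = 1 ∨ n1 % 8 = 7) ↔ β % 8 = 0 := by omega
    simp only [this]
  rw [hB, hn1, mul_comm] at g7
  split_ifs at g7 ⊢ <;> linarith

theorem case2a {n d D α β γ δ : ℕ} (hn : n % 8 = 1) (hsf : Squarefree n) (hP : PP n) (hdD : d * D = n)
    (hd8 : d % 8 = 5) (hD8 : D % 8 = 5)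
    (hα : α % 2 = 1) (hβ : β % 2 = 0) (hc : Nat.Coprime (n * α) β) (hβ0 : 0 < β)
    (h1 : n * α ^ 2 + β ^ 2 = γ ^ 2) (h2 : δ ^ 2 + β ^ 2 = n * α ^ 2)
    {x y : ℤ} {Z : ℕ} (hZ0 : 0 < Z) (hZ : Z % 4 = 1) (hxy : IsCoprime x y) (h : d * x ^ 2 + D * y ^ 2 = (Z : ℤ) ^ 2) : False := by
  obtain ⟨δ', n1, g1, g2, g3, g4, g5, g6, g7⟩ := TA_pack (k := 1) (Or.inl rfl) hn hsf hP hdD hα hβ hc hβ0 h1 h2 hxy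
    (Z := Z) (by rw [h]; push_cast; ring)
  subst hdD
  have hPd : PP d := hP.dvd ⟨D, rfl⟩
  have hPD : PP D := hP.dvd ⟨d, by ring⟩
  have hB := B2 hsf hPd hPD hd8 hD8 (by omega) hβ g4 g5 g6 hZ0 hZ hxy h
  rw [hB, jac_two_nat (by omega)] at g7
  simp [hd8] at g7


theorem L_odd {a b k : ℕ} (hk : k = 1 ∨ k = 2) (hsf : Squarefree (a * b)) (hP : PP (a * b)) {x y x' y' z z' : ℤ}
    (hxy : IsCoprime x y) (hxy' : IsCoprime x' y') (h : a * x ^ 2 + b * y ^ 2 = k * z ^ 2)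
    (h' : a * x' ^ 2 + b * y' ^ 2 = k * z' ^ 2) {L : ℕ} (hL : (L : ℤ) = k * z * z' + a * x * x' + b * y * y')
    {j N : ℕ} (hj : L = 2 ^ j * N) (hN : N % 2 = 1) : N % 4 = 1 := by
  have hN0 : N ≠ 0 := by omega
  have hL0 : L ≠ 0 := by rw [hj]; positivity
  have key : jacobiSym (-1) N = 1 := by
    refine jac_even hN0 (isCoprime_one_left.neg_left) fun q hq hqN hjq => ?_
    have hqi := Nat.prime_iff_prime_int.1 hq
    have hq2 : q ≠ 2 := by
      rintro rfl
      omega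
    have hqo : q % 2 = 1 := Nat.odd_iff.1 (hq.odd_of_ne_two hq2)
    have h2 : ¬ (q : ℤ) ∣ 2 := by
      intro hh
      have h3 : q ∣ 2 := by exact_mod_cast hh
      exact hq2 ((Nat.prime_dvd_prime_iff_eq hq Nat.prime_two).1 h3)
    have hq4 : q % 4 ≠ 1 := by
      intro hh
      rw [jac_neg_one_nat hqo, if_pos hh] at hjq
      norm_num at hjq
    have hqab : ¬ q ∣ a * b := fun hh => hq4 (hP q hq hh)
    have hqa : ¬ q ∣ a := fun hh => hqab (hh.mul_right b)
    have hqb : ¬ q ∣ b := fun hh => hqab (hh.mul_left a)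
    have hqk : ¬ q ∣ k := by
      intro hh
      rcases hk with rfl | rfl
      · exact hq.one_lt.ne' (Nat.dvd_one.1 hh)
      · exact hq2 ((Nat.prime_dvd_prime_iff_eq hq Nat.prime_two).1 hh)
    have hfac : L.factorization q = N.factorization q := by
      rw [hj, Nat.factorization_mul (by positivity) hN0, Nat.factorization_pow]
      have : (2 : ℕ).factorization q = 0 := Nat.factorization_eq_zero_of_not_dvd (fun hh => h2 (by exact_mod_cast hh))
      simp [this]
    rw [← hfac]
    have part : ∀ (P w : ℤ) (m : ℕ), (L : ℤ) * P = m * w ^ 2 → ¬ q ∣ m → ¬ (q : ℤ) ∣ P → Even (L.factorization q) := by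
      intro P w m he hm hP'
      refine val_even_partner' hq hL0 (M' := P.natAbs) (m := m) (k := w.natAbs) ?_ hm ?_
      · intro hh; exact hP' (Int.natCast_dvd.2 hh)
      · have := congrArg Int.natAbs he
        simpa [Int.natAbs_mul, Int.natAbs_pow] using this
    by_cases c1 : (q : ℤ) ∣ k * z * z' - a * x * x' - b * y * y'
    swap
    · refine part _ (x * y' - x' * y) (a * b) ?_ hqab c1
      rw [hL]; push_cast
      linear_combination -k * z' ^ 2 * h - (a * x ^ 2 + b * y ^ 2) * h'
    by_cases c2 : (q : ℤ) ∣ k * z * z' + a * x * x' - b * y * y'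
    swap
    · refine part _ (z * x' + x * z') (k * a) ?_ (fun hh => (hq.dvd_mul.1 hh).elim hqk hqa) c2
      rw [hL]; push_cast
      linear_combination (a * x' ^ 2 - k * z' ^ 2) * h - b * y ^ 2 * h'
    by_cases c3 : (q : ℤ) ∣ k * z * z' - a * x * x' + b * y * y'
    swap
    · refine part _ (z * y' + y * z') (k * b) ?_ (fun hh => (hq.dvd_mul.1 hh).elim hqk hqb) c3
      rw [hL]; push_cast
      linear_combination (b * y' ^ 2 - k * z' ^ 2) * h - a * x ^ 2 * h'
    exfalso
    have hqL : (q : ℤ) ∣ k * z * z' + a * x * x' + b * y * y' := by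
      rw [← hL, hj]; exact Int.natCast_dvd_natCast.2 (hqN.mul_left _)
    have can : ∀ (m : ℕ) (s t : ℤ), ¬ q ∣ m → (q : ℤ) ∣ 2 * (m * s * t) → (q : ℤ) ∣ s ∨ (q : ℤ) ∣ t := by
      intro m s t hm hh
      have := (hqi.dvd_or_dvd hh).resolve_left h2
      rw [mul_assoc] at this
      exact hqi.dvd_or_dvd ((hqi.dvd_or_dvd this).resolve_left (fun h => hm (Int.natCast_dvd_natCast.1 h)))
    have dz := can k z z' hqk (by
      have := dvd_add hqL c1
      have e : k * z * z' + a * x * x' + b * y * y' + (k * z * z' - a * x * x' - b * y * y') = 2 * (k * z * z') := by ring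
      rwa [e] at this)
    have dx := can a x x' hqa (by
      have := dvd_sub hqL c3
      have e : k * z * z' + a * x * x' + b * y * y' - (k * z * z' - a * x * x' + b * y * y') = 2 * (a * x * x') := by ring
      rwa [e] at this)
    have dy := can b y y' hqb (by
      have := dvd_sub hqL c2
      have e : k * z * z' + a * x * x' + b * y * y' - (k * z * z' + a * x * x' - b * y * y') = 2 * (b * y * y') := by ring
      rwa [e] at this)
    rcases dz with dz | dz
    · obtain ⟨-, -, nx, ny⟩ := prim_sol hsf hxy h hq dz
      exact not_both_dvd hq hxy' (dx.resolve_left nx) (dy.resolve_left ny)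
    · obtain ⟨-, -, nx, ny⟩ := prim_sol hsf hxy' h' hq dz
      exact not_both_dvd hq hxy (dx.resolve_right nx) (dy.resolve_right ny)
  rw [jac_neg_one_nat hN] at key
  by_contra hcon
  rw [if_neg hcon] at key
  norm_num at key

/-- either the two solutions agree up to sign or both linear forms are positive -/
theorem L_pos {a b k : ℕ} (hk0 : 0 < k) (hab : a * b ≠ 0) {x y x' y' : ℤ} {z z' : ℕ} (hz : 0 < z) (hz' : 0 < z')
    (hxy : IsCoprime x y) (hxy' : IsCoprime x' y') (h : a * x ^ 2 + b * y ^ 2 = k * (z : ℤ) ^ 2)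
    (h' : a * x' ^ 2 + b * y' ^ 2 = k * (z' : ℤ) ^ 2) (hne : z ≠ z') :
    ∃ L L' : ℕ, 0 < L ∧ 0 < L' ∧ (L : ℤ) = k * z * z' + a * x * x' + b * y * y' ∧
      (L' : ℤ) = k * z * z' - a * x * x' - b * y * y' ∧ (L : ℤ) * L' = a * b * (x * y' - x' * y) ^ 2 ∧
      (L : ℤ) + L' = 2 * k * z * z' := by
  have hk0' : (0 : ℤ) < k := by exact_mod_cast hk0
  have hz0 : (0 : ℤ) < z := by exact_mod_cast hz
  have hz0' : (0 : ℤ) < z' := by exact_mod_cast hz'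
  have ha : (0 : ℤ) < a := by have := left_ne_zero_of_mul hab; positivity
  have hb : (0 : ℤ) < b := by have := right_ne_zero_of_mul hab; positivity
  have hprod : ((k : ℤ) * z * z' + a * x * x' + b * y * y') * (k * z * z' - a * x * x' - b * y * y') = a * b * (x * y' - x' * y) ^ 2 := by
    linear_combination -k * z' ^ 2 * h - (a * x ^ 2 + b * y ^ 2) * h'
  have hw : x * y' - x' * y ≠ 0 := by
    intro hw
    apply hne
    have h1 : x ∣ x' := hxy.dvd_of_dvd_mul_right ⟨y', by linear_combination -hw⟩
    have h2 : x' ∣ x := hxy'.dvd_of_dvd_mul_right ⟨y, by linear_combination hw⟩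
    have h3 : y ∣ y' := hxy.symm.dvd_of_dvd_mul_left ⟨x', by linear_combination hw⟩
    have h4 : y' ∣ y := hxy'.symm.dvd_of_dvd_mul_left ⟨x, by linear_combination -hw⟩
    have h5 : x ^ 2 = x' ^ 2 := by
      rw [← Int.natAbs_sq x, ← Int.natAbs_sq x', Int.natAbs_eq_of_dvd_dvd h1 h2]
    have h6 : y ^ 2 = y' ^ 2 := by
      rw [← Int.natAbs_sq y, ← Int.natAbs_sq y', Int.natAbs_eq_of_dvd_dvd h3 h4]
    rw [h5, h6, h'] at h
    have h7 : (z' : ℤ) ^ 2 = z ^ 2 := mul_left_cancel₀ hk0'.ne' h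
    have h8 : z' ^ 2 = z ^ 2 := by exact_mod_cast h7
    exact (Nat.pow_left_injective two_ne_zero h8).symm
  have hpos : 0 < ((k : ℤ) * z * z' + a * x * x' + b * y * y') * (k * z * z' - a * x * x' - b * y * y') := by
    rw [hprod]; positivity
  have hsum : 0 < (k : ℤ) * z * z' := by positivity
  have hL : 0 < (k : ℤ) * z * z' + a * x * x' + b * y * y' ∧ 0 < k * z * z' - a * x * x' - b * y * y' := by
    rcases pos_and_pos_or_neg_and_neg_of_mul_pos hpos with h1 | ⟨h1, h2⟩
    · exact h1
    · linarith
  refine ⟨_, _, ?_, ?_, Int.toNat_of_nonneg hL.1.le, Int.toNat_of_nonneg hL.2.le, ?_, ?_⟩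
  · have := hL.1; omega
  · have := hL.2; omega
  · rw [Int.toNat_of_nonneg hL.1.le, Int.toNat_of_nonneg hL.2.le, hprod]
  · rw [Int.toNat_of_nonneg hL.1.le, Int.toNat_of_nonneg hL.2.le]; ring

/-- one odd, one even, product `n * v ^ 2` -/
theorem four_dvd_of {n : ℕ} {r s v : ℤ} (hn : n % 2 = 1) (hr : r % 2 = 1) (hs : s % 2 = 0) (h : r * s = n * v ^ 2) : s % 4 = 0 := by
  have hv : v % 2 = 0 := by
    by_contra hcon
    obtain ⟨v1, hv1⟩ : ∃ t, v = 2 * t + 1 := ⟨v / 2, by omega⟩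
    obtain ⟨n1, hn1⟩ : ∃ t : ℤ, (n : ℤ) = 2 * t + 1 := ⟨n / 2, by omega⟩
    obtain ⟨s1, hs1⟩ : ∃ t, s = 2 * t := ⟨s / 2, by omega⟩
    rw [hv1, hn1, hs1] at h
    have : 2 * (r * s1) = 2 * (n1 * (2 * v1 + 1) ^ 2 + 2 * v1 ^ 2 + 2 * v1) + 1 := by linear_combination h
    omega
  obtain ⟨v1, hv1⟩ : ∃ t, v = 2 * t := ⟨v / 2, by omega⟩
  obtain ⟨r1, hr1⟩ : ∃ t, r = 2 * t + 1 := ⟨r / 2, by omega⟩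
  obtain ⟨s1, hs1⟩ : ∃ t, s = 2 * t := ⟨s / 2, by omega⟩
  rw [hv1, hr1, hs1] at h
  have : s1 = 2 * (n * v1 ^ 2 - r1 * s1) := by linarith
  omega

theorem indep {d D : ℕ} (hsf : Squarefree (d * D)) (hP : PP (d * D)) (h8 : d * D % 8 = 1) {x y x' y' : ℤ} {z z' : ℕ}
    (hz : 0 < z) (hz' : 0 < z')
    (hxy : IsCoprime x y) (hxy' : IsCoprime x' y') (h : d * x ^ 2 + D * y ^ 2 = 2 * (z : ℤ) ^ 2)
    (h' : d * x' ^ 2 + D * y' ^ 2 = 2 * (z' : ℤ) ^ 2) : z % 4 = z' % 4 := by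
  by_cases hne : z = z'
  · rw [hne]
  have hPd : PP d := hP.dvd ⟨D, rfl⟩
  have hPD : PP D := hP.dvd ⟨d, by ring⟩
  have hd4 := hPd.mod4 (left_ne_zero_of_mul hsf.ne_zero)
  have hD4 := hPD.mod4 (right_ne_zero_of_mul hsf.ne_zero)
  obtain ⟨ox, oy, oz, -⟩ := odd_sol2 h8 hd4 hD4 hxy h
  obtain ⟨ox', oy', oz', -⟩ := odd_sol2 h8 hd4 hD4 hxy' h'
  have g : d * x ^ 2 + D * y ^ 2 = (2 : ℕ) * (z : ℤ) ^ 2 := by rw [h]; push_cast; ring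
  have g' : d * x' ^ 2 + D * y' ^ 2 = (2 : ℕ) * (z' : ℤ) ^ 2 := by rw [h']; push_cast; ring
  obtain ⟨L, L', l1, l2, l3, l4, l5, l6⟩ := L_pos (k := 2) two_pos hsf.ne_zero hz hz' hxy hxy' g g' hne
  have hodd : ∀ j N : ℕ, L = 2 ^ j * N → N % 2 = 1 → N % 4 = 1 := fun j N hj hN =>
    L_odd (Or.inr rfl) hsf hP hxy hxy' g g' l3 hj hN
  have hodd' : ∀ j N : ℕ, L' = 2 ^ j * N → N % 2 = 1 → N % 4 = 1 := fun j N hj hN =>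
    L_odd (x := -x) (y := -y) (z := z) (z' := z') (Or.inr rfl) hsf hP hxy.neg_neg hxy' (by linear_combination g) g' (by rw [l4]; ring) hj hN
  obtain ⟨d1, hd1⟩ : ∃ t : ℤ, (d : ℤ) = 2 * t + 1 := ⟨d / 2, by omega⟩
  obtain ⟨D1, hD1⟩ : ∃ t : ℤ, (D : ℤ) = 2 * t + 1 := ⟨D / 2, by omega⟩
  obtain ⟨x1, hx1⟩ : ∃ t : ℤ, x = 2 * t + 1 := ⟨x / 2, by omega⟩
  obtain ⟨y1, hy1⟩ : ∃ t : ℤ, y = 2 * t + 1 := ⟨y / 2, by omega⟩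
  obtain ⟨x1', hx1'⟩ : ∃ t : ℤ, x' = 2 * t + 1 := ⟨x' / 2, by omega⟩
  obtain ⟨y1', hy1'⟩ : ∃ t : ℤ, y' = 2 * t + 1 := ⟨y' / 2, by omega⟩
  obtain ⟨w, hw⟩ : ∃ w, x * y' - x' * y = 2 * w := by
    rw [hx1, hy1, hx1', hy1']
    exact ⟨2 * x1 * y1' + x1 + y1' - 2 * x1' * y1 - x1' - y1, by ring⟩
  have hLe : ∃ t, (L : ℤ) = 2 * t := by
    rw [l3, hd1, hD1, hx1, hy1, hx1', hy1']
    exact ⟨z * z' + d1 * (2 * x1 + 1) * (2 * x1' + 1) + 2 * x1 * x1' + x1 + x1' + D1 * (2 * y1 + 1) * (2 * y1' + 1) +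
      2 * y1 * y1' + y1 + y1' + 1, by push_cast; ring⟩
  obtain ⟨t, ht⟩ := hLe
  obtain ⟨m, hm⟩ : ∃ m : ℕ, L = 2 * m := ⟨L / 2, by omega⟩
  push_cast at l6
  obtain ⟨zz, hzz⟩ : ∃ zz : ℤ, zz = (z : ℤ) * z' := ⟨_, rfl⟩
  have l6' : (L : ℤ) + L' = 4 * zz := by rw [l6, hzz]; ring
  have hzo : zz % 2 = 1 := by
    rw [hzz, Int.mul_emod, oz, oz']; norm_num
  obtain ⟨m', hm'⟩ : ∃ m : ℕ, L' = 2 * m := ⟨L' / 2, by omega⟩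
  have hmm : (m : ℤ) * m' = (d * D : ℕ) * w ^ 2 := by
    rw [hw, hm, hm'] at l5
    push_cast at l5 ⊢
    linarith
  have hsum : (m : ℤ) + m' = 2 * zz := by omega
  have goal : zz % 4 = 1 := by
    by_cases hmo : m % 2 = 1
    · have h1 := hodd 1 m (by rw [hm]; ring) hmo
      have h2 := hodd' 1 m' (by rw [hm']; ring) (by omega)
      have hwo : w % 2 = 1 := by
        by_contra hcon
        obtain ⟨v1, hv1⟩ : ∃ t, w = 2 * t := ⟨w / 2, by omega⟩
        obtain ⟨m1, hm1⟩ : ∃ t : ℤ, (m : ℤ) = 2 * t + 1 := ⟨m / 2, by omega⟩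
        obtain ⟨m1', hm1'⟩ : ∃ t : ℤ, (m' : ℤ) = 2 * t + 1 := ⟨m' / 2, by omega⟩
        rw [hv1, hm1, hm1'] at hmm
        have : 2 * (2 * m1 * m1' + m1 + m1') + 1 = 2 * (2 * (d * D : ℕ) * v1 ^ 2) := by linear_combination hmm
        omega
      have hw8 := odd_sq_mod8 hwo
      obtain ⟨w2, hw2⟩ : ∃ t, w ^ 2 = 8 * t + 1 := ⟨w ^ 2 / 8, by omega⟩
      obtain ⟨n2, hn2⟩ : ∃ t : ℤ, ((d * D : ℕ) : ℤ) = 8 * t + 1 := ⟨(d * D : ℕ) / 8, by omega⟩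
      obtain ⟨m1, hm1⟩ : ∃ t : ℤ, (m : ℤ) = 4 * t + 1 := ⟨m / 4, by omega⟩
      obtain ⟨m1', hm1'⟩ : ∃ t : ℤ, (m' : ℤ) = 4 * t + 1 := ⟨m' / 4, by omega⟩
      rw [hw2, hn2, hm1, hm1'] at hmm
      have : m1 + m1' = 2 * (8 * n2 * w2 + n2 + w2 - 2 * m1 * m1') := by linarith
      omega
    · obtain ⟨r, hr⟩ : ∃ r : ℕ, m = 2 * r := ⟨m / 2, by omega⟩
      obtain ⟨r', hr'⟩ : ∃ r : ℕ, m' = 2 * r := ⟨m' / 2, by omega⟩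
      have hwe : w % 2 = 0 := by
        by_contra hcon
        obtain ⟨v1, hv1⟩ : ∃ t, w = 2 * t + 1 := ⟨w / 2, by omega⟩
        obtain ⟨n2, hn2⟩ : ∃ t : ℤ, ((d * D : ℕ) : ℤ) = 2 * t + 1 := ⟨(d * D : ℕ) / 2, by omega⟩
        rw [hv1, hn2, hr, hr'] at hmm
        push_cast at hmm
        have : 2 * (2 * (r : ℤ) * r') = 2 * (n2 * (2 * v1 + 1) ^ 2 + 2 * v1 ^ 2 + 2 * v1) + 1 := by linear_combination hmm
        omega
      obtain ⟨v, hv⟩ : ∃ t, w = 2 * t := ⟨w / 2, by omega⟩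
      have hrr : (r : ℤ) * r' = (d * D : ℕ) * v ^ 2 := by
        rw [hv, hr, hr'] at hmm
        push_cast at hmm ⊢
        linarith
      by_cases hro : r % 2 = 1
      · have h1 := hodd 2 r (by rw [hm, hr]; ring) hro
        have h2 := four_dvd_of (by omega) (by omega) (by omega) hrr
        omega
      · have h1 := hodd' 2 r' (by rw [hm', hr']; ring) (by omega)
        rw [mul_comm] at hrr
        have h2 := four_dvd_of (by omega) (by omega) (by omega) hrr
        omega
  have hz4 : z % 4 = 1 ∨ z % 4 = 3 := by omega
  have hz4' : z' % 4 = 1 ∨ z' % 4 = 3 := by omega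
  rw [hzz, Int.mul_emod] at goal
  have hzi : ((z : ℤ) % 4) = ((z % 4 : ℕ) : ℤ) := by push_cast; rfl
  have hzi' : ((z' : ℤ) % 4) = ((z' % 4 : ℕ) : ℤ) := by push_cast; rfl
  rw [hzi, hzi'] at goal
  rcases hz4 with h1 | h1 <;> rcases hz4' with h2 | h2 <;> rw [h1, h2] at goal ⊢ <;> norm_num at goal


theorem mod4_of_PP {D1 k m : ℕ} (h : PP D1) (hm : m = D1 * k ^ 2) (ho : m % 2 = 1) : m % 4 = 1 := by
  have hD0 : D1 ≠ 0 := by rintro rfl; simp at hm; omega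
  have h4 := h.mod4 hD0
  have hk : k % 2 = 1 := by
    by_contra hcon
    obtain ⟨t, rfl⟩ : ∃ t, k = 2 * t := ⟨k / 2, by omega⟩
    have : m = 2 * (D1 * 2 * t ^ 2) := by rw [hm]; ring
    omega
  obtain ⟨t, rfl⟩ : ∃ t, k = 2 * t + 1 := ⟨k / 2, by omega⟩
  obtain ⟨e, rfl⟩ : ∃ e, D1 = 4 * e + 1 := ⟨D1 / 4, by omega⟩
  have : m = 4 * (e * (2 * t + 1) ^ 2 + t ^ 2 + t) + 1 := by rw [hm]; ring
  omega

theorem case1b {d D α β γ δ : ℕ} (hsf : Squarefree (d * D)) (hP : PP (d * D)) (h8 : d * D % 8 = 1)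
    (hα : α % 2 = 1) (hβ : β % 2 = 0) (hc : Nat.Coprime α β) (hδ : 0 < δ)
    (h1 : α ^ 2 + β ^ 2 = d * γ ^ 2) (h2 : α ^ 2 = β ^ 2 + D * δ ^ 2) {x y : ℤ} {z : ℕ} (hz : 0 < z) (hxy : IsCoprime x y)
    (h : d * x ^ 2 + D * y ^ 2 = 2 * (z : ℤ) ^ 2) : jacobiSym 2 d = if z % 4 = 1 then 1 else -1 := by
  have hd0 := left_ne_zero_of_mul hsf.ne_zero
  have hD0 := right_ne_zero_of_mul hsf.ne_zero
  have hPd : PP d := hP.dvd ⟨D, rfl⟩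
  have hPD : PP D := hP.dvd ⟨d, by ring⟩
  have hd4 := hPd.mod4 hd0
  -- the solution
  have hcop : ∀ p : ℕ, p.Prime → p ∣ γ → ¬ p ∣ δ := by
    intro p hp hg hd
    have e1 : p ∣ α ^ 2 + β ^ 2 := by rw [h1]; exact (dvd_pow hg two_ne_zero).mul_left _
    have hsum : α ^ 2 + α ^ 2 = d * γ ^ 2 + D * δ ^ 2 := by rw [← h1]; omega
    have e2 : p ∣ 2 * α ^ 2 := by
      rw [two_mul, hsum]
      exact dvd_add ((dvd_pow hg two_ne_zero).mul_left _) ((dvd_pow hd two_ne_zero).mul_left _)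
    rcases hp.dvd_mul.1 e2 with h3 | h3
    · have := (Nat.prime_dvd_prime_iff_eq hp Nat.prime_two).1 h3
      subst this
      have h5 : (α ^ 2 + β ^ 2) % 2 = 0 := by omega
      simp [Nat.add_mod, Nat.pow_mod, hα, hβ] at h5
    · have h4 := (Nat.dvd_add_right h3).1 e1
      exact hp.one_lt.ne' (Nat.eq_one_of_dvd_coprimes hc (hp.dvd_of_dvd_pow h3) (hp.dvd_of_dvd_pow h4))
  have hcop' : IsCoprime (γ : ℤ) (δ : ℤ) := coprime_of_primes (by exact_mod_cast hδ.ne') fun p hp hd hg =>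
    hcop p hp (Int.natCast_dvd_natCast.1 hg) (Int.natCast_dvd_natCast.1 hd)
  have i1 : (α : ℤ) ^ 2 + (β : ℤ) ^ 2 = d * (γ : ℤ) ^ 2 := by exact_mod_cast h1
  have i2 : (α : ℤ) ^ 2 = (β : ℤ) ^ 2 + D * (δ : ℤ) ^ 2 := by exact_mod_cast h2
  have hz4 := indep hsf hP h8 hz (by omega : 0 < α) hxy hcop' h (by linear_combination -i1 - i2)
  rw [hz4]
  -- α + β ≡ 1 mod 4
  have hlt : β < α := by
    have : 0 < D * δ ^ 2 := by positivity
    have : β ^ 2 < α ^ 2 := by omega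
    exact lt_of_pow_lt_pow_left₀ 2 (by omega) this
  have hs4 : (α + β) % 4 = 1 := by
    have hco : Nat.Coprime (α - β) (α + β) := by
      rw [Nat.coprime_iff_gcd_eq_one]
      by_contra hcon
      obtain ⟨p, hp, hpg⟩ := Nat.exists_prime_and_dvd hcon
      have a1 := hpg.trans (Nat.gcd_dvd_left _ _)
      have a2 := hpg.trans (Nat.gcd_dvd_right _ _)
      have a3 : p ∣ 2 * α := by
        have := dvd_add a1 a2
        have e : α - β + (α + β) = 2 * α := by omega
        rwa [e] at this
      have a4 : p ∣ 2 * β := by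
        have := Nat.dvd_sub a2 a1
        have e : α + β - (α - β) = 2 * β := by omega
        rwa [e] at this
      by_cases hp2 : p = 2
      · subst hp2; omega
      · have h2' : ¬ p ∣ 2 := fun hh => hp2 ((Nat.prime_dvd_prime_iff_eq hp Nat.prime_two).1 hh)
        exact hp.one_lt.ne' (Nat.eq_one_of_dvd_coprimes hc ((hp.dvd_mul.1 a3).resolve_left h2') ((hp.dvd_mul.1 a4).resolve_left h2'))
    have hpr : (α - β) * (α + β) = D * δ ^ 2 := by
      zify [hlt.le]; linear_combination i2
    obtain ⟨D1, D2, k, l, hD, -, hl⟩ := sqsplit hco hpr (by omega)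
    exact mod4_of_PP (hPD.dvd ⟨D1, by rw [hD]; ring⟩) hl (by omega)
  -- d mod 8
  have hγ : (γ : ℤ) % 2 = 1 := by
    by_contra hcon
    obtain ⟨t, ht⟩ : ∃ t : ℤ, (γ : ℤ) = 2 * t := ⟨γ / 2, by omega⟩
    obtain ⟨a, ha⟩ : ∃ t : ℤ, (α : ℤ) = 2 * t + 1 := ⟨α / 2, by omega⟩
    obtain ⟨b, hb⟩ : ∃ t : ℤ, (β : ℤ) = 2 * t := ⟨β / 2, by omega⟩
    rw [ht, ha, hb] at i1
    have : 2 * (2 * a ^ 2 + 2 * a + 2 * b ^ 2) + 1 = 2 * (2 * d * t ^ 2) := by linear_combination i1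
    omega
  have hγ8 := odd_sq_mod8 hγ
  have hα8 := odd_sq_mod8 (x := (α : ℤ)) (by omega)
  obtain ⟨g, hg⟩ : ∃ t : ℤ, (γ : ℤ) ^ 2 = 8 * t + 1 := ⟨γ ^ 2 / 8, by omega⟩
  obtain ⟨a, ha⟩ : ∃ t : ℤ, (α : ℤ) ^ 2 = 8 * t + 1 := ⟨α ^ 2 / 8, by omega⟩
  rw [hg, ha] at i1
  rw [jac_two_nat (by omega)]
  have hiff : (d % 8 = 1 ∨ d % 8 = 7) ↔ α % 4 = 1 := by
    by_cases hb : β % 4 = 0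
    · obtain ⟨b, hb'⟩ : ∃ t : ℤ, (β : ℤ) = 4 * t := ⟨β / 4, by omega⟩
      rw [hb'] at i1
      have : (d : ℤ) = 8 * (a + 2 * b ^ 2 - d * g) + 1 := by linear_combination -i1
      omega
    · obtain ⟨b, hb'⟩ : ∃ t : ℤ, (β : ℤ) = 4 * t + 2 := ⟨β / 4, by omega⟩
      rw [hb'] at i1
      have : (d : ℤ) = 8 * (a + 2 * b ^ 2 + 2 * b - d * g) + 5 := by linear_combination -i1
      omega
  simp only [hiff]

theorem case2b {d D α β γ δ : ℕ} (hsf : Squarefree (d * D)) (hP : PP (d * D)) (hd8 : d % 8 = 5) (hD8 : D % 8 = 5)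
    (hα : α % 2 = 1) (hβ : β % 2 = 0) (hβ0 : 0 < β) (hc : Nat.Coprime (d * α) (D * β))
    (h1 : d * α ^ 2 + D * β ^ 2 = γ ^ 2) (h2 : d * α ^ 2 = δ ^ 2 + D * β ^ 2) {x y : ℤ} {z : ℕ} (hz : 0 < z) (hz4 : z % 4 = 1)
    (hxy : IsCoprime x y) (h : d * x ^ 2 + D * y ^ 2 = (z : ℤ) ^ 2) : False := by
  have hd0 := left_ne_zero_of_mul hsf.ne_zero
  have hD0 := right_ne_zero_of_mul hsf.ne_zero
  have hPd : PP d := hP.dvd ⟨D, rfl⟩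
  have hPD : PP D := hP.dvd ⟨d, by ring⟩
  have i1 : d * (α : ℤ) ^ 2 + D * (β : ℤ) ^ 2 = (γ : ℤ) ^ 2 := by exact_mod_cast h1
  have i2 : d * (α : ℤ) ^ 2 = (δ : ℤ) ^ 2 + D * (β : ℤ) ^ 2 := by exact_mod_cast h2
  obtain ⟨d1, hd1⟩ : ∃ d1 : ℤ, (d : ℤ) = 8 * d1 + 5 := ⟨d / 8, by omega⟩
  obtain ⟨D1, hD1⟩ : ∃ D1 : ℤ, (D : ℤ) = 8 * D1 + 5 := ⟨D / 8, by omega⟩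
  have hα8 := odd_sq_mod8 (x := (α : ℤ)) (by omega)
  obtain ⟨a, ha⟩ : ∃ t : ℤ, (α : ℤ) ^ 2 = 8 * t + 1 := ⟨α ^ 2 / 8, by omega⟩
  have par : ∀ w : ℤ, (∃ t, w ^ 2 = 2 * t + 1) → w % 2 = 1 := by
    rintro w ⟨t, ht⟩
    by_contra hcon
    obtain ⟨v, hv⟩ : ∃ v, w = 2 * v := ⟨w / 2, by omega⟩
    rw [hv] at ht
    have : 2 * (2 * v ^ 2) = 2 * t + 1 := by linear_combination ht
    omega
  obtain ⟨b, hb⟩ : ∃ t : ℤ, (β : ℤ) = 2 * t := ⟨β / 2, by omega⟩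
  have hγ : (γ : ℤ) % 2 = 1 := par _ ⟨4 * d1 * (8 * a + 1) + 20 * a + 2 + 2 * D * b ^ 2, by
    rw [← i1, ha, hb, hd1]; ring⟩
  have hδ : (δ : ℤ) % 2 = 1 := par _ ⟨4 * d1 * (8 * a + 1) + 20 * a + 2 - 2 * D * b ^ 2, by
    have e : (δ : ℤ) ^ 2 = d * (α : ℤ) ^ 2 - D * (β : ℤ) ^ 2 := by linear_combination -i2
    rw [e, ha, hb, hd1]; ring⟩
  have hγ8 := odd_sq_mod8 hγ
  have hbo : b % 2 = 1 := by
    by_contra hcon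
    obtain ⟨b1, hb1⟩ : ∃ t, b = 2 * t := ⟨b / 2, by omega⟩
    rw [hb, hb1, ha, hd1] at i1
    have : (γ : ℤ) ^ 2 = 8 * (8 * d1 * a + d1 + 5 * a + 2 * D * b1 ^ 2) + 5 := by linear_combination -i1
    omega
  obtain ⟨b', hb'⟩ : ∃ b' : ℕ, β = 2 * b' := ⟨β / 2, by omega⟩
  have hlt : δ < γ := by
    have : 0 < D * β ^ 2 := by positivity
    have : δ ^ 2 < γ ^ 2 := by omega
    exact lt_of_pow_lt_pow_left₀ 2 (by omega) this
  obtain ⟨s, hs⟩ : ∃ s, γ - δ = 2 * s := ⟨(γ - δ) / 2, by omega⟩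
  have hγs : γ = δ + 2 * s := by omega
  have hst : s * (s + δ) = 2 * (D * b' ^ 2) := by
    have e : (4 : ℤ) * (s * (s + δ)) = 4 * (2 * (D * b' ^ 2)) := by
      have e1 : (γ : ℤ) = δ + 2 * s := by exact_mod_cast hγs
      have e2 : (β : ℤ) = 2 * b' := by exact_mod_cast hb'
      rw [e1] at i1
      rw [e2] at i1 i2
      linear_combination i2 - i1
    have e' : 4 * (s * (s + δ)) = 4 * (2 * (D * b' ^ 2)) := by exact_mod_cast e
    omega
  have hco : Nat.Coprime s (s + δ) := by
    rw [Nat.coprime_iff_gcd_eq_one]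
    by_contra hcon
    obtain ⟨p, hp, hpg⟩ := Nat.exists_prime_and_dvd hcon
    have a1 := hpg.trans (Nat.gcd_dvd_left _ _)
    have a2 := hpg.trans (Nat.gcd_dvd_right _ _)
    have a3 : p ∣ δ := (Nat.dvd_add_right a1).1 a2
    have a4 : p ∣ γ := by rw [hγs]; exact dvd_add a3 (a1.mul_left 2)
    have hp2 : ¬ p ∣ 2 := by
      intro hh
      have := (Nat.prime_dvd_prime_iff_eq hp Nat.prime_two).1 hh
      subst this; omega
    have a5 : p ∣ 2 * (d * α ^ 2) := by
      have e : 2 * (d * α ^ 2) = γ ^ 2 + δ ^ 2 := by omega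
      rw [e]; exact dvd_add (dvd_pow a4 two_ne_zero) (dvd_pow a3 two_ne_zero)
    have a6 := (hp.dvd_mul.1 a5).resolve_left hp2
    have a7 : p ∣ D * β ^ 2 := by
      have : p ∣ d * α ^ 2 + D * β ^ 2 := by rw [h1]; exact dvd_pow a4 two_ne_zero
      exact (Nat.dvd_add_right a6).1 this
    have a8 : p ∣ d * α := by
      rcases hp.dvd_mul.1 a6 with h | h
      · exact h.mul_right _
      · exact (hp.dvd_of_dvd_pow h).mul_left _
    have a9 : p ∣ D * β := by
      rcases hp.dvd_mul.1 a7 with h | h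
      · exact h.mul_right _
      · exact (hp.dvd_of_dvd_pow h).mul_left _
    exact hp.one_lt.ne' (Nat.eq_one_of_dvd_coprimes hc a8 a9)
  have hprod_odd : (D * b' ^ 2) % 2 = 1 := by
    have : b' % 2 = 1 := by omega
    rw [Nat.mul_mod, Nat.pow_mod, this, show D % 2 = 1 by omega]
  have hγ4 : γ % 4 = 3 := by
    have main : ∀ m m' : ℕ, Nat.Coprime m m' → m * m' = D * b' ^ 2 → m % 4 = 1 ∧ m' % 4 = 1 := by
      intro m m' hcm hmm
      have ho : m % 2 = 1 ∧ m' % 2 = 1 := by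
        rw [← hmm] at hprod_odd
        have := Nat.odd_mul.1 (Nat.odd_iff.2 hprod_odd)
        exact ⟨Nat.odd_iff.1 this.1, Nat.odd_iff.1 this.2⟩
      obtain ⟨A, B, k, l, hD, hk, hl⟩ := sqsplit hcm hmm (by omega)
      exact ⟨mod4_of_PP (hPD.dvd ⟨B, hD⟩) hk ho.1, mod4_of_PP (hPD.dvd ⟨A, by rw [hD]; ring⟩) hl ho.2⟩
    by_cases hse : s % 2 = 0
    · obtain ⟨t, ht⟩ : ∃ t, s = 2 * t := ⟨s / 2, by omega⟩
      have := main t (s + δ) (Nat.Coprime.coprime_dvd_left ⟨2, by rw [ht]; ring⟩ hco) (by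
        rw [ht] at hst ⊢
        have e : 2 * (t * (2 * t + δ)) = 2 * (D * b' ^ 2) := by rw [← hst]; ring
        omega)
      omega
    · obtain ⟨t, ht⟩ : ∃ t, s + δ = 2 * t := ⟨(s + δ) / 2, by omega⟩
      have := main s t (Nat.Coprime.coprime_dvd_right ⟨2, by rw [ht]; ring⟩ hco) (by
        rw [ht] at hst
        have e : 2 * (s * t) = 2 * (D * b' ^ 2) := by rw [← hst]; ring
        omega)
      omega
  -- linear forms
  have hcop' : IsCoprime (α : ℤ) (β : ℤ) :=
    Nat.isCoprime_iff_coprime.2 (Nat.Coprime.coprime_dvd_left ⟨d, by ring⟩ (Nat.Coprime.coprime_dvd_right ⟨D, by ring⟩ hc))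
  have g : d * x ^ 2 + D * y ^ 2 = (1 : ℕ) * (z : ℤ) ^ 2 := by rw [h]; push_cast; ring
  have g' : d * (α : ℤ) ^ 2 + D * (β : ℤ) ^ 2 = (1 : ℕ) * (γ : ℤ) ^ 2 := by rw [i1]; push_cast; ring
  obtain ⟨L, L', l1, l2, l3, l4, l5, l6⟩ := L_pos (k := 1) one_pos hsf.ne_zero hz (by omega : 0 < γ) hxy hcop' g g'
    (by rintro rfl; omega)
  have hodd : ∀ j N : ℕ, L = 2 ^ j * N → N % 2 = 1 → N % 4 = 1 := fun j N hj hN =>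
    L_odd (Or.inl rfl) hsf hP hxy hcop' g g' l3 hj hN
  have hodd' : ∀ j N : ℕ, L' = 2 ^ j * N → N % 2 = 1 → N % 4 = 1 := fun j N hj hN =>
    L_odd (x := -x) (y := -y) (z := z) (z' := γ) (Or.inl rfl) hsf hP hxy.neg_neg hcop' (by linear_combination g) g' (by rw [l4]; ring) hj hN
  have hz8 : (z : ℤ) ^ 2 % 8 = 1 := odd_sq_mod8 (by omega)
  obtain ⟨z1, hz1⟩ : ∃ t : ℤ, (z : ℤ) = 4 * t + 1 := ⟨z / 4, by omega⟩
  obtain ⟨γ1, hγ1⟩ : ∃ t : ℤ, (γ : ℤ) = 4 * t + 3 := ⟨γ / 4, by omega⟩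
  obtain ⟨α1, hα1⟩ : ∃ t : ℤ, (α : ℤ) = 2 * t + 1 := ⟨α / 2, by omega⟩
  obtain ⟨b1, hb1⟩ : ∃ t : ℤ, b = 2 * t + 1 := ⟨b / 2, by omega⟩
  by_cases hy : y % 2 = 1
  · have hy8 := odd_sq_mod8 hy
    obtain ⟨y2, hy2⟩ : ∃ x1, y ^ 2 = 8 * x1 + 1 := ⟨y ^ 2 / 8, by omega⟩
    have hx2 : x % 2 = 0 := by
      by_contra hcon
      have hx8 := odd_sq_mod8 (x := x) (by omega)
      obtain ⟨x1, hx1⟩ : ∃ x1, x ^ 2 = 8 * x1 + 1 := ⟨x ^ 2 / 8, by omega⟩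
      rw [hx1, hy2, hd1, hD1] at h
      have : (z : ℤ) ^ 2 = 8 * (8 * d1 * x1 + d1 + 5 * x1 + 8 * D1 * y2 + D1 + 5 * y2 + 1) + 2 := by linear_combination -h
      omega
    have hx4 : x % 4 = 2 := by
      by_contra hcon
      obtain ⟨x1, hx1⟩ : ∃ x1, x = 4 * x1 := ⟨x / 4, by omega⟩
      rw [hx1, hy2, hD1] at h
      have : (z : ℤ) ^ 2 = 8 * (2 * d * x1 ^ 2 + 8 * D1 * y2 + D1 + 5 * y2) + 5 := by linear_combination -h
      omega
    obtain ⟨x1, hx1⟩ : ∃ x1, x = 4 * x1 + 2 := ⟨x / 4, by omega⟩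
    obtain ⟨y1, hy1⟩ : ∃ x1, y = 2 * x1 + 1 := ⟨y / 2, by omega⟩
    have hL4 : (L : ℤ) % 4 = 3 := by
      rw [l3, hz1, hγ1, hd1, hD1, hx1, hy1, hα1, hb, hb1]
      push_cast; ring_nf; omega
    have := hodd 0 L (by ring) (by omega)
    omega
  · have hx : x % 2 = 1 := by
      by_contra hcon
      exact not_both_dvd Nat.prime_two hxy (by push_cast; omega) (by push_cast; omega)
    obtain ⟨x1, hx1⟩ : ∃ x1, x = 2 * x1 + 1 := ⟨x / 2, by omega⟩
    obtain ⟨y1, hy1⟩ : ∃ x1, y = 2 * x1 := ⟨y / 2, by omega⟩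
    have hL2 : (L : ℤ) % 2 = 0 := by
      rw [l3, hz1, hγ1, hd1, hD1, hx1, hy1, hα1, hb, hb1]
      push_cast; ring_nf; omega
    push_cast at l6
    obtain ⟨zz, hzz⟩ : ∃ zz : ℤ, zz = (z : ℤ) * γ := ⟨_, rfl⟩
    have l6' : (L : ℤ) + L' = 2 * zz := by rw [l6, hzz]; ring
    have hzz4 : zz % 4 = 3 := by rw [hzz, hz1, hγ1]; ring_nf; omega
    obtain ⟨m, hm⟩ : ∃ m : ℕ, L = 2 * m := ⟨L / 2, by omega⟩
    obtain ⟨m', hm'⟩ : ∃ m : ℕ, L' = 2 * m := ⟨L' / 2, by omega⟩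
    have hmm : (m : ℤ) * m' = (d * D : ℕ) * (x * b - α * y1) ^ 2 := by
      rw [hm, hm', hb, hy1] at l5
      push_cast at l5 ⊢
      linarith
    have hnn : (d * D) % 2 = 1 := by rw [Nat.mul_mod, show d % 2 = 1 by omega, show D % 2 = 1 by omega]
    by_cases hmo : m % 2 = 1
    · have e1 := hodd 1 m (by rw [hm]; ring) hmo
      have e2 := four_dvd_of hnn (by omega) (by omega) hmm
      omega
    · have e1 := hodd' 1 m' (by rw [hm']; ring) (by omega)
      rw [mul_comm] at hmm
      have e2 := four_dvd_of hnn (by omega) (by omega) hmm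
      omega


theorem pairwise_uv {u v : ℕ} (hc : Nat.Coprime u v) (hlt : v < u) (ho : (u + v) % 2 = 1) :
    Nat.Coprime (u * v) ((u + v) * (u - v)) ∧ Nat.Coprime (u + v) (u - v) := by
  have h1 : Nat.Coprime (u + v) (u - v) := by
    rw [Nat.coprime_iff_gcd_eq_one]
    by_contra hcon
    obtain ⟨p, hp, hpg⟩ := Nat.exists_prime_and_dvd hcon
    have a1 := hpg.trans (Nat.gcd_dvd_left _ _)
    have a2 := hpg.trans (Nat.gcd_dvd_right _ _)
    have hp2 : p ≠ 2 := by rintro rfl; omega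
    have b1 : p ∣ 2 * u := by
      have := dvd_add a1 a2
      rwa [show u + v + (u - v) = 2 * u by omega] at this
    have b2 : p ∣ 2 * v := by
      have := Nat.dvd_sub a1 a2
      rwa [show u + v - (u - v) = 2 * v by omega] at this
    have hn2 : ¬ p ∣ 2 := fun h => hp2 ((Nat.prime_dvd_prime_iff_eq hp Nat.prime_two).1 h)
    exact hp.one_lt.ne' (Nat.eq_one_of_dvd_coprimes hc ((hp.dvd_mul.1 b1).resolve_left hn2)
      ((hp.dvd_mul.1 b2).resolve_left hn2))
  refine ⟨?_, h1⟩
  have c1 : Nat.Coprime u (u + v) := by simpa using hc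
  have c2 : Nat.Coprime v (u + v) := by simpa using hc.symm
  have c4 : Nat.Coprime v (u - v) := (Nat.coprime_sub_self_right hlt.le).2 hc.symm
  have c3 : Nat.Coprime u (u - v) := by
    have : Nat.Coprime (v + (u - v)) (u - v) := by simpa using c4
    rwa [Nat.add_sub_cancel' hlt.le] at this
  exact Nat.Coprime.mul_right (Nat.Coprime.mul_left c1 c2) (Nat.Coprime.mul_left c3 c4)

/-- one descent step -/
theorem desc_uv {n u v b : ℕ} (hn : Squarefree n) (hP : PP n) (hc : Nat.Coprime u v) (hv : 0 < v) (hlt : v < u)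
    (ho : (u + v) % 2 = 1) (h : u * v * ((u + v) * (u - v)) = n * b ^ 2) :
    ∃ n1 n2 n3 n4 α β γ δ : ℕ, n1 * n2 * (n3 * n4) = n ∧ α % 2 = 1 ∧ β % 2 = 0 ∧ 0 < β ∧ 0 < δ ∧
      u = n1 * α ^ 2 ∧ v = n2 * β ^ 2 ∧ u + v = n3 * γ ^ 2 ∧ u = v + n4 * δ ^ 2 := by
  obtain ⟨c1, c2⟩ := pairwise_uv hc hlt ho
  have hn0 := Nat.pos_of_ne_zero hn.ne_zero
  obtain ⟨m, m', k, l, hm, e1, e2⟩ := sqsplit c1 h hn0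
  have hm0 : 0 < m := Nat.pos_of_mul_pos_right (hm ▸ hn0 : 0 < m * m')
  have hm0' : 0 < m' := Nat.pos_of_mul_pos_left (hm ▸ hn0 : 0 < m * m')
  obtain ⟨n1, n2, α, β, hm1, f1, f2⟩ := sqsplit hc e1 hm0
  obtain ⟨n3, n4, γ, δ, hm2, f3, f4⟩ := sqsplit c2 e2 hm0'
  have hPm : PP m := hP.dvd ⟨m', hm⟩
  have hPm' : PP m' := hP.dvd ⟨m, by rw [hm]; ring⟩
  have g3 := mod4_of_PP (hPm'.dvd ⟨n4, hm2⟩) f3 ho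
  have g4 := mod4_of_PP (hPm'.dvd ⟨n3, by rw [hm2]; ring⟩) f4 (by omega)
  have hu : u % 2 = 1 := by omega
  have hve : v % 2 = 0 := by omega
  refine ⟨n1, n2, n3, n4, α, β, γ, δ, by rw [hm, hm1, hm2], ?_, ?_, ?_, ?_, f1, f2, f3, by omega⟩
  · by_contra hcon
    have : 2 ∣ u := by rw [f1]; exact (dvd_pow (by omega : 2 ∣ α) two_ne_zero).mul_left _
    omega
  · by_contra hcon
    have hn2 := (hPm.dvd ⟨n1, by rw [hm1]; ring⟩ : PP n2).odd (by rintro rfl; simp at f2; omega)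
    have hb : Odd β := Nat.odd_iff.2 (by omega)
    have : Odd v := by rw [f2]; exact hn2.mul hb.pow
    rw [Nat.odd_iff] at this; omega
  · rcases Nat.eq_zero_or_pos β with h0 | h0
    · subst h0; simp at f2; omega
    · exact h0
  · rcases Nat.eq_zero_or_pos δ with h0 | h0
    · subst h0; simp at f4; omega
    · exact h0

theorem pyth_uv {n x y A B : ℕ} (hx : x % 2 = 1) (hy : 0 < y) (hA : 0 < A) (hxy : Nat.Coprime x y)
    (h1 : x ^ 2 + y ^ 2 = A ^ 2) (h2 : 2 * (x * y) = n * (2 * B) ^ 2) :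
    ∃ u v : ℕ, Nat.Coprime u v ∧ 0 < v ∧ v < u ∧ (u + v) % 2 = 1 ∧ u * v * ((u + v) * (u - v)) = n * B ^ 2 ∧
      A = u ^ 2 + v ^ 2 := by
  have ht : PythagoreanTriple (x : ℤ) y A := by
    unfold PythagoreanTriple
    have : (x : ℤ) ^ 2 + y ^ 2 = A ^ 2 := by exact_mod_cast h1
    linear_combination this
  obtain ⟨u, v, e1, e2, e3, e4, e5, e6⟩ := ht.coprime_classification' (by simpa using hxy) (by omega) (by omega)
  have hy' : (0 : ℤ) < 2 * u * v := by rw [← e2]; exact_mod_cast hy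
  have hu : 0 < u := by
    rcases e6.eq_or_lt with h | h
    · rw [← h] at hy'; simp at hy'
    · exact h
  have hv : 0 < v := by
    by_contra hcon
    have := mul_nonneg (by positivity : 0 ≤ 2 * u) (by omega : 0 ≤ -v)
    linarith
  have hvu : v < u := by
    have : (0 : ℤ) < u ^ 2 - v ^ 2 := by rw [← e1]; omega
    nlinarith
  lift u to ℕ using hu.le
  lift v to ℕ using hv.le
  have hle : v ≤ u := by omega
  refine ⟨u, v, by simpa using e4, by omega, by omega, by omega, ?_, by exact_mod_cast e3⟩
  have i2 : (2 : ℤ) * (x * y) = n * (2 * B) ^ 2 := by exact_mod_cast h2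
  rw [e1, e2] at i2
  zify [hle]
  linarith

set_option maxHeartbeats 1600000 in
theorem descent {n : ℕ} (hn8 : n % 8 = 1) (hn : Squarefree n) (hP : PP n) (N : ℕ) :
    ∀ A B C1 C2 : ℕ, A = N → 0 < B → A ^ 2 + n * B ^ 2 = C1 ^ 2 → A ^ 2 = n * B ^ 2 + C2 ^ 2 →
    ∃ n1 n2 n3 n4 α β γ δ : ℕ, n1 * n2 * (n3 * n4) = n ∧ α % 2 = 1 ∧ β % 2 = 0 ∧ 0 < β ∧ 0 < δ ∧
      Nat.Coprime (n1 * α ^ 2) (n2 * β ^ 2) ∧ n1 * α ^ 2 + n2 * β ^ 2 = n3 * γ ^ 2 ∧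
      n1 * α ^ 2 = n2 * β ^ 2 + n4 * δ ^ 2 ∧ ¬ (n1 = 1 ∧ n3 = 1 ∧ n4 = 1) := by
  induction N using Nat.strong_induction_on with
  | _ N ih =>
  intro A B C1 C2 hAN hB h1 h2
  have hn0 := Nat.pos_of_ne_zero hn.ne_zero
  have hnB : 0 < n * B ^ 2 := by positivity
  have hA : 0 < A := by
    rcases Nat.eq_zero_or_pos A with h | h
    · subst h; simp at h2; omega
    · exact h
  by_cases hg : Nat.gcd A B = 1
  swap
  · obtain ⟨a, b, -, ha, hb⟩ := Nat.exists_coprime A B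
    have hg0 : 0 < Nat.gcd A B := Nat.gcd_pos_of_pos_left _ hA
    generalize Nat.gcd A B = g at *
    have d1 : g ∣ C1 := by
      rw [← Nat.pow_dvd_pow_iff two_ne_zero, ← h1, ha, hb]
      exact ⟨a ^ 2 + n * b ^ 2, by ring⟩
    have d2 : g ∣ C2 := by
      rw [← Nat.pow_dvd_pow_iff two_ne_zero]
      have : g ^ 2 ∣ n * B ^ 2 + C2 ^ 2 := by rw [← h2, ha]; exact ⟨a ^ 2, by ring⟩
      exact (Nat.dvd_add_right (by rw [hb]; exact ⟨n * b ^ 2, by ring⟩)).1 this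
    obtain ⟨c1, rfl⟩ := d1
    obtain ⟨c2, rfl⟩ := d2
    have hg2 : 0 < g ^ 2 := by positivity
    refine ih a ?_ a b c1 c2 rfl ?_ ?_ ?_
    · rw [← hAN, ha]
      have ha0 : 0 < a := by
        rcases Nat.eq_zero_or_pos a with h | h
        · subst h; simp at ha; omega
        · exact h
      nlinarith [(by omega : 2 ≤ g)]
    · rcases Nat.eq_zero_or_pos b with h | h
      · subst h; simp at hb; omega
      · exact h
    · refine Nat.eq_of_mul_eq_mul_left hg2 ?_
      rw [ha, hb] at h1; linarith
    · refine Nat.eq_of_mul_eq_mul_left hg2 ?_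
      rw [ha, hb] at h2; linarith
  · have sq8 : ∀ t : ℕ, t ^ 2 % 8 = 0 ∧ t % 2 = 0 ∨ t ^ 2 % 8 = 4 ∧ t % 2 = 0 ∨ t ^ 2 % 8 = 1 ∧ t % 2 = 1 := by
      intro t
      rw [Nat.pow_mod]
      have : t % 8 < 8 := Nat.mod_lt _ (by norm_num)
      have h' : t % 2 = (t % 8) % 2 := by omega
      rw [h']
      interval_cases t % 8 <;> simp
    have hnB8 : n * B ^ 2 % 8 = B ^ 2 % 8 := by rw [Nat.mul_mod, hn8]; simp
    have hpar : A % 2 = 1 ∧ B % 2 = 0 ∧ C1 % 2 = 1 ∧ C2 % 2 = 1 := by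
      have hnot : ¬ (A % 2 = 0 ∧ B % 2 = 0) := by
        rintro ⟨a, b⟩
        have := Nat.dvd_gcd (Nat.dvd_of_mod_eq_zero a) (Nat.dvd_of_mod_eq_zero b)
        rw [hg] at this; omega
      rcases sq8 A with h | h | h <;> rcases sq8 B with h' | h' | h' <;> rcases sq8 C1 with h3 | h3 | h3 <;>
        rcases sq8 C2 with h4 | h4 | h4 <;> omega
    obtain ⟨pA, pB, p1, p2⟩ := hpar
    have hC : C2 < C1 := by
      have : C2 ^ 2 < C1 ^ 2 := by omega
      exact lt_of_pow_lt_pow_left₀ 2 (by omega) this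
    obtain ⟨y, hy⟩ : ∃ y, C1 = C2 + 2 * y := ⟨(C1 - C2) / 2, by omega⟩
    obtain ⟨b, hb⟩ : ∃ b, B = 2 * b := ⟨B / 2, by omega⟩
    have hy0 : 0 < y := by omega
    have i1 : (A : ℤ) ^ 2 + n * B ^ 2 = C1 ^ 2 := by exact_mod_cast h1
    have i2 : (A : ℤ) ^ 2 = n * B ^ 2 + C2 ^ 2 := by exact_mod_cast h2
    have i3 : (C1 : ℤ) = C2 + 2 * y := by exact_mod_cast hy
    rw [i3] at i1
    have j1 : (C2 + y) ^ 2 + y ^ 2 = A ^ 2 := by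
      have : ((C2 : ℤ) + y) ^ 2 + y ^ 2 = A ^ 2 := by linarith
      exact_mod_cast this
    have j2 : 2 * ((C2 + y) * y) = n * B ^ 2 := by
      have : (2 : ℤ) * ((C2 + y) * y) = n * B ^ 2 := by linarith
      exact_mod_cast this
    have jc : Nat.Coprime (C2 + y) y := by
      rw [Nat.coprime_iff_gcd_eq_one]
      by_contra hcon
      obtain ⟨p, hp, hpg⟩ := Nat.exists_prime_and_dvd hcon
      have a1 := hpg.trans (Nat.gcd_dvd_left _ _)
      have a2 := hpg.trans (Nat.gcd_dvd_right _ _)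
      have a3 : p ∣ A := by
        refine hp.dvd_of_dvd_pow (n := 2) ?_
        rw [← j1]
        exact dvd_add (dvd_pow a1 two_ne_zero) (dvd_pow a2 two_ne_zero)
      have a4 : p * p ∣ n * B ^ 2 := by
        rw [← j2]
        exact (mul_dvd_mul a1 a2).mul_left 2
      have a5 : Nat.Coprime p B := Nat.Coprime.coprime_dvd_left a3 hg
      have a6 : p * p ∣ n := Nat.Coprime.dvd_of_dvd_mul_right
        ((Nat.Coprime.mul_left a5 a5).pow_right 2) a4
      exact hp.one_lt.ne' (Nat.isUnit_iff.1 (hn p a6))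
    rw [hb] at j2
    obtain ⟨u, v, q1, q2, q3, q4, q5, q6⟩ : ∃ u v : ℕ, Nat.Coprime u v ∧ 0 < v ∧ v < u ∧ (u + v) % 2 = 1 ∧
        u * v * ((u + v) * (u - v)) = n * b ^ 2 ∧ A = u ^ 2 + v ^ 2 := by
      rcases Nat.mod_two_eq_zero_or_one y with hyp | hyp
      · exact pyth_uv (by omega) hy0 hA jc j1 j2
      · exact pyth_uv hyp (by omega) hA jc.symm (by linarith) (by linarith)
    obtain ⟨n1, n2, n3, n4, α, β, γ, δ, r1, r2, r3, r4, r5, r6, r7, r8, r9⟩ := desc_uv hn hP q1 q2 q3 q4 q5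
    by_cases htriv : n1 = 1 ∧ n3 = 1 ∧ n4 = 1
    · obtain ⟨rfl, rfl, rfl⟩ := htriv
      simp only [one_mul, mul_one] at r1 r6 r8 r9
      subst r1
      refine ih α ?_ α β γ δ rfl r4 (by rw [← r6, ← r7, r8]) (by rw [← r6, ← r7]; exact r9)
      rw [← hAN, q6]
      have : α ≤ u := by rw [r6]; nlinarith
      nlinarith
    · exact ⟨n1, n2, n3, n4, α, β, γ, δ, r1, r2, r3, r4, r5, by rw [← r6, ← r7]; exact q1,
        by rw [← r6, ← r7]; exact r8, by rw [← r6, ← r7]; exact r9, htriv⟩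


set_option maxHeartbeats 1600000 in
theorem quad_loc {n1 n2 n3 n4 α β γ δ : ℕ} (hsf : Squarefree (n1 * n2 * (n3 * n4))) (hP : PP (n1 * n2 * (n3 * n4)))
    (hc : Nat.Coprime (n1 * α ^ 2) (n2 * β ^ 2)) (h1 : n1 * α ^ 2 + n2 * β ^ 2 = n3 * γ ^ 2)
    (h2 : n1 * α ^ 2 = n2 * β ^ 2 + n4 * δ ^ 2) :
    (∃ X Y Z : ℤ, Z ≠ 0 ∧ ((n3 * n4 : ℕ) : ℤ) * X ^ 2 + ((n1 * n2 : ℕ) : ℤ) * Y ^ 2 = Z ^ 2) ∧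
      jacobiSym 2 (n3 * n4) = 1 := by
  have h0 := hsf.ne_zero
  have hm0 := left_ne_zero_of_mul h0
  have hm0' := right_ne_zero_of_mul h0
  have n10 := left_ne_zero_of_mul hm0
  have n20 := right_ne_zero_of_mul hm0
  have n30 := left_ne_zero_of_mul hm0'
  have n40 := right_ne_zero_of_mul hm0'
  have P1 : PP n1 := hP.dvd ⟨n2 * (n3 * n4), by ring⟩
  have P2 : PP n2 := hP.dvd ⟨n1 * (n3 * n4), by ring⟩
  have P3 : PP n3 := hP.dvd ⟨n1 * n2 * n4, by ring⟩
  have P4 : PP n4 := hP.dvd ⟨n1 * n2 * n3, by ring⟩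
  have i1 : (n1 : ℤ) * α ^ 2 + n2 * β ^ 2 = n3 * γ ^ 2 := by exact_mod_cast h1
  have i2 : (n1 : ℤ) * α ^ 2 = n2 * β ^ 2 + n4 * δ ^ 2 := by exact_mod_cast h2
  have cop : ∀ p : ℕ, p.Prime → (p : ℤ) ∣ n1 * α ^ 2 → (p : ℤ) ∣ n2 * β ^ 2 → False := by
    intro p hp a b
    have a' : p ∣ n1 * α ^ 2 := by exact_mod_cast a
    have b' : p ∣ n2 * β ^ 2 := by exact_mod_cast b
    exact hp.one_lt.ne' (Nat.eq_one_of_dvd_coprimes hc a' b')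
  have key : ∀ p : ℕ, p.Prime → ∀ a b : ℤ, ¬ (p : ℤ) ∣ a * b ^ 2 → ¬ (p : ℤ) ∣ a ∧ ¬ (p : ℤ) ∣ b := by
    intro p hp a b h
    exact ⟨fun h' => h (h'.mul_right _), fun h' => h ((dvd_pow h' two_ne_zero).mul_left _)⟩
  have two : ∀ p m : ℕ, p.Prime → PP m → p ∣ m → ∀ t : ℤ, (p : ℤ) ∣ 2 * t → (p : ℤ) ∣ t := by
    intro p m hp hPm hd t ht
    exact ((Nat.prime_iff_prime_int.1 hp).dvd_or_dvd ht).resolve_left (hPm.ndvd_two hp hd)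
  have l1 : ∀ p : ℕ, p.Prime → p ∣ n1 → jacobiSym (n3 * n4) p = 1 := by
    intro p hp hd
    have hd' : (p : ℤ) ∣ n1 * α ^ 2 := (Int.natCast_dvd_natCast.2 hd).mul_right _
    have hnd : ¬ (p : ℤ) ∣ n4 * δ ^ 2 := by
      intro h
      refine cop p hp hd' ?_
      have := dvd_sub hd' h
      rwa [show (n1 : ℤ) * α ^ 2 - n4 * δ ^ 2 = n2 * β ^ 2 by linear_combination i2] at this
    obtain ⟨k1, k2⟩ := key p hp _ _ hnd
    have := jac_loc (a := n3) (b := -n4) (x := γ) (y := δ) hp (by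
      rw [show (n3 : ℤ) * γ ^ 2 - -n4 * δ ^ 2 = 2 * (n1 * α ^ 2) by linear_combination -i1 - i2]
      exact hd'.mul_left 2) (by rwa [dvd_neg]) k2
    rwa [mul_neg, jac_neg (P1.dvd hd) hp.ne_zero] at this
  have l2 : ∀ p : ℕ, p.Prime → p ∣ n2 → jacobiSym (n3 * n4) p = 1 := by
    intro p hp hd
    have hd' : (p : ℤ) ∣ n2 * β ^ 2 := (Int.natCast_dvd_natCast.2 hd).mul_right _
    have hnd : ¬ (p : ℤ) ∣ n4 * δ ^ 2 := by
      intro h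
      refine cop p hp ?_ hd'
      rw [i2]; exact dvd_add hd' h
    obtain ⟨k1, k2⟩ := key p hp _ _ hnd
    exact jac_loc (a := n3) (b := n4) (x := γ) (y := δ) hp (by
      rw [show (n3 : ℤ) * γ ^ 2 - n4 * δ ^ 2 = 2 * (n2 * β ^ 2) by linear_combination -i1 + i2]
      exact hd'.mul_left 2) k1 k2
  have l3 : ∀ p : ℕ, p.Prime → p ∣ n3 → jacobiSym (n1 * n2) p = 1 ∧ jacobiSym (2 * n1 * n4) p = 1 := by
    intro p hp hd
    have hd' : (p : ℤ) ∣ n3 * γ ^ 2 := (Int.natCast_dvd_natCast.2 hd).mul_right _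
    have hnd : ¬ (p : ℤ) ∣ n2 * β ^ 2 := by
      intro h
      refine cop p hp ?_ h
      have := dvd_sub hd' h
      rwa [show (n3 : ℤ) * γ ^ 2 - n2 * β ^ 2 = n1 * α ^ 2 by linear_combination -i1] at this
    have hnd4 : ¬ (p : ℤ) ∣ n4 * δ ^ 2 := by
      intro h
      refine hnd (two p n3 hp P3 hd _ ?_)
      have := dvd_sub hd' h
      rwa [show (n3 : ℤ) * γ ^ 2 - n4 * δ ^ 2 = 2 * (n2 * β ^ 2) by linear_combination -i1 + i2] at this
    obtain ⟨k1, k2⟩ := key p hp _ _ hnd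
    obtain ⟨k3, k4⟩ := key p hp _ _ hnd4
    constructor
    · have := jac_loc (a := n1) (b := -n2) (x := α) (y := β) hp (by
        rw [show (n1 : ℤ) * α ^ 2 - -n2 * β ^ 2 = n3 * γ ^ 2 by linear_combination i1]
        exact hd') (by rwa [dvd_neg]) k2
      rwa [mul_neg, jac_neg (P3.dvd hd) hp.ne_zero] at this
    · exact jac_loc (a := 2 * n1) (b := n4) (x := α) (y := δ) hp (by
        rw [show 2 * (n1 : ℤ) * α ^ 2 - n4 * δ ^ 2 = n3 * γ ^ 2 by linear_combination i1 + i2]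
        exact hd') k3 k4
  have l4 : ∀ p : ℕ, p.Prime → p ∣ n4 → jacobiSym (n1 * n2) p = 1 ∧ jacobiSym (2 * n1 * n3) p = 1 := by
    intro p hp hd
    have hd' : (p : ℤ) ∣ n4 * δ ^ 2 := (Int.natCast_dvd_natCast.2 hd).mul_right _
    have hnd : ¬ (p : ℤ) ∣ n2 * β ^ 2 := by
      intro h
      refine cop p hp ?_ h
      rw [i2]; exact dvd_add h hd'
    have hnd3 : ¬ (p : ℤ) ∣ n3 * γ ^ 2 := by
      intro h
      refine hnd (two p n4 hp P4 hd _ ?_)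
      have := dvd_sub h hd'
      rwa [show (n3 : ℤ) * γ ^ 2 - n4 * δ ^ 2 = 2 * (n2 * β ^ 2) by linear_combination -i1 + i2] at this
    obtain ⟨k1, k2⟩ := key p hp _ _ hnd
    obtain ⟨k3, k4⟩ := key p hp _ _ hnd3
    constructor
    · exact jac_loc (a := n1) (b := n2) (x := α) (y := β) hp (by
        rw [show (n1 : ℤ) * α ^ 2 - n2 * β ^ 2 = n4 * δ ^ 2 by linear_combination i2]
        exact hd') k1 k2
    · exact jac_loc (a := 2 * n1) (b := n3) (x := α) (y := γ) hp (by
        rw [show 2 * (n1 : ℤ) * α ^ 2 - n3 * γ ^ 2 = n4 * δ ^ 2 by linear_combination i1 + i2]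
        exact hd') k3 k4
  refine ⟨leg_kernel (by rwa [mul_comm] at hsf) ?_ ?_, ?_⟩
  · intro p hp hd
    push_cast
    rcases hp.dvd_mul.1 hd with h | h
    · exact (l3 p hp h).1
    · exact (l4 p hp h).1
  · intro p hp hd
    push_cast
    rcases hp.dvd_mul.1 hd with h | h
    · exact l1 p hp h
    · exact l2 p hp h
  · have e1 := jac_prod_one n10 l1
    have e3 := jac_prod_one n30 (fun p hp hd => (l3 p hp hd).2)
    have e4 := jac_prod_one n40 (fun p hp hd => (l4 p hp hd).2)
    rw [jacobiSym.mul_left, jac_comm P3 n30 P1 n10, jac_comm P4 n40 P1 n10] at e1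
    rw [jacobiSym.mul_left, jacobiSym.mul_left] at e3 e4
    rw [jac_comm P4 n40 P3 n30] at e3
    rw [jac_mul_right n30 n40]
    have hs : (jacobiSym n3 n4 : ℤ) ^ 2 = 1 := by
      have : jacobiSym n3 n4 ≠ 0 := by
        intro h; rw [h] at e4; simp at e4
      rcases jacobiSym.trichotomy n3 n4 with h | h | h
      · exact absurd h this
      · rw [h]; norm_num
      · rw [h]; norm_num
    generalize jacobiSym 2 n3 = a at *
    generalize jacobiSym 2 n4 = b at *
    generalize jacobiSym (n1 : ℤ) n3 = c at *
    generalize jacobiSym (n1 : ℤ) n4 = d at *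
    generalize jacobiSym (n3 : ℤ) n4 = f at *
    have : (a * b) * (c * d) * f ^ 2 = 1 := by linear_combination b * d * f * e3 + e4
    rw [hs, e1] at this
    linarith


theorem cop_of_sq {a b α β : ℕ} (hc : Nat.Coprime (a * α ^ 2) (b * β ^ 2)) : Nat.Coprime (a * α) (b * β) :=
  (hc.coprime_dvd_left ⟨α, by ring⟩).coprime_dvd_right ⟨β, by ring⟩

theorem mod8_pair {f f' n : ℕ} (hn8 : n % 8 = 1) (hP : PP n) (hf : f * f' = n) :
    (f % 8 = 1 ∧ f' % 8 = 1) ∨ (f % 8 = 5 ∧ f' % 8 = 5) := by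
  have h0 : f * f' ≠ 0 := by omega
  have h1 := (hP.dvd ⟨f', hf.symm⟩ : PP f).mod4 (left_ne_zero_of_mul h0)
  have h2 := (hP.dvd ⟨f, by rw [← hf]; ring⟩ : PP f').mod4 (right_ne_zero_of_mul h0)
  have h3 : (f % 8) * (f' % 8) % 8 = 1 := by rw [← Nat.mul_mod, hf, hn8]
  have a1 : f % 8 = 1 ∨ f % 8 = 5 := by omega
  have a2 : f' % 8 = 1 ∨ f' % 8 = 5 := by omega
  rcases a1 with a1 | a1 <;> rcases a2 with a2 | a2 <;> simp_all

theorem jac2_pair {f f' n : ℕ} (hn8 : n % 8 = 1) (hP : PP n) (hf : f * f' = n) :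
    jacobiSym 2 f = jacobiSym 2 f' ∧ (jacobiSym 2 f = 1 ∧ f % 8 = 1 ∨ jacobiSym 2 f = -1 ∧ f % 8 = 5) := by
  rcases mod8_pair hn8 hP hf with ⟨h1, h2⟩ | ⟨h1, h2⟩ <;>
  · rw [jac_two_nat (by omega), jac_two_nat (by omega)]
    simp [h1, h2]

theorem fin1 {n n1 n2 n3 n4 α β γ δ f f' : ℕ} (hn8 : n % 8 = 1) (hn : Squarefree n) (hP : PP n)
    (hq : n1 * n2 * (n3 * n4) = n) (hα : α % 2 = 1) (hβ : β % 2 = 0) (hβ0 : 0 < β) (hδ0 : 0 < δ)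
    (hc : Nat.Coprime (n1 * α ^ 2) (n2 * β ^ 2)) (h1 : n1 * α ^ 2 + n2 * β ^ 2 = n3 * γ ^ 2)
    (h2 : n1 * α ^ 2 = n2 * β ^ 2 + n4 * δ ^ 2) (hnt : ¬ (n1 = 1 ∧ n3 = 1 ∧ n4 = 1))
    (hf : f * f' = n)
    (N1 : ∀ m m' : ℕ, m * m' = n → ∀ X Y Z : ℤ, Z ≠ 0 → m * X ^ 2 + m' * Y ^ 2 = Z ^ 2 → m = 1 ∨ m = n)
    (N2 : ∀ m m' : ℕ, m * m' = n → ∀ X Y Z : ℤ, Z ≠ 0 → m * X ^ 2 + m' * Y ^ 2 = 2 * Z ^ 2 → m = f ∨ m = f')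
    {x y : ℤ} {z : ℕ} (hz : 0 < z) (hxy : IsCoprime x y) (h : f * x ^ 2 + f' * y ^ 2 = 2 * (z : ℤ) ^ 2) :
    jacobiSym 2 f = if z % 4 = 1 then 1 else -1 := by
  have hn0 := hn.ne_zero
  have hγ0 : γ ≠ 0 := by
    rintro rfl
    have hn2 : n2 ≠ 0 := by rintro rfl; simp at hq; omega
    have : 0 < n2 * β ^ 2 := by positivity
    simp at h1; omega
  have hγz : (γ : ℤ) ≠ 0 := by exact_mod_cast hγ0
  have i1 : (n1 : ℤ) * α ^ 2 + n2 * β ^ 2 = n3 * γ ^ 2 := by exact_mod_cast h1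
  have i2 : (n1 : ℤ) * α ^ 2 = n2 * β ^ 2 + n4 * δ ^ 2 := by exact_mod_cast h2
  obtain ⟨⟨X, Y, Z, hZ, hXYZ⟩, -⟩ := quad_loc (hq.symm ▸ hn) (hq.symm ▸ hP) hc h1 h2
  rcases N1 (n3 * n4) (n1 * n2) (by rw [← hq]; ring) X Y Z hZ hXYZ with hm | hm
  · have h3 : n3 = 1 := Nat.eq_one_of_mul_eq_one_right hm
    have h4 : n4 = 1 := Nat.eq_one_of_mul_eq_one_left hm
    subst h3; subst h4
    simp only [mul_one, one_mul, Nat.cast_one] at *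
    rcases N1 n1 n2 hq α β γ hγz i1 with h5 | h5
    · exact absurd h5 (by simpa using hnt)
    · subst h5
      have h6 : n2 = 1 := by
        have : n1 * n2 = n1 * 1 := by rw [hq, mul_one]
        exact Nat.eq_of_mul_eq_mul_left (Nat.pos_of_ne_zero hn0) this
      subst h6
      have hcc := cop_of_sq hc
      simp only [one_mul] at hcc h1 h2
      exact case1a (δ := δ) hn8 hn hP hf hα hβ hcc hβ0 h1 (by omega) hxy h
  · have h12 : n1 * n2 = 1 := by
      have : n1 * n2 * n = 1 * n := by rw [one_mul, ← hm]; rw [hq, hm]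
      exact Nat.eq_of_mul_eq_mul_right (Nat.pos_of_ne_zero hn0) this
    have h3 : n1 = 1 := Nat.eq_one_of_mul_eq_one_right h12
    have h4 : n2 = 1 := Nat.eq_one_of_mul_eq_one_left h12
    subst h3; subst h4
    simp only [mul_one, one_mul, Nat.cast_one] at *
    have hα0 : (α : ℤ) ≠ 0 := by omega
    have hcc : Nat.Coprime α β := by simpa using hc
    rcases N2 n3 n4 hm γ δ α hα0 (by linarith) with h5 | h5
    · subst h5
      have h6 : n4 = f' := by
        have : n3 * n4 = n3 * f' := by rw [hm, hf]
        exact Nat.eq_of_mul_eq_mul_left (Nat.pos_of_ne_zero (by rintro rfl; simp at hf; omega)) this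
      subst h6; subst hf
      exact case1b hn hP hn8 hα hβ hcc hδ0 h1 h2 hz hxy h
    · subst h5
      have h6 : n4 = f := by
        have : n3 * n4 = n3 * f := by rw [hm, ← hf]; ring
        exact Nat.eq_of_mul_eq_mul_left (Nat.pos_of_ne_zero (by rintro rfl; simp at hf; omega)) this
      subst h6
      rw [(jac2_pair hn8 hP hf).1]
      subst hm
      exact case1b hn hP hn8 hα hβ hcc hδ0 h1 h2 hz hxy.symm (by linarith)

theorem fin2 {n n1 n2 n3 n4 α β γ δ f f' : ℕ} (hn8 : n % 8 = 1) (hn : Squarefree n) (hP : PP n)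
    (hq : n1 * n2 * (n3 * n4) = n) (hα : α % 2 = 1) (hβ : β % 2 = 0) (hβ0 : 0 < β)
    (hc : Nat.Coprime (n1 * α ^ 2) (n2 * β ^ 2)) (h1 : n1 * α ^ 2 + n2 * β ^ 2 = n3 * γ ^ 2)
    (h2 : n1 * α ^ 2 = n2 * β ^ 2 + n4 * δ ^ 2) (hnt : ¬ (n1 = 1 ∧ n3 = 1 ∧ n4 = 1))
    (hf : f * f' = n) (hf8 : f % 8 = 5)
    (N1 : ∀ m m' : ℕ, m * m' = n → ∀ X Y Z : ℤ, Z ≠ 0 → m * X ^ 2 + m' * Y ^ 2 = Z ^ 2 →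
      m = 1 ∨ m = n ∨ m = f ∨ m = f')
    (N2 : ∀ m m' : ℕ, m * m' = n → ∀ X Y Z : ℤ, Z ≠ 0 → m * X ^ 2 + m' * Y ^ 2 = 2 * Z ^ 2 → False)
    {x y : ℤ} {z : ℕ} (hz : 0 < z) (hz4 : z % 4 = 1) (hxy : IsCoprime x y)
    (h : f * x ^ 2 + f' * y ^ 2 = (z : ℤ) ^ 2) : False := by
  have hn0 := hn.ne_zero
  have hγ0 : γ ≠ 0 := by
    rintro rfl
    have hn2 : n2 ≠ 0 := by rintro rfl; simp at hq; omega
    have : 0 < n2 * β ^ 2 := by positivity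
    simp at h1; omega
  have hγz : (γ : ℤ) ≠ 0 := by exact_mod_cast hγ0
  have hf8' : f' % 8 = 5 := by
    rcases mod8_pair hn8 hP hf with h | h <;> omega
  have i1 : (n1 : ℤ) * α ^ 2 + n2 * β ^ 2 = n3 * γ ^ 2 := by exact_mod_cast h1
  have i2 : (n1 : ℤ) * α ^ 2 = n2 * β ^ 2 + n4 * δ ^ 2 := by exact_mod_cast h2
  obtain ⟨⟨X, Y, Z, hZ, hXYZ⟩, hJ⟩ := quad_loc (hq.symm ▸ hn) (hq.symm ▸ hP) hc h1 h2
  rcases N1 (n3 * n4) (n1 * n2) (by rw [← hq]; ring) X Y Z hZ hXYZ with hm | hm | hm | hm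
  · have h3 : n3 = 1 := Nat.eq_one_of_mul_eq_one_right hm
    have h4 : n4 = 1 := Nat.eq_one_of_mul_eq_one_left hm
    subst h3; subst h4
    simp only [mul_one, one_mul, Nat.cast_one] at *
    have hcc := cop_of_sq hc
    rcases N1 n1 n2 hq α β γ hγz i1 with h5 | h5 | h5 | h5
    · exact absurd h5 (by simpa using hnt)
    · subst h5
      have h6 : n2 = 1 := by
        have : n1 * n2 = n1 * 1 := by rw [hq, mul_one]
        exact Nat.eq_of_mul_eq_mul_left (Nat.pos_of_ne_zero hn0) this
      subst h6
      simp only [one_mul] at hcc h1 h2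
      exact case2a (δ := δ) hn8 hn hP hf hf8 hf8' hα hβ hcc hβ0 h1 (by omega) hz hz4 hxy h
    · subst h5
      have h6 : n2 = f' := by
        have : n1 * n2 = n1 * f' := by rw [hq, hf]
        exact Nat.eq_of_mul_eq_mul_left (by omega) this
      subst h6; subst hf
      exact case2b (δ := δ) hn hP hf8 hf8' hα hβ hβ0 hcc h1 (by omega) hz hz4 hxy h
    · subst h5
      have h6 : n2 = f := by
        have : n1 * n2 = n1 * f := by rw [hq, ← hf]; ring
        exact Nat.eq_of_mul_eq_mul_left (by omega) this
      subst h6; subst hq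
      exact case2b (δ := δ) hn hP hf8' hf8 hα hβ hβ0 hcc h1 (by omega) hz hz4 hxy.symm (by linarith)
  · have h12 : n1 * n2 = 1 := by
      have : n1 * n2 * n = 1 * n := by rw [one_mul, ← hm]; rw [hq, hm]
      exact Nat.eq_of_mul_eq_mul_right (Nat.pos_of_ne_zero hn0) this
    have h3 : n1 = 1 := Nat.eq_one_of_mul_eq_one_right h12
    have h4 : n2 = 1 := Nat.eq_one_of_mul_eq_one_left h12
    subst h3; subst h4
    simp only [mul_one, one_mul, Nat.cast_one] at *
    have hα0 : (α : ℤ) ≠ 0 := by omega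
    exact N2 n3 n4 hm γ δ α hα0 (by linarith)
  · rw [hm, jac_two_nat (by omega)] at hJ
    simp [hf8] at hJ
  · rw [hm, jac_two_nat (by omega)] at hJ
    simp [hf8'] at hJ

/-- In the second case `f ≡ 5 mod 8`. -/
theorem case2_mod {n f f' : ℕ} (hn8 : n % 8 = 1) (hn : Squarefree n) (hP : PP n) (hf : f * f' = n)
    (N1 : ∀ m m' : ℕ, m * m' = n → ∀ X Y Z : ℤ, Z ≠ 0 → m * X ^ 2 + m' * Y ^ 2 = Z ^ 2 →
      m = 1 ∨ m = n ∨ m = f ∨ m = f')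
    (N2 : ∀ m m' : ℕ, m * m' = n → ∀ X Y Z : ℤ, Z ≠ 0 → m * X ^ 2 + m' * Y ^ 2 = 2 * Z ^ 2 → False) :
    f % 8 = 5 := by
  obtain ⟨j1, j2⟩ := jac2_pair hn8 hP hf
  rcases j2 with ⟨j2, -⟩ | ⟨-, j2⟩
  swap
  · exact j2
  exfalso
  have hn1 : jacobiSym 2 n = 1 := by rw [jac_two_nat (by omega)]; simp [hn8]
  obtain ⟨m, m', hm, c1, c2⟩ := LA (a := 2) hn hP (by
      rw [Int.isCoprime_iff_gcd_eq_one]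
      have : Nat.Coprime 2 n := by rw [Nat.coprime_two_left, Nat.odd_iff]; omega
      exact_mod_cast this) (by
      intro m m' hm h1 h2
      obtain ⟨X, Y, Z, hZ, hXYZ⟩ := leg_kernel (hm.symm ▸ hn) h1 h2
      rcases N1 m m' hm X Y Z hZ hXYZ with h | h | h | h
      · subst h; simp
      · rw [h, hn1]
      · rw [h, j2]
      · rw [h, ← j1, j2])
  have hsf : Squarefree (m * m') := hm.symm ▸ hn
  obtain ⟨hc, hsm, hsm'⟩ := Nat.squarefree_mul_iff.1 hsf
  have hm2 : (m * m') % 2 = 1 := by rw [hm]; omega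
  have ho : Odd m ∧ Odd m' := by rw [← Nat.odd_iff] at hm2; exact Nat.odd_mul.1 hm2
  obtain ⟨X, Y, Z, hZ, hXYZ⟩ := legendre_jac (a := m) (b := m') (c := 2) hsm hsm' Nat.prime_two.squarefree hc
    ((Nat.coprime_two_right).2 ho.1) ((Nat.coprime_two_right).2 ho.2)
    (fun p hp hd => by rw [← c1 p hp hd]; push_cast; ring_nf)
    (fun p hp hd => by rw [← c2 p hp hd]; push_cast; ring_nf)
    (fun p hp hd => by
      have := (Nat.prime_dvd_prime_iff_eq hp Nat.prime_two).1 hd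
      subst this
      have hodd : Odd (m * m') := ho.1.mul ho.2
      have e : jacobiSym (-((m : ℤ) * m')) 2 = jacobiSym 1 2 := jac_congr (by
        obtain ⟨k, hk⟩ := hodd
        have : ((m : ℤ) * m') = 2 * k + 1 := by exact_mod_cast hk
        exact ⟨-k - 1, by rw [this]; push_cast; ring⟩)
      rw [e, jacobiSym.one_left])
  exact N2 m m' hm X Y Z hZ (by exact_mod_cast hXYZ)


theorem rat_four {n : ℕ} (t r s : ℚ) (h1 : t ^ 2 + n = r ^ 2) (h2 : t ^ 2 - n = s ^ 2) :
    ∃ A B C1 C2 : ℕ, 0 < B ∧ A ^ 2 + n * B ^ 2 = C1 ^ 2 ∧ A ^ 2 = n * B ^ 2 + C2 ^ 2 := by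
  have key : ∀ r : ℚ, ∀ m : ℤ, t ^ 2 + m = r ^ 2 → ∃ c : ℤ, t.num ^ 2 + m * (t.den : ℤ) ^ 2 = c ^ 2 := by
    intro r m h
    have hd : (t.den : ℚ) ≠ 0 := by exact_mod_cast t.den_ne_zero
    have ht : (t.num : ℚ) = t * t.den := (Rat.mul_den_eq_num t).symm
    have : IsSquare (((t.num ^ 2 + m * (t.den : ℤ) ^ 2 : ℤ)) : ℚ) := by
      refine ⟨r * t.den, ?_⟩
      push_cast
      rw [ht]
      linear_combination (t.den : ℚ) ^ 2 * h
    obtain ⟨c, hc⟩ := Rat.isSquare_intCast_iff.1 this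
    exact ⟨c, by rw [hc]; ring⟩
  obtain ⟨c1, hc1⟩ := key r n (by exact_mod_cast h1)
  obtain ⟨c2, hc2⟩ := key s (-n) (by push_cast; linarith)
  refine ⟨t.num.natAbs, t.den, c1.natAbs, c2.natAbs, t.den_pos, ?_, ?_⟩
  · zify; simpa using hc1
  · zify; simp only [sq_abs]; linarith

theorem final_of_no_sol {n : ℕ} (hn0 : n ≠ 0)
    (hno : ¬ ∃ A B C1 C2 : ℕ, 0 < B ∧ A ^ 2 + n * B ^ 2 = C1 ^ 2 ∧ A ^ 2 = n * B ^ 2 + C2 ^ 2)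
    (W : WeierstrassCurve.Affine ℚ)
    (hW : W = { a₁ := 0, a₂ := 0, a₃ := 0, a₄ := -(n : ℚ) ^ 2, a₆ := 0 }) :
    Finite W.Point ∧
    ¬∃ a b c : ℚ, 0 < a ∧ 0 < b ∧ 0 < c ∧ a ^ 2 + b ^ 2 = c ^ 2 ∧ a * b / 2 = n := by
  constructor
  · have hy : ∀ x y : ℚ, W.Nonsingular x y → y = 0 ∧ (x = 0 ∨ x = n ∨ x = -n) := by
      intro x y h
      have h1 := (WeierstrassCurve.Affine.equation_iff x y).1 h.1
      rw [hW] at h1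
      simp only [zero_mul, add_zero] at h1
      by_cases hy0 : y = 0
      · refine ⟨hy0, ?_⟩
        rw [hy0] at h1
        have : x * ((x - n) * (x + n)) = 0 := by linear_combination -h1
        rcases mul_eq_zero.1 this with h | h
        · exact Or.inl h
        · rcases mul_eq_zero.1 h with h | h
          · exact Or.inr (Or.inl (by linarith))
          · exact Or.inr (Or.inr (by linarith))
      · exfalso
        apply hno
        refine rat_four ((x ^ 2 + n ^ 2) / (2 * y)) ((x ^ 2 + 2 * n * x - n ^ 2) / (2 * y))
          ((x ^ 2 - 2 * n * x - n ^ 2) / (2 * y)) ?_ ?_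
        · field_simp
          linear_combination 4 * (n : ℚ) * h1
        · field_simp
          linear_combination -4 * (n : ℚ) * h1
    let g : W.Point → Option (ℚ × ℚ) := fun P => match P with
      | .zero => none
      | .some x y _ => some (x, y)
    have hg : Function.Injective g := by
      intro P Q h
      cases P <;> cases Q <;> simp_all [g]
    have hfin : (Set.range g).Finite := by
      refine Set.Finite.subset (Set.toFinite ({none, some (0, 0), some ((n : ℚ), 0), some (-(n : ℚ), 0)} : Set (Option (ℚ × ℚ)))) ?_
      rintro _ ⟨P, rfl⟩
      cases P with
      | zero => simp [g]
      | some x y h =>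
        obtain ⟨rfl, h1⟩ := hy x y h
        rcases h1 with rfl | rfl | rfl <;> simp [g]
    exact Set.finite_univ_iff.1 (Set.Finite.of_finite_image (by rwa [Set.image_univ]) hg.injOn)
  · rintro ⟨a, b, c, -, -, -, h1, h2⟩
    apply hno
    refine rat_four (c / 2) ((a + b) / 2) ((a - b) / 2) ?_ ?_
    · rw [← h2]; linear_combination -h1 / 4
    · rw [← h2]; linear_combination -h1 / 4

open NumberField

theorem no_sol (n : ℕ) (hn8 : n % 8 = 1) (hnsf : Squarefree n)
    (hpf : ∀ q : ℕ, q.Prime → q ∣ n → q % 4 = 1)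
    (K : Type) [Field K] [NumberField K] (hdeg : Module.finrank ℚ K = 2)
    (s : K) (hs : s ^ 2 = -(n : K))
    (h4 : Nat.card {c : ClassGroup (𝓞 K) // c ^ 2 = 1 ∧ ∃ b, c = b ^ 2} = 2)
    (e : ℕ) (henorm : ∃ x : K, x ≠ 0 ∧ Algebra.norm ℚ x = (e : ℚ))
    (he1 : e ≠ 1) (hen : e ≠ n)
    (f f' : ℕ) (hf : f * f' = n) (hde : e = f ∨ e = 2 * f)
    (h8 : Nat.card {c : ClassGroup (𝓞 K) // c ^ 2 = 1 ∧ ∃ b, c = b ^ 4} = 2 ↔ f % 8 = 5) :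
    ¬ ∃ A B C1 C2 : ℕ, 0 < B ∧ A ^ 2 + n * B ^ 2 = C1 ^ 2 ∧ A ^ 2 = n * B ^ 2 + C2 ^ 2 := by
  rintro ⟨A, B, C1, C2, hB, g1, g2⟩
  have hP : PP n := hpf
  obtain ⟨n1, n2, n3, n4, α, β, γ, δ, r1, r2, r3, r4, r5, r6, r7, r8, r9⟩ :=
    descent hn8 hnsf hP A A B C1 C2 rfl hB g1 g2
  have hn1 : 1 < n := by
    by_contra hcon
    have : n = 1 := by omega
    rw [this] at r1
    have a1 := Nat.eq_one_of_mul_eq_one_right r1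
    have a2 := Nat.eq_one_of_mul_eq_one_left r1
    exact r9 ⟨Nat.eq_one_of_mul_eq_one_right a1, Nat.eq_one_of_mul_eq_one_right a2,
      Nat.eq_one_of_mul_eq_one_left a2⟩
  have hn4 : n % 4 = 1 := by omega
  obtain ⟨⟨q⟩, hnorm⟩ := QF_exists hnsf hn4 K hdeg s hs
  obtain ⟨X, Y, Z, hZ, hXYZ⟩ := hnorm e henorm
  rcases hde with rfl | rfl
  · obtain ⟨N1, N2, -, N4⟩ := q.case2 hnsf hn4 hn1 h4 hf he1 hen hZ hXYZ
    have hf8 := case2_mod hn8 hnsf hP hf N1 N2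
    obtain ⟨x, y, w, hw, hxy, h⟩ := N4 (h8.2 hf8)
    have hw8 : w ^ 2 % 4 = 1 := by rcases (by omega : w % 4 = 1 ∨ w % 4 = 3) with h | h <;> simp [Nat.pow_mod, h]
    exact fin2 hn8 hnsf hP r1 r2 r3 r4 r6 r7 r8 r9 hf hf8 N1 N2 (z := w ^ 2) (by omega) hw8 hxy
      (by rw [h]; push_cast; ring)
  · obtain ⟨N1, N2, ⟨x, y, z, hz, hxy, h⟩, N4, N5⟩ := q.case1 hnsf hn4 hP hn1 h4 hf hZ hXYZ
    have main := @fin1 n n1 n2 n3 n4 α β γ δ f f' hn8 hnsf hP r1 r2 r3 r4 r5 r6 r7 r8 r9 hf N1 N2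
    rcases (jac2_pair hn8 hP hf).2 with ⟨j1, j2⟩ | ⟨j1, j2⟩
    · have := main hz hxy h
      rw [j1] at this
      have hz4 : z % 4 = 1 := by
        by_contra hcon
        rw [if_neg hcon] at this
        norm_num at this
      have := h8.1 (N5 x y z hz hz4 hxy h)
      omega
    · obtain ⟨x, y, w, hw, hxy, h⟩ := N4 (h8.2 j2)
      have hw8 : w ^ 2 % 4 = 1 := by rcases (by omega : w % 4 = 1 ∨ w % 4 = 3) with h | h <;> simp [Nat.pow_mod, h]
      have := main (z := w ^ 2) (by omega) hxy (by rw [h]; push_cast; ring)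
      rw [j1, if_pos hw8] at this
      norm_num at this

theorem stmt_18 (n : ℕ) (hn8 : n % 8 = 1) (hnsf : Squarefree n)
    (hpf : ∀ q : ℕ, q.Prime → q ∣ n → q % 4 = 1)
    (K : Type) [Field K] [NumberField K] (hdeg : Module.finrank ℚ K = 2)
    (s : K) (hs : s ^ 2 = -(n : K))
    -- h₄(n) = 1 : A[2] ∩ 2A has order 2
    (h4 : Nat.card {c : ClassGroup (𝓞 K) // c ^ 2 = 1 ∧ ∃ b, c = b ^ 2} = 2)
    -- e is one of the two elements of D(K) ∩ N(K^×) other than 1 and n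
    (e : ℕ) (hepos : 0 < e) (hesf : Squarefree e) (hedvd : (e : ℤ) ∣ 4 * (n : ℤ))
    (henorm : ∃ x : K, x ≠ 0 ∧ Algebra.norm ℚ x = (e : ℚ))
    (he1 : e ≠ 1) (hen : e ≠ n)
    -- d = d(n) is the larger of the odd parts of e and of its complement
    (d : ℕ) (hdn : d ∣ n) (hdmax : n / d ≤ d)
    (hde : e = d ∨ e = n / d ∨ e = 2 * d ∨ e = 2 * (n / d))
    -- h₈(n) ≡ (d(n) − 1)/4 (mod 2), with h₈(n) ∈ {0,1}
    (h8 : Nat.card {c : ClassGroup (𝓞 K) // c ^ 2 = 1 ∧ ∃ b, c = b ^ 4} = 2 ↔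
      (d - 1) / 4 % 2 = 1)
    (W : WeierstrassCurve.Affine ℚ)
    (hW : W = { a₁ := 0, a₂ := 0, a₃ := 0, a₄ := -(n : ℚ) ^ 2, a₆ := 0 }) :
    Finite W.Point ∧
    ¬∃ a b c : ℚ, 0 < a ∧ 0 < b ∧ 0 < c ∧ a ^ 2 + b ^ 2 = c ^ 2 ∧ a * b / 2 = n := by
  refine final_of_no_sol hnsf.ne_zero ?_ W hW
  have hmul : d * (n / d) = n := Nat.mul_div_cancel' hdn
  have hpair := mod8_pair hn8 hpf hmul
  have h8' : (d - 1) / 4 % 2 = 1 ↔ d % 8 = 5 := by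
    rcases hpair with ⟨h, -⟩ | ⟨h, -⟩ <;> omega
  have h8'' : (d - 1) / 4 % 2 = 1 ↔ (n / d) % 8 = 5 := by
    rw [h8']
    rcases hpair with ⟨h, h'⟩ | ⟨h, h'⟩ <;> simp [h, h']
  rcases hde with h | h | h | h
  · exact no_sol n hn8 hnsf hpf K hdeg s hs h4 e henorm he1 hen d (n / d) hmul (Or.inl h) (h8.trans h8')
  · exact no_sol n hn8 hnsf hpf K hdeg s hs h4 e henorm he1 hen (n / d) d (by rw [mul_comm]; exact hmul) (Or.inl h)
      (h8.trans h8'')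
  · exact no_sol n hn8 hnsf hpf K hdeg s hs h4 e henorm he1 hen d (n / d) hmul (Or.inr h) (h8.trans h8')
  · exact no_sol n hn8 hnsf hpf K hdeg s hs h4 e henorm he1 hen (n / d) d (by rw [mul_comm]; exact hmul) (Or.inr h)
      (h8.trans h8'')
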